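/- Let k be an algebraically closed field and let S = V(f) ⊆ P³ be a smooth surface of degree d ≥ 3 containing exactly d²(d²−3d+3) lines. Then for every line L on S: the set of planes (3-dimensional subspaces of k⁴) that contain L and contain at least one line on S other than L has cardinality exactly d²−2d+2, and each such plane contains exactly d distinct lines on S. -/

import Mathlib

open MvPolynomial

/-- `W` is a line (2-dimensional linear subspace of `k⁴`) lying on the surface `V(f) ⊆ P³`. -/
def IsLineOn {k : Type*} [Field k] (f : MvPolynomial (Fin 4) k)
    (W : Submodule k (Fin 4 → k)) : Prop :=
  Module.finrank k W = 2 ∧ ∀ v ∈ W, MvPolynomial.eval v f = 0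

/-- `f` is a nonzero homogeneous polynomial of degree `d` in `k[x,y,z,w]` such that `f` and its
four partial derivatives have no common zero in `k⁴ ∖ {0}`; i.e. `V(f) ⊆ P³` is a smooth
surface of degree `d`. -/
def IsSmoothSurface {k : Type*} [Field k] (f : MvPolynomial (Fin 4) k) (d : ℕ) : Prop :=
  f ≠ 0 ∧ f.IsHomogeneous d ∧
    ∀ v : Fin 4 → k, v ≠ 0 →
      ¬ (MvPolynomial.eval v f = 0 ∧
         ∀ i : Fin 4, MvPolynomial.eval v (MvPolynomial.pderiv i f) = 0)

section LineExpansion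

variable {k σ A B : Type*} [Field k] [CommRing A] [Algebra k A] [CommRing B] [Algebra k B]

/-- The expansion of `f(u + s v)` as a polynomial in `s`. -/
noncomputable def lineExp (f : MvPolynomial σ k) (u v : σ → A) : Polynomial A :=
  aeval (fun i => Polynomial.C (u i) + Polynomial.X * Polynomial.C (v i)) f

/-- The derivative of `f` at `u` in the direction `v`. -/
noncomputable def dirDeriv [Fintype σ] (f : MvPolynomial σ k) (u v : σ → A) : A :=
  ∑ i, v i * aeval u (pderiv i f)

lemma lineExp_map (f : MvPolynomial σ k) (u v : σ → A) (ψ : A →ₐ[k] B) :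
    (lineExp f u v).map (ψ : A →+* B) = lineExp f (fun i => ψ (u i)) (fun i => ψ (v i)) := by
  have h : (Polynomial.mapAlgHom ψ).comp
      (aeval (fun i => Polynomial.C (u i) + Polynomial.X * Polynomial.C (v i))) =
      aeval (fun i => Polynomial.C (ψ (u i)) + Polynomial.X * Polynomial.C (ψ (v i))) := by
    ext i; simp
  exact congrArg (fun F => F f) h

lemma lineExp_coeff_map (f : MvPolynomial σ k) (u v : σ → A) (ψ : A →ₐ[k] B) (j : ℕ) :
    ψ ((lineExp f u v).coeff j) = (lineExp f (fun i => ψ (u i)) (fun i => ψ (v i))).coeff j := by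
  rw [← lineExp_map, Polynomial.coeff_map]; rfl

lemma lineExp_add (f g : MvPolynomial σ k) (u v : σ → A) :
    lineExp (f + g) u v = lineExp f u v + lineExp g u v := by simp [lineExp]

lemma lineExp_mul (f g : MvPolynomial σ k) (u v : σ → A) :
    lineExp (f * g) u v = lineExp f u v * lineExp g u v := by simp [lineExp]

lemma lineExp_eval (f : MvPolynomial σ k) (u v : σ → A) (s : A) :
    (lineExp f u v).eval s = aeval (fun i => u i + s * v i) f := by
  have h : ((Polynomial.aeval s).restrictScalars k).comp
      (aeval (fun i => Polynomial.C (u i) + Polynomial.X * Polynomial.C (v i))) =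
      (aeval (fun i => u i + s * v i) : MvPolynomial σ k →ₐ[k] A) := by
    ext1 i; simp; ring
  have := congrArg (fun F => F f) h
  simpa [lineExp, Polynomial.aeval_def] using this

lemma lineExp_eval_field (f : MvPolynomial σ k) (u v : σ → k) (s : k) :
    (lineExp f u v).eval s = eval (u + s • v) f := by
  rw [lineExp_eval, ← coe_aeval_eq_eval]; rfl

lemma lineExp_coeff_zero (f : MvPolynomial σ k) (u v : σ → A) :
    (lineExp f u v).coeff 0 = aeval u f := by
  rw [Polynomial.coeff_zero_eq_eval_zero, lineExp_eval]; simp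

lemma lineExp_coeff_one [Fintype σ] (f : MvPolynomial σ k) (u v : σ → A) :
    (lineExp f u v).coeff 1 = dirDeriv f u v := by
  classical
  induction f using MvPolynomial.induction_on with
  | C a => simp [lineExp, dirDeriv]
  | add p q hp hq =>
    rw [lineExp_add, Polynomial.coeff_add, hp, hq]
    simp [dirDeriv, mul_add, Finset.sum_add_distrib]
  | mul_X p i hp =>
    rw [lineExp_mul, Polynomial.coeff_mul, Finset.Nat.antidiagonal_succ]
    have h0 := lineExp_coeff_zero p u v
    have : lineExp (X i : MvPolynomial σ k) u v =
        Polynomial.C (u i) + Polynomial.X * Polynomial.C (v i) := by simp [lineExp]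
    simp only [Finset.Nat.antidiagonal_zero, Finset.map_singleton, Finset.sum_cons,
      Finset.sum_singleton]
    simp only [Function.Embedding.prodMap, Function.Embedding.coeFn_mk, Prod.map, hp, h0, this]
    simp [dirDeriv, Derivation.leibniz, mul_add, Finset.sum_add_distrib, Finset.sum_mul,
      pderiv_X, Pi.single_apply]
    rw [mul_comm]
    congr 1
    · simp [apply_ite]
    · refine Finset.sum_congr rfl fun j _ => by ring

end LineExpansion

section Homogeneous

variable {k σ A : Type*} [Field k] [CommRing A] [Algebra k A]

/-- `p` behaves like the expansion of a form of degree `n` with leading coefficient `c`. -/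
private def ExpansionBound (𝒟 : ℕ → Submodule k A) (a b n : ℕ) (p : Polynomial A) (c : A) : Prop :=
  p.natDegree ≤ n ∧ p.coeff n = c ∧ ∀ j e, j + e = n → p.coeff j ∈ 𝒟 (e * a + j * b)

private lemma ExpansionBound.mul {𝒟 : ℕ → Submodule k A} [SetLike.GradedMonoid 𝒟] {a b n n' : ℕ}
    {p p' : Polynomial A} {c c' : A} (h : ExpansionBound 𝒟 a b n p c)
    (h' : ExpansionBound 𝒟 a b n' p' c') :
    ExpansionBound 𝒟 a b (n + n') (p * p') (c * c') := by
  obtain ⟨h1, h2, h3⟩ := h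
  obtain ⟨h1', h2', h3'⟩ := h'
  refine ⟨Polynomial.natDegree_mul_le_of_le h1 h1', ?_, ?_⟩
  · rw [Polynomial.coeff_mul_add_eq_of_natDegree_le h1 h1', h2, h2']
  · intro j e hje
    rw [Polynomial.coeff_mul]
    refine Submodule.sum_mem _ fun x hx => ?_
    rw [Finset.HasAntidiagonal.mem_antidiagonal] at hx
    by_cases hx1 : x.1 ≤ n
    · by_cases hx2 : x.2 ≤ n'
      · have e1 := h3 x.1 (n - x.1) (by omega)
        have e2 := h3' x.2 (n' - x.2) (by omega)
        have e3 := SetLike.mul_mem_graded e1 e2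
        convert e3 using 2
        have : e = (n - x.1) + (n' - x.2) := by omega
        rw [this, ← hx]; ring
      · rw [Polynomial.coeff_eq_zero_of_natDegree_lt (p := p') (by omega)]; simp
    · rw [Polynomial.coeff_eq_zero_of_natDegree_lt (p := p) (by omega)]; simp

private lemma ExpansionBound.one {𝒟 : ℕ → Submodule k A} [SetLike.GradedMonoid 𝒟] {a b : ℕ} :
    ExpansionBound 𝒟 a b 0 1 1 := by
  refine ⟨by simp, by simp, fun j e h => ?_⟩
  obtain ⟨rfl, rfl⟩ : j = 0 ∧ e = 0 := by omega
  simpa using SetLike.one_mem_graded 𝒟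

private lemma ExpansionBound.pow {𝒟 : ℕ → Submodule k A} [SetLike.GradedMonoid 𝒟] {a b : ℕ}
    {p : Polynomial A} {c : A} (h : ExpansionBound 𝒟 a b 1 p c) (n : ℕ) :
    ExpansionBound 𝒟 a b n (p ^ n) (c ^ n) := by
  induction n with
  | zero => simpa using ExpansionBound.one
  | succ n ih => simpa [pow_succ] using ih.mul h

private lemma ExpansionBound.prod {𝒟 : ℕ → Submodule k A} [SetLike.GradedMonoid 𝒟] {a b : ℕ}
    {p : σ → Polynomial A} {c : σ → A} (h : ∀ i, ExpansionBound 𝒟 a b 1 (p i) (c i))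
    (s : σ → ℕ) (T : Finset σ) :
    ExpansionBound 𝒟 a b (∑ i ∈ T, s i) (∏ i ∈ T, p i ^ s i) (∏ i ∈ T, c i ^ s i) := by
  classical
  induction T using Finset.induction_on with
  | empty => simpa using ExpansionBound.one
  | insert i T hi ih =>
    rw [Finset.sum_insert hi, Finset.prod_insert hi, Finset.prod_insert hi]
    exact ((h i).pow _).mul ih

private lemma lineExp_expansionBound (𝒟 : ℕ → Submodule k A) [SetLike.GradedMonoid 𝒟] {a b d : ℕ}
    {f : MvPolynomial σ k} (hf : f.IsHomogeneous d) {u v : σ → A} (hu : ∀ i, u i ∈ 𝒟 a)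
    (hv : ∀ i, v i ∈ 𝒟 b) :
    ExpansionBound 𝒟 a b d (lineExp f u v) (aeval v f) := by
  have h1 : ∀ i, ExpansionBound 𝒟 a b 1
      (Polynomial.C (u i) + Polynomial.X * Polynomial.C (v i)) (v i) := by
    intro i
    refine ⟨?_, by simp [Polynomial.coeff_C], ?_⟩
    · refine Polynomial.natDegree_add_le_of_degree_le (by simp) ?_
      exact (Polynomial.natDegree_mul_C_le _ _).trans Polynomial.natDegree_X_le
    · intro j e hje
      rcases Nat.eq_zero_or_pos j with rfl | hj
      · obtain rfl : e = 1 := by omega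
        simpa using hu i
      · obtain ⟨rfl, rfl⟩ : j = 1 ∧ e = 0 := by omega
        simpa [Polynomial.coeff_C] using hv i
  have h2 : ∀ s ∈ f.support, ExpansionBound 𝒟 a b d
      (algebraMap k (Polynomial A) (f.coeff s) *
        ∏ i ∈ s.support, (Polynomial.C (u i) + Polynomial.X * Polynomial.C (v i)) ^ s i)
      (algebraMap k A (f.coeff s) * ∏ i ∈ s.support, v i ^ s i) := by
    intro s hs
    have hd : ∑ i ∈ s.support, s i = d := by
      have := hf (mem_support_iff.1 hs)
      simpa [Finsupp.weight_apply, Finsupp.sum] using this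
    have h3 := ExpansionBound.prod h1 s s.support
    rw [hd] at h3
    obtain ⟨e1, e2, e3⟩ := h3
    rw [Polynomial.algebraMap_apply]
    refine ⟨(Polynomial.natDegree_C_mul_le _ _).trans e1, by rw [Polynomial.coeff_C_mul, e2],
      fun j e hje => ?_⟩
    rw [Polynomial.coeff_C_mul, ← Algebra.smul_def]
    exact Submodule.smul_mem _ _ (e3 j e hje)
  have h4 : lineExp f u v = ∑ s ∈ f.support, algebraMap k (Polynomial A) (f.coeff s) *
        ∏ i ∈ s.support, (Polynomial.C (u i) + Polynomial.X * Polynomial.C (v i)) ^ s i := by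
    rw [lineExp, aeval_def, eval₂_eq]
  have h5 : aeval v f = ∑ s ∈ f.support, algebraMap k A (f.coeff s) * ∏ i ∈ s.support, v i ^ s i := by
    rw [aeval_def, eval₂_eq]
  rw [h4, h5]
  refine ⟨Polynomial.natDegree_sum_le_of_forall_le _ _ fun s hs => (h2 s hs).1, ?_, ?_⟩
  · rw [Polynomial.finsetSum_coeff]
    exact Finset.sum_congr rfl fun s hs => (h2 s hs).2.1
  · intro j e hje
    rw [Polynomial.finsetSum_coeff]
    exact Submodule.sum_mem _ fun s hs => (h2 s hs).2.2 j e hje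

lemma lineExp_coeff_mem (𝒟 : ℕ → Submodule k A) [SetLike.GradedMonoid 𝒟] {a b d j e : ℕ}
    {f : MvPolynomial σ k} (hf : f.IsHomogeneous d) {u v : σ → A} (hu : ∀ i, u i ∈ 𝒟 a)
    (hv : ∀ i, v i ∈ 𝒟 b) (hje : j + e = d) :
    (lineExp f u v).coeff j ∈ 𝒟 (e * a + j * b) :=
  (lineExp_expansionBound 𝒟 hf hu hv).2.2 j e hje

lemma lineExp_natDegree_le {d : ℕ} {f : MvPolynomial σ k} (hf : f.IsHomogeneous d) (u v : σ → A) :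
    (lineExp f u v).natDegree ≤ d := by
  have : SetLike.GradedMonoid (fun _ : ℕ => (⊤ : Submodule k A)) :=
    { one_mem := trivial, mul_mem := fun _ _ _ _ _ _ => trivial }
  exact (lineExp_expansionBound (fun _ : ℕ => (⊤ : Submodule k A)) (a := 0) (b := 0) hf
    (fun _ => trivial) (fun _ => trivial)).1

lemma lineExp_coeff_top {d : ℕ} {f : MvPolynomial σ k} (hf : f.IsHomogeneous d) (u v : σ → A) :
    (lineExp f u v).coeff d = aeval v f := by
  have : SetLike.GradedMonoid (fun _ : ℕ => (⊤ : Submodule k A)) :=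
    { one_mem := trivial, mul_mem := fun _ _ _ _ _ _ => trivial }
  exact (lineExp_expansionBound (fun _ : ℕ => (⊤ : Submodule k A)) (a := 0) (b := 0) hf
    (fun _ => trivial) (fun _ => trivial)).2.1

lemma IsHomogeneous.aeval_smul {d : ℕ} {f : MvPolynomial σ k} (hf : f.IsHomogeneous d) (c : A)
    (v : σ → A) : aeval (fun i => c * v i) f = c ^ d * aeval v f := by
  have h := lineExp_eval f (fun _ : σ => (0 : A)) v c
  have h3 : aeval (fun i => c * v i) f = c ^ d * aeval v f := by
    rw [aeval_def, eval₂_eq, aeval_def, eval₂_eq, Finset.mul_sum]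
    refine Finset.sum_congr rfl fun s hs => ?_
    have hd : ∑ i ∈ s.support, s i = d := by
      have := hf (mem_support_iff.1 hs)
      simpa [Finsupp.weight_apply, Finsupp.sum] using this
    simp_rw [mul_pow, Finset.prod_mul_distrib, Finset.prod_pow_eq_pow_sum, hd]
    ring
  exact h3

lemma IsHomogeneous.eval_smul {d : ℕ} {f : MvPolynomial σ k} (hf : f.IsHomogeneous d) (c : k)
    (v : σ → k) : eval (c • v) f = c ^ d * eval v f := by
  have := IsHomogeneous.aeval_smul hf c v
  exact this

/-- Expanding along a rescaled direction from a rescaled point. -/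
lemma lineExp_coeff_smul_right {f : MvPolynomial σ k} (u v : σ → A) (c : A) (j : ℕ) :
    (lineExp f u (fun i => c * v i)).coeff j = c ^ j * (lineExp f u v).coeff j := by
  have h : lineExp f u (fun i => c * v i) = (lineExp f u v).comp (Polynomial.C c * Polynomial.X) := by
    have h : ((Polynomial.aeval (Polynomial.C c * Polynomial.X : Polynomial A)).restrictScalars k).comp
      (aeval (fun i => Polynomial.C (u i) + Polynomial.X * Polynomial.C (v i))) =
      (aeval (fun i => Polynomial.C (u i) + Polynomial.X * Polynomial.C (c * v i)) :
        MvPolynomial σ k →ₐ[k] Polynomial A) := by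
      ext1 i; simp; ring
    exact (congrArg (fun F => F f) h).symm
  rw [h, Polynomial.comp_C_mul_X_coeff]; ring

end Homogeneous

section CommonZeros

variable {k : Type*} [Field k]

/-- Setting the first `j` variables to zero. -/
private noncomputable def killVars (k : Type*) [Field k] (j : ℕ) :
    MvPolynomial (Fin 4) k →ₐ[k] MvPolynomial (Fin 4) k :=
  aeval (fun i => if i.1 < j then 0 else X i)

private lemma height_ker_killVars (j : ℕ) (hj : j ≤ 4) :
    (j : ℕ∞) ≤ (RingHom.ker (killVars k j)).height := by
  induction j with
  | zero => simp
  | succ j ih =>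
    have h1 := ih (by omega)
    have : (RingHom.ker (killVars k j)).IsPrime := RingHom.ker_isPrime _
    have : (RingHom.ker (killVars k (j + 1))).IsPrime := RingHom.ker_isPrime _
    have hlt : RingHom.ker (killVars k j) < RingHom.ker (killVars k (j + 1)) := by
      refine lt_of_le_of_ne ?_ ?_
      · have hc : (killVars k (j + 1)).comp (killVars k j) = killVars k (j + 1) := by
          ext1 i
          by_cases h : i.1 < j
          · have : i.1 < j + 1 := by omega
            simp only [killVars, AlgHom.comp_apply, aeval_X, if_pos h, map_zero, if_pos this]
          · simp [killVars, h]
        intro p hp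
        rw [RingHom.mem_ker] at hp ⊢
        rw [← hc, AlgHom.comp_apply, hp, map_zero]
      · intro h
        have h2 : (X ⟨j, by omega⟩ : MvPolynomial (Fin 4) k) ∈ RingHom.ker (killVars k (j + 1)) := by
          simp [RingHom.mem_ker, killVars]
        rw [← h] at h2
        simp [RingHom.mem_ker, killVars] at h2
    have := Ideal.height_add_one_le_of_lt_of_isPrime hlt
    push_cast
    exact (add_le_add_left h1 1).trans this

/-- At most three forms in four variables have a nontrivial common zero. -/
lemma exists_common_zero [IsAlgClosed k] (s : Finset (MvPolynomial (Fin 4) k)) (hs : s.card ≤ 3)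
    (hom : ∀ g ∈ s, ∃ n, 0 < n ∧ g.IsHomogeneous n) :
    ∃ v : Fin 4 → k, v ≠ 0 ∧ ∀ g ∈ s, eval v g = 0 := by
  by_contra! hno
  set I := Ideal.span (s : Set (MvPolynomial (Fin 4) k)) with hI
  have hX : ∀ i, (X i : MvPolynomial (Fin 4) k) ∈ I.radical := by
    intro i
    rw [← vanishingIdeal_zeroLocus_eq_radical (K := k) I, mem_vanishingIdeal_iff]
    intro v hv
    rw [mem_zeroLocus_iff] at hv
    by_cases h0 : v = 0
    · simp [h0]
    · obtain ⟨g, hg, hgv⟩ := hno v h0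
      exact absurd (by simpa [coe_aeval_eq_eval] using hv g (Ideal.subset_span hg)) hgv
  have hkv : ∀ p, killVars k 4 p = C (coeff 0 p) := by
    intro p
    have : killVars k 4 = (Algebra.ofId k (MvPolynomial (Fin 4) k)).comp (aeval (0 : Fin 4 → k)) := by
      ext1 i
      have := i.2
      simp [killVars]
    rw [this]
    simp [Algebra.ofId_apply, algebraMap_eq, constantCoeff_eq]
  have : (RingHom.ker (killVars k 4)).IsPrime := RingHom.ker_isPrime _
  have hmin : RingHom.ker (killVars k 4) ∈ I.minimalPrimes := by
    refine ⟨⟨this, ?_⟩, ?_⟩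
    · rw [hI, Ideal.span_le]
      intro g hg
      obtain ⟨n, hn, hgn⟩ := hom g hg
      change killVars k 4 g = 0
      rw [hkv, hgn.coeff_eq_zero (by simp; omega), C_0]
    · rintro Q ⟨hQ, hIQ⟩ - p hp
      have hq : (Ideal.Quotient.mkₐ k Q).comp (killVars k 4) = Ideal.Quotient.mkₐ k Q := by
        ext1 i
        have := i.2
        have hi : (X i : MvPolynomial (Fin 4) k) ∈ Q :=
          (Ideal.IsPrime.radical_le_iff hQ).2 hIQ (hX i)
        simp [killVars, Ideal.Quotient.eq_zero_iff_mem.2 hi]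
      have := congrArg (fun F => F p) hq
      rw [RingHom.mem_ker] at hp
      simp only [AlgHom.comp_apply, hp, map_zero] at this
      exact Ideal.Quotient.eq_zero_iff_mem.1 this.symm
  have h1 := Ideal.height_le_card_of_mem_minimalPrimes_span_finset hmin
  have h2 := (height_ker_killVars (k := k) 4 le_rfl).trans h1
  have : 4 ≤ s.card := by exact_mod_cast h2
  omega

lemma isHomogeneous_of_mul_left {σ : Type*} {d : ℕ} {a b : MvPolynomial σ k}
    (hab : (a * b).IsHomogeneous d) (h0 : a * b ≠ 0) :
    ∃ a' b', a'.IsHomogeneous a.totalDegree ∧ b'.IsHomogeneous b.totalDegree ∧ a * b = a' * b' := by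
  have ha : a ≠ 0 := left_ne_zero_of_mul h0
  have hb : b ≠ 0 := right_ne_zero_of_mul h0
  refine ⟨homogeneousComponent a.totalDegree a, homogeneousComponent b.totalDegree b,
    homogeneousComponent_isHomogeneous _ _, homogeneousComponent_isHomogeneous _ _, ?_⟩
  have hd : d = a.totalDegree + b.totalDegree := by
    rw [← totalDegree_mul_of_isDomain ha hb, hab.totalDegree h0]
  have e1 : a * b = homogeneousComponent d (a * b) := by
    rw [homogeneousComponent_of_mem hab]; simp
  rw [e1]
  conv_lhs => rw [← sum_homogeneousComponent a, ← sum_homogeneousComponent b]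
  rw [Finset.sum_mul_sum, map_sum]
  rw [Finset.sum_eq_single a.totalDegree]
  · rw [map_sum, Finset.sum_eq_single b.totalDegree]
    · rw [homogeneousComponent_of_mem ((homogeneousComponent_isHomogeneous _ _).mul
        (homogeneousComponent_isHomogeneous _ _)), if_pos hd]
    · intro j hj hj'
      rw [homogeneousComponent_of_mem ((homogeneousComponent_isHomogeneous _ _).mul
        (homogeneousComponent_isHomogeneous _ _)), if_neg (by omega)]
    · intro h; simp at h
  · intro i hi hi'
    rw [map_sum]
    refine Finset.sum_eq_zero fun j hj => ?_
    rw [Finset.mem_range] at hi hj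
    rw [homogeneousComponent_of_mem ((homogeneousComponent_isHomogeneous _ _).mul
        (homogeneousComponent_isHomogeneous _ _)), if_neg (by omega)]
  · intro h; simp at h

lemma IsSmoothSurface.exists_pderiv {d : ℕ} {f : MvPolynomial (Fin 4) k} (hf : IsSmoothSurface f d)
    {v : Fin 4 → k} (hv : v ≠ 0) (h : eval v f = 0) : ∃ i, eval v (pderiv i f) ≠ 0 := by
  by_contra! h'
  exact hf.2.2 v hv ⟨h, h'⟩

lemma IsSmoothSurface.prime [IsAlgClosed k] {d : ℕ} (hd : d ≠ 0) {f : MvPolynomial (Fin 4) k}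
    (hf : IsSmoothSurface f d) : Prime f := by
  classical
  rw [← irreducible_iff_prime]
  have key : ∀ a b : MvPolynomial (Fin 4) k, f = a * b → ¬ (0 < a.totalDegree ∧ 0 < b.totalDegree) := by
    rintro a b rfl ⟨ha, hb⟩
    obtain ⟨a', b', ha', hb', hab⟩ := isHomogeneous_of_mul_left hf.2.1 hf.1
    obtain ⟨v, hv, hz⟩ := exists_common_zero {a', b'} (Finset.card_le_two.trans (by omega)) (by
      intro g hg
      simp only [Finset.mem_insert, Finset.mem_singleton] at hg
      rcases hg with rfl | rfl
      · exact ⟨_, ha, ha'⟩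
      · exact ⟨_, hb, hb'⟩)
    have h1 := hz a' (by simp)
    have h2 := hz b' (by simp)
    obtain ⟨i, hi⟩ := hf.exists_pderiv hv (by rw [hab, map_mul, h1, zero_mul])
    apply hi
    rw [hab, Derivation.leibniz]
    simp [h1, h2]
  have hunit : ∀ a b : MvPolynomial (Fin 4) k, f = a * b → a.totalDegree = 0 → IsUnit a := by
    rintro a b rfl h
    rw [totalDegree_eq_zero_iff_eq_C] at h
    rw [h]
    refine IsUnit.map _ (isUnit_iff_ne_zero.2 fun h0 => ?_)
    rw [h0, C_0] at h
    exact hf.1 (by rw [h, zero_mul])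
  refine ⟨fun h => ?_, fun a b hab => ?_⟩
  · have h1 := (isUnit_iff_totalDegree_of_isReduced.1 h).2
    rw [hf.2.1.totalDegree hf.1] at h1
    exact hd h1
  · by_cases ha : a.totalDegree = 0
    · exact Or.inl (hunit a b hab ha)
    · refine Or.inr (hunit b a (by rw [hab, mul_comm]) ?_)
      have := key a b hab
      omega

/-- Nullstellensatz for a prime polynomial. -/
lemma exists_eval_ne_zero_of_not_dvd {σ : Type*} [Finite σ] [IsAlgClosed k] {f h : MvPolynomial σ k}
    (hf : Prime f) (hfh : ¬ f ∣ h) : ∃ v : σ → k, eval v f = 0 ∧ eval v h ≠ 0 := by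
  by_contra! hno
  apply hfh
  have h1 : (Ideal.span {f}).IsPrime := (Ideal.span_singleton_prime hf.ne_zero).2 hf
  have h2 : h ∈ vanishingIdeal k (zeroLocus k (Ideal.span {f})) := by
    rw [mem_vanishingIdeal_iff]
    intro v hv
    rw [mem_zeroLocus_iff] at hv
    have := hv f (Ideal.mem_span_singleton_self f)
    exact hno v this
  rw [vanishingIdeal_zeroLocus_eq_radical, h1.radical] at h2
  exact Ideal.mem_span_singleton.1 h2

/-- Conversely, a polynomial vanishing on the zero set of a prime polynomial is a multiple of it. -/
lemma dvd_of_eval_eq_zero {σ : Type*} [Finite σ] [IsAlgClosed k] {f h : MvPolynomial σ k}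
    (hf : Prime f) (H : ∀ v : σ → k, eval v f = 0 → eval v h = 0) : f ∣ h := by
  by_contra hno
  obtain ⟨v, h1, h2⟩ := exists_eval_ne_zero_of_not_dvd hf hno
  exact h2 (H v h1)

/-- A nonzero polynomial of smaller degree is not a multiple. -/
lemma not_dvd_of_totalDegree_lt {σ : Type*} {f h : MvPolynomial σ k} (hh : h ≠ 0)
    (hlt : h.totalDegree < f.totalDegree) : ¬ f ∣ h := by
  rintro ⟨g, rfl⟩
  rw [totalDegree_mul_of_isDomain (left_ne_zero_of_mul hh) (right_ne_zero_of_mul hh)] at hlt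
  omega

end CommonZeros

section LinearChange

variable {k σ : Type*} [Field k] [Fintype σ] [DecidableEq σ]

/-- The composition of `f` with the linear map `T`. -/
noncomputable def lsub (T : (σ → k) →ₗ[k] (σ → k)) (f : MvPolynomial σ k) : MvPolynomial σ k :=
  aeval (fun i => ∑ j, C (T (Pi.single j 1) i) * X j) f

lemma eval_lsub (T : (σ → k) →ₗ[k] (σ → k)) (f : MvPolynomial σ k) (v : σ → k) :
    eval v (lsub T f) = eval (T v) f := by
  have h : (aeval v).comp (aeval (fun i => ∑ j, C (T (Pi.single j 1) i) * X j)) =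
      (aeval (T v) : MvPolynomial σ k →ₐ[k] k) := by
    ext1 i
    have : v = ∑ j, v j • (Pi.single j 1 : σ → k) := by
      ext i; simp [Pi.single_apply]
    conv_rhs => rw [this]
    simp [mul_comm]
  have := congrArg (fun F => F f) h
  exact this

lemma lsub_isHomogeneous (T : (σ → k) →ₗ[k] (σ → k)) {f : MvPolynomial σ k} {d : ℕ}
    (hf : f.IsHomogeneous d) : (lsub T f).IsHomogeneous d := by
  have := hf.aeval (fun i => ∑ j, C (T (Pi.single j 1) i) * X j) (n := 1) (fun i => by
    refine IsHomogeneous.sum _ _ _ fun j _ => ?_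
    simpa using (isHomogeneous_C σ (T (Pi.single j 1) i)).mul (isHomogeneous_X k j))
  rwa [one_mul] at this

lemma lineExp_lsub [Infinite k] (T : (σ → k) →ₗ[k] (σ → k)) (f : MvPolynomial σ k) (u v : σ → k) :
    lineExp (lsub T f) u v = lineExp f (T u) (T v) := by
  refine Polynomial.funext fun s => ?_
  rw [lineExp_eval_field, lineExp_eval_field, eval_lsub]; simp

lemma dirDeriv_lsub [Infinite k] (T : (σ → k) →ₗ[k] (σ → k)) (f : MvPolynomial σ k) (u v : σ → k) :
    dirDeriv (lsub T f) u v = dirDeriv f (T u) (T v) := by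
  rw [← lineExp_coeff_one, lineExp_lsub, lineExp_coeff_one]

lemma IsSmoothSurface.lsub [Infinite k] {d : ℕ} {f : MvPolynomial (Fin 4) k}
    (hf : IsSmoothSurface f d) (T : (Fin 4 → k) ≃ₗ[k] (Fin 4 → k)) :
    IsSmoothSurface (lsub (T : (Fin 4 → k) →ₗ[k] (Fin 4 → k)) f) d := by
  refine ⟨fun h => hf.1 ?_, lsub_isHomogeneous _ hf.2.1, ?_⟩
  · refine funext fun v => ?_
    have := eval_lsub (T : (Fin 4 → k) →ₗ[k] (Fin 4 → k)) f (T.symm v)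
    simpa [h] using this.symm
  · rintro v hv ⟨h1, h2⟩
    rw [eval_lsub] at h1
    obtain ⟨i, hi⟩ := hf.exists_pderiv (v := T v) (by simpa using hv) h1
    apply hi
    have h3 : dirDeriv (_root_.lsub (T : (Fin 4 → k) →ₗ[k] (Fin 4 → k)) f) v
        (T.symm (Pi.single i 1)) = 0 := by
      refine Finset.sum_eq_zero fun j _ => ?_
      have := h2 j
      rw [← coe_aeval_eq_eval] at this
      exact mul_eq_zero_of_right _ this
    rw [dirDeriv_lsub] at h3
    simpa [dirDeriv, Pi.single_apply, coe_aeval_eq_eval] using h3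

lemma isLineOn_lsub {f : MvPolynomial (Fin 4) k} (T : (Fin 4 → k) ≃ₗ[k] (Fin 4 → k))
    (W : Submodule k (Fin 4 → k)) :
    IsLineOn (lsub (T : (Fin 4 → k) →ₗ[k] (Fin 4 → k)) f) W ↔
      IsLineOn f (W.map (T : (Fin 4 → k) →ₗ[k] (Fin 4 → k))) := by
  unfold IsLineOn
  rw [LinearEquiv.finrank_map_eq]
  simp only [eval_lsub, Submodule.mem_map, forall_exists_index, and_imp]
  exact and_congr_right fun _ =>
    ⟨fun h v u hu e => e ▸ h u hu, fun h v hv => h _ v hv rfl⟩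

end LinearChange

section Bezout

variable {K : Type*} [Field K]

private lemma card_finsupp_sum_le (n : ℕ) :
    2 * Nat.card {s : Fin 2 →₀ ℕ | (s.sum fun _ e => e) ≤ n} = (n + 1) * (n + 2) := by
  have e1 : Nat.card {s : Fin 2 →₀ ℕ | (s.sum fun _ e => e) ≤ n} =
      ((Finset.range (n + 1) ×ˢ Finset.range (n + 1)).filter fun p => p.1 + p.2 ≤ n).card := by
    rw [← Fintype.card_coe, ← Nat.card_eq_fintype_card]
    refine Nat.card_congr
      ((Finsupp.equivFunOnFinite.trans (piFinTwoEquiv fun _ => ℕ)).subtypeEquiv fun s => ?_)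
    have : (s.sum fun _ e => e) = s 0 + s 1 := by
      rw [Finsupp.sum_fintype _ _ (by simp), Fin.sum_univ_two]
    simp only [Set.mem_ofPred_eq, this, Finset.mem_filter, Finset.mem_product, Finset.mem_range,
      Equiv.trans_apply, piFinTwoEquiv_apply, Finsupp.equivFunOnFinite_apply]
    omega
  rw [e1, Finset.card_eq_sum_card_fiberwise (f := fun p => p.1 + p.2) (t := Finset.range (n + 1))]
  · have : ∀ i ∈ Finset.range (n + 1), (((Finset.range (n + 1) ×ˢ Finset.range (n + 1)).filter
        fun p => p.1 + p.2 ≤ n).filter fun p => p.1 + p.2 = i).card = i + 1 := by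
      intro i hi
      rw [← Finset.Nat.card_antidiagonal i]
      congr 1
      ext p
      simp only [Finset.mem_filter, Finset.mem_product, Finset.mem_range,
        Finset.HasAntidiagonal.mem_antidiagonal] at hi ⊢
      omega
    rw [Finset.sum_congr rfl this]
    clear this e1
    induction n with
    | zero => simp
    | succ n ih => rw [Finset.sum_range_succ, mul_add, ih]; ring
  · intro p hp
    simp only [Finset.coe_filter, Finset.mem_product, Finset.mem_range, Set.mem_ofPred_eq] at hp
    simp; omega

private lemma finrank_restrictTotalDegree (n : ℕ) :
    2 * Module.finrank K (restrictTotalDegree (Fin 2) K n) = (n + 1) * (n + 2) := by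
  rw [← card_finsupp_sum_le n]
  congr 1
  exact Module.finrank_eq_nat_card_basis (basisRestrictSupport K _)

/-- Multiplication by `φ` from degree `≤ a` to degree `≤ n`. -/
private noncomputable def mulRestrict (φ : MvPolynomial (Fin 2) K) (a n : ℕ)
    (h : φ.totalDegree + a ≤ n) :
    restrictTotalDegree (Fin 2) K a →ₗ[K] restrictTotalDegree (Fin 2) K n :=
  (LinearMap.mulLeft K φ).restrict fun u hu => by
    rw [mem_restrictTotalDegree] at hu ⊢
    exact (totalDegree_mul _ _).trans (by omega)

private lemma exists_separating (Z : Finset (Fin 2 → K)) (z : Fin 2 → K) :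
    ∃ p : MvPolynomial (Fin 2) K, p.totalDegree ≤ Z.card ∧ eval z p = 1 ∧
      ∀ z' ∈ Z, z' ≠ z → eval z' p = 0 := by
  classical
  have h : ∀ z' : Fin 2 → K, ∃ l : MvPolynomial (Fin 2) K, l.totalDegree ≤ 1 ∧
      (z' ≠ z → eval z l ≠ 0 ∧ eval z' l = 0) := by
    intro z'
    by_cases hzz : z' = z
    · exact ⟨0, by simp, fun h => absurd hzz h⟩
    · obtain ⟨i, hi⟩ := Function.ne_iff.1 hzz
      refine ⟨X i - C (z' i), (totalDegree_sub_C_le _ _).trans (by simp), fun _ => ⟨?_, by simp⟩⟩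
      simpa [sub_ne_zero] using hi.symm
  choose l hl1 hl2 using h
  set q := ∏ z' ∈ Z.erase z, l z' with hq
  have hqz : eval z q ≠ 0 := by
    rw [hq, map_prod, Finset.prod_ne_zero_iff]
    exact fun z' hz' => (hl2 z' (Finset.ne_of_mem_erase hz')).1
  refine ⟨C (eval z q)⁻¹ * q, ?_, by simp [hqz], fun z' h1 h2 => ?_⟩
  · refine (totalDegree_mul _ _).trans ?_
    rw [totalDegree_C, zero_add]
    refine (totalDegree_finsetProd _ _).trans ?_
    refine (Finset.sum_le_card_nsmul _ _ 1 fun i _ => hl1 i).trans ?_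
    simpa using Finset.card_le_card (Finset.erase_subset z Z)
  · have : eval z' q = 0 := by
      rw [hq, map_prod]
      exact Finset.prod_eq_zero (Finset.mem_erase.2 ⟨h2, h1⟩) (hl2 z' h2).2
    rw [map_mul, this, mul_zero]

/-- A weak form of Bézout's theorem in the affine plane. -/
theorem card_common_zeros_le {φ ψ : MvPolynomial (Fin 2) K} (hφ : φ ≠ 0) (hψ : ψ ≠ 0)
    (hcop : ∀ u v, φ * u = ψ * v → φ ∣ v) (Z : Finset (Fin 2 → K))
    (hZ : ∀ z ∈ Z, eval z φ = 0 ∧ eval z ψ = 0) :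
    Z.card ≤ φ.totalDegree * ψ.totalDegree := by
  classical
  set a := φ.totalDegree with ha
  set b := ψ.totalDegree with hb
  set c := Z.card with hc
  set n := a + b + c with hn
  let T := fun n => restrictTotalDegree (Fin 2) K n
  let Λ : (T (b + c) × T (a + c)) →ₗ[K] T n :=
    (mulRestrict φ (b + c) n (by omega)).coprod (mulRestrict ψ (a + c) n (by omega))
  let κ : T c →ₗ[K] (T (b + c) × T (a + c)) :=
    (mulRestrict ψ c (b + c) (by omega)).prod (-(mulRestrict φ c (a + c) (by omega)))
  let ev : T n →ₗ[K] (Z → K) :=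
    LinearMap.pi fun z => (aeval (z : Fin 2 → K)).toLinearMap ∘ₗ (T n).subtype
  have hker : LinearMap.ker Λ ≤ LinearMap.range κ := by
    rintro ⟨u, v⟩ huv
    rw [LinearMap.mem_ker] at huv
    have h1 : φ * u.1 + ψ * v.1 = 0 := congrArg Subtype.val huv
    obtain ⟨w, hw⟩ := hcop u.1 (-v.1) (by linear_combination h1)
    have hu : u.1 = ψ * w := by
      apply mul_left_cancel₀ hφ
      linear_combination h1 + ψ * hw
    have hwd : w.totalDegree ≤ c := by
      by_cases hw0 : w = 0
      · simp [hw0]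
      · have h2 : u.1.totalDegree ≤ b + c := (mem_restrictTotalDegree _ _ _).1 u.2
        rw [hu, totalDegree_mul_of_isDomain hψ hw0] at h2
        omega
    refine ⟨⟨w, (mem_restrictTotalDegree _ _ _).2 hwd⟩, ?_⟩
    refine Prod.ext (Subtype.ext hu.symm) (Subtype.ext ?_)
    change -(φ * w) = v.1
    rw [← hw, neg_neg]
  have hrange : LinearMap.range Λ ≤ LinearMap.ker ev := by
    rintro _ ⟨⟨u, v⟩, rfl⟩
    rw [LinearMap.mem_ker]
    ext z
    change aeval (z : Fin 2 → K) (φ * u.1 + ψ * v.1) = 0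
    have := hZ z z.2
    simp [this]
  have hsurj : Function.Surjective ev := by
    rw [← LinearMap.range_eq_top, eq_top_iff]
    intro g _
    choose p hp1 hp2 hp3 using fun z : Z => exists_separating Z (z : Fin 2 → K)
    refine ⟨⟨∑ z : Z, C (g z) * p z, ?_⟩, ?_⟩
    · rw [mem_restrictTotalDegree]
      refine totalDegree_finsetSum_le fun z _ => (totalDegree_mul _ _).trans ?_
      rw [totalDegree_C, zero_add]
      exact (hp1 z).trans (by omega)
    · ext z
      change aeval (z : Fin 2 → K) (∑ z : Z, C (g z) * p z) = g z
      rw [map_sum, Finset.sum_eq_single z]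
      · simp [hp2]
      · intro z' _ hne
        have := hp3 z' z z.2 (fun h => hne (Subtype.ext h.symm))
        simp [this]
      · simp
  have e1 := Λ.finrank_range_add_finrank_ker
  have e2 := ev.finrank_range_add_finrank_ker
  have e3 := Submodule.finrank_mono hker
  have e4 := Submodule.finrank_mono hrange
  have e5 := κ.finrank_range_le
  rw [LinearMap.range_eq_top.2 hsurj, finrank_top, Module.finrank_fintype_fun_eq_card,
    Fintype.card_coe] at e2
  rw [Module.finrank_prod] at e1
  have f1 := finrank_restrictTotalDegree (K := K) n
  have f2 := finrank_restrictTotalDegree (K := K) (a + c)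
  have f3 := finrank_restrictTotalDegree (K := K) (b + c)
  have f4 := finrank_restrictTotalDegree (K := K) c
  change 2 * Module.finrank K (T n) = _ at f1
  change 2 * Module.finrank K (T (a + c)) = _ at f2
  change 2 * Module.finrank K (T (b + c)) = _ at f3
  change 2 * Module.finrank K (T c) = _ at f4
  have key : 2 * c + ((a + c) + 1) * ((a + c) + 2) + ((b + c) + 1) * ((b + c) + 2) ≤
      (n + 1) * (n + 2) + (c + 1) * (c + 2) := by
    rw [← f1, ← f2, ← f3, ← f4]; omega
  rw [hn] at key
  nlinarith [key]

end Bezout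

section SkewLines

variable {k : Type*} [Field k]

/-- Dehomogenization `x = 1`, with `y` regarded as a scalar. -/
private noncomputable def dehom (k : Type*) [Field k] :
    MvPolynomial (Fin 4) k →ₐ[k] MvPolynomial (Fin 2) (Polynomial k) :=
  aeval ![X 0, X 1, 1, C Polynomial.X]

private lemma eval_eval_dehom (f : MvPolynomial (Fin 4) k) (w z : Polynomial k) :
    eval ![w, z] (dehom k f) = aeval ![w, z, 1, Polynomial.X] f := by
  have h : (AlgHom.restrictScalars k (aeval ![w, z] : MvPolynomial (Fin 2) (Polynomial k)
      →ₐ[Polynomial k] Polynomial k)).comp (dehom k) = aeval ![w, z, 1, Polynomial.X] := by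
    ext i
    fin_cases i <;> simp [dehom]
  exact DFunLike.congr_fun h f

private lemma exists_dehom_eq (A : MvPolynomial (Fin 2) (Polynomial k)) :
    ∃ N₀, ∀ N ≥ N₀, ∃ A' : MvPolynomial (Fin 4) k, A'.IsHomogeneous N ∧ dehom k A' = A := by
  induction A using MvPolynomial.induction_on with
  | C r =>
    induction r using Polynomial.induction_on' with
    | add p q hp hq =>
      obtain ⟨N₁, h1⟩ := hp
      obtain ⟨N₂, h2⟩ := hq
      refine ⟨max N₁ N₂, fun N hN => ?_⟩
      obtain ⟨A, hA, rfl'⟩ := h1 N (le_trans (le_max_left _ _) hN)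
      obtain ⟨B, hB, rfl''⟩ := h2 N (le_trans (le_max_right _ _) hN)
      exact ⟨A + B, hA.add hB, by rw [map_add, rfl', rfl'', C_add]⟩
    | monomial n c =>
      refine ⟨n, fun N hN => ⟨C c * X 3 ^ n * X 2 ^ (N - n), ?_, ?_⟩⟩
      · have := ((isHomogeneous_C (Fin 4) c).mul ((isHomogeneous_X k (3 : Fin 4)).pow n)).mul
          ((isHomogeneous_X k (2 : Fin 4)).pow (N - n))
        convert this using 1
        omega
      · have hc : dehom k (C c) = C (Polynomial.C c) := (dehom k).commutes c
        rw [map_mul, map_mul, map_pow, map_pow, hc, ← Polynomial.C_mul_X_pow_eq_monomial]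
        simp [dehom]
  | add p q hp hq =>
    obtain ⟨N₁, h1⟩ := hp
    obtain ⟨N₂, h2⟩ := hq
    refine ⟨max N₁ N₂, fun N hN => ?_⟩
    obtain ⟨A, hA, hA'⟩ := h1 N (le_trans (le_max_left _ _) hN)
    obtain ⟨B, hB, hB'⟩ := h2 N (le_trans (le_max_right _ _) hN)
    exact ⟨A + B, hA.add hB, by rw [map_add, hA', hB']⟩
  | mul_X p i hp =>
    obtain ⟨N₁, h1⟩ := hp
    refine ⟨N₁ + 1, fun N hN => ?_⟩
    obtain ⟨A, hA, hA'⟩ := h1 (N - 1) (by omega)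
    refine ⟨A * X (Fin.castLE (by omega) i), ?_, ?_⟩
    · convert hA.mul (isHomogeneous_X k (Fin.castLE (by omega) i : Fin 4)) using 1
      omega
    · rw [map_mul, hA']
      congr 1
      fin_cases i <;> simp [dehom]

private lemma dehom_injective [Infinite k] {n : ℕ} {G : MvPolynomial (Fin 4) k}
    (hG : G.IsHomogeneous n) (h : dehom k G = 0) : G = 0 := by
  have hx : X 2 * G = 0 := by
    refine MvPolynomial.funext fun v => ?_
    rw [map_mul, eval_X, map_zero]
    by_cases hv : v 2 = 0
    · rw [hv, zero_mul]
    · have h1 := eval_eval_dehom G (Polynomial.C ((v 2)⁻¹ * v 0)) (Polynomial.C ((v 2)⁻¹ * v 1))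
      rw [h, map_zero] at h1
      have h2 : eval ((v 2)⁻¹ • v) G = 0 := by
        have h3 := congrArg (Polynomial.evalRingHom ((v 2)⁻¹ * v 3)) h1
        rw [map_zero, aeval_def, ← MvPolynomial.coe_eval₂Hom, ← RingHom.comp_apply,
          MvPolynomial.comp_eval₂Hom] at h3
        rw [h3, MvPolynomial.eval]
        congr 2
        · ext; simp
        · funext i
          fin_cases i <;> simp [hv]
      rw [IsHomogeneous.eval_smul hG] at h2
      rw [(mul_eq_zero.1 h2).resolve_left (pow_ne_zero _ (inv_ne_zero hv)), mul_zero]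
  exact (mul_eq_zero.1 hx).resolve_left (X_ne_zero _)

private lemma dehom_totalDegree_le {f : MvPolynomial (Fin 4) k} {m : ℕ}
    (hm : ∀ s ∈ f.support, s 0 + s 1 ≤ m) : (dehom k f).totalDegree ≤ m := by
  rw [f.as_sum, map_sum]
  refine totalDegree_finsetSum_le fun s hs => ?_
  have : dehom k (monomial s (coeff s f)) =
      C (Polynomial.C (coeff s f)  * Polynomial.X ^ s 3) * (X 0 ^ s 0 * X 1 ^ s 1) := by
    rw [dehom, aeval_monomial, Finsupp.prod_fintype _ _ (by simp), Fin.prod_univ_four,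
      IsScalarTower.algebraMap_apply k (Polynomial k), Polynomial.algebraMap_eq,
      MvPolynomial.algebraMap_eq]
    simp
    ring
  rw [this]
  refine (totalDegree_mul _ _).trans ?_
  rw [totalDegree_C, zero_add]
  refine (totalDegree_mul _ _).trans ?_
  refine le_trans (add_le_add (totalDegree_pow _ _) (totalDegree_pow _ _)) ?_
  simpa using hm s hs

lemma totalDegree_map_le {σ R S : Type*} [CommSemiring R] [CommSemiring S] (φ : R →+* S)
    (p : MvPolynomial σ R) : (map φ p).totalDegree ≤ p.totalDegree :=
  Finset.sup_mono (support_map_subset φ p)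

theorem card_skew_lines_le [Infinite k] {f P : MvPolynomial (Fin 4) k} {d e m : ℕ} (hf : Prime f)
    (hfd : f.IsHomogeneous d) (hP : P.IsHomogeneous e) (hfP : ¬ f ∣ P)
    (hm : ∀ s ∈ f.support, s 0 + s 1 ≤ m) (T : Finset (k × k × k × k))
    (hT : ∀ a ∈ T, ∀ t : k, eval ![a.1 + t * a.2.1, a.2.2.1 + t * a.2.2.2, 1, t] f = 0 ∧
      eval ![a.1 + t * a.2.1, a.2.2.1 + t * a.2.2.2, 1, t] P = 0) :
    T.card ≤ m * e := by
  classical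
  let K := FractionRing (Polynomial k)
  have hinj : Function.Injective (map (σ := Fin 2) (algebraMap (Polynomial k) K)) :=
    map_injective _ (IsFractionRing.injective (Polynomial k) K)
  have hne : ∀ {n} {G : MvPolynomial (Fin 4) k}, G.IsHomogeneous n → G ≠ 0 →
      map (algebraMap (Polynomial k) K) (dehom k G) ≠ 0 := by
    intro n G hG h0 h
    exact h0 (dehom_injective hG (hinj (by rw [h, map_zero])))
  have hP0 : P ≠ 0 := fun h => hfP (h ▸ dvd_zero f)
  have hcop0 : ∀ A B, dehom k f * A = dehom k P * B → dehom k f ∣ B := by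
    intro A B hAB
    obtain ⟨N₁, h1⟩ := exists_dehom_eq A
    obtain ⟨N₂, h2⟩ := exists_dehom_eq B
    obtain ⟨A', hA, hA'⟩ := h1 (N₁ + N₂ + e) (by omega)
    obtain ⟨B', hB, hB'⟩ := h2 (N₁ + N₂ + d) (by omega)
    have hz : f * A' - P * B' = 0 := by
      refine dehom_injective (n := N₁ + N₂ + d + e) ?_ ?_
      · refine IsHomogeneous.sub ?_ ?_
        · rw [show N₁ + N₂ + d + e = d + (N₁ + N₂ + e) by omega]; exact hfd.mul hA
        · rw [show N₁ + N₂ + d + e = e + (N₁ + N₂ + d) by omega]; exact hP.mul hB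
      · rw [map_sub, map_mul, map_mul, hA', hB', hAB, sub_self]
    have : f ∣ P * B' := ⟨A', (sub_eq_zero.1 hz).symm⟩
    rw [← hB']
    exact map_dvd _ ((hf.dvd_or_dvd this).resolve_left hfP)
  let M := (nonZeroDivisors (Polynomial k)).map
    (C : (Polynomial k) →+* MvPolynomial (Fin 2) (Polynomial k))
  let _ : Algebra (MvPolynomial (Fin 2) (Polynomial k)) (MvPolynomial (Fin 2) K) :=
    (map (algebraMap (Polynomial k) K)).toAlgebra
  have : IsLocalization M (MvPolynomial (Fin 2) K) := MvPolynomial.isLocalization _ _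
  have hcop : ∀ u v, map (algebraMap (Polynomial k) K) (dehom k f) * u =
      map (algebraMap (Polynomial k) K) (dehom k P) * v →
      map (algebraMap (Polynomial k) K) (dehom k f) ∣ v := by
    intro u v huv
    obtain ⟨⟨U, s1⟩, h1⟩ := IsLocalization.surj M u
    obtain ⟨⟨V, s2⟩, h2⟩ := IsLocalization.surj M v
    change u * map (algebraMap (Polynomial k) K) s1 = map (algebraMap (Polynomial k) K) U at h1
    change v * map (algebraMap (Polynomial k) K) s2 = map (algebraMap (Polynomial k) K) V at h2
    have h3 : dehom k f * (U * s2) = dehom k P * (V * s1) := by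
      apply hinj
      simp only [map_mul, ← h1, ← h2]
      linear_combination (map (algebraMap (Polynomial k) K) (s1 : MvPolynomial (Fin 2) (Polynomial k)) *
        map (algebraMap (Polynomial k) K) (s2 : MvPolynomial (Fin 2) (Polynomial k))) * huv
    have h4 := map_dvd (map (algebraMap (Polynomial k) K)) (hcop0 _ _ h3)
    rw [map_mul, ← h2] at h4
    have u1 : IsUnit (map (algebraMap (Polynomial k) K) (s1 : MvPolynomial (Fin 2) (Polynomial k))) :=
      IsLocalization.map_units (MvPolynomial (Fin 2) K) s1
    have u2 : IsUnit (map (algebraMap (Polynomial k) K) (s2 : MvPolynomial (Fin 2) (Polynomial k))) :=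
      IsLocalization.map_units (MvPolynomial (Fin 2) K) s2
    exact u2.dvd_mul_right.1 (u1.dvd_mul_right.1 h4)
  let pt : k × k × k × k → Fin 2 → (Polynomial k) := fun a =>
    ![Polynomial.C a.1 + Polynomial.X * Polynomial.C a.2.1,
      Polynomial.C a.2.2.1 + Polynomial.X * Polynomial.C a.2.2.2]
  have hpt : ∀ a ∈ T, ∀ G, (∀ t : k, eval ![a.1 + t * a.2.1, a.2.2.1 + t * a.2.2.2, 1, t] G = 0) →
      eval (fun i => algebraMap (Polynomial k) K (pt a i))
        (map (algebraMap (Polynomial k) K) (dehom k G)) = 0 := by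
    intro a _ G hG
    rw [eval_map, ← Function.comp_def, ← eval₂_comp, eval_eval_dehom]
    convert map_zero (algebraMap (Polynomial k) K)
    refine Polynomial.funext fun t => ?_
    rw [Polynomial.eval_zero, ← hG t, ← Polynomial.coe_evalRingHom, aeval_def,
      ← MvPolynomial.coe_eval₂Hom, ← RingHom.comp_apply, MvPolynomial.comp_eval₂Hom, MvPolynomial.eval]
    congr 2
    · ext; simp
    · funext i
      fin_cases i <;>
        simp [-Polynomial.X_mul_C]
  have hptinj : Function.Injective fun a => fun i => algebraMap (Polynomial k) K (pt a i) := by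
    rintro ⟨a, a', b, b'⟩ ⟨c, c', g, g'⟩ h
    have h' : ∀ i, pt (a, a', b, b') i = pt (c, c', g, g') i := fun i =>
      IsFractionRing.injective (Polynomial k) K (congrFun h i)
    have h0 := h' 0
    have h1 := h' 1
    simp only [pt, Matrix.cons_val_zero, Matrix.cons_val_one] at h0 h1
    have e1 := congrArg (Polynomial.coeff · 0) h0
    have e2 := congrArg (Polynomial.coeff · 1) h0
    have e3 := congrArg (Polynomial.coeff · 0) h1
    have e4 := congrArg (Polynomial.coeff · 1) h1
    simp [Polynomial.coeff_C] at e1 e2 e3 e4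
    simp [e1, e2, e3, e4]
  have key := card_common_zeros_le (hne hfd hf.ne_zero) (hne hP hP0) hcop
    (T.image fun a => fun i => algebraMap (Polynomial k) K (pt a i)) (by
      intro z hz
      obtain ⟨a, ha, rfl⟩ := Finset.mem_image.1 hz
      exact ⟨hpt a ha f fun t => (hT a ha t).1, hpt a ha P fun t => (hT a ha t).2⟩)
  rw [Finset.card_image_of_injective _ hptinj] at key
  refine key.trans (Nat.mul_le_mul ?_ ?_)
  · exact (totalDegree_map_le _ _).trans (dehom_totalDegree_le hm)
  · refine (totalDegree_map_le _ _).trans (dehom_totalDegree_le fun s hs => ?_)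
    have := hP (mem_support_iff.1 hs)
    rw [Finsupp.weight_apply, Finsupp.sum_fintype _ _ (by simp), Fin.sum_univ_four] at this
    simp at this
    omega

end SkewLines

section LineCount

variable {k : Type*} [Field k]

/-- A plane complementary to the axis `x = y = 0` is a graph over the `(x, y)`-plane. -/
lemma exists_graph_of_disjoint_axis {M : Submodule k (Fin 4 → k)} (hM : Module.finrank k M = 2)
    (hd : ∀ v ∈ M, v 2 = 0 → v 3 = 0 → v = 0) :
    ∃ a : k × k × k × k, ∀ v, v ∈ M ↔
      v 0 = a.1 * v 2 + a.2.1 * v 3 ∧ v 1 = a.2.2.1 * v 2 + a.2.2.2 * v 3 := by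
  let π : M →ₗ[k] (Fin 2 → k) :=
    LinearMap.pi ![LinearMap.proj (R := k) (φ := fun _ : Fin 4 => k) 2 ∘ₗ M.subtype,
      LinearMap.proj (R := k) (φ := fun _ : Fin 4 => k) 3 ∘ₗ M.subtype]
  have h0 : ∀ v, π v 0 = v.1 2 := fun v => rfl
  have h1 : ∀ v, π v 1 = v.1 3 := fun v => rfl
  have hinj : Function.Injective π := by
    rw [← LinearMap.ker_eq_bot, LinearMap.ker_eq_bot']
    intro v hv
    exact Subtype.ext (hd v v.2 (by rw [← h0, hv]; rfl) (by rw [← h1, hv]; rfl))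
  have hsurj : Function.Surjective π :=
    (LinearMap.injective_iff_surjective_of_finrank_eq_finrank (by simp [hM])).1 hinj
  obtain ⟨u, hu⟩ := hsurj ![1, 0]
  obtain ⟨v, hv⟩ := hsurj ![0, 1]
  have u2 : u.1 2 = 1 := by rw [← h0, hu]; rfl
  have u3 : u.1 3 = 0 := by rw [← h1, hu]; rfl
  have v2 : v.1 2 = 0 := by rw [← h0, hv]; rfl
  have v3 : v.1 3 = 1 := by rw [← h1, hv]; rfl
  refine ⟨(u.1 0, v.1 0, u.1 1, v.1 1), fun w => ⟨fun hw => ?_, fun hw => ?_⟩⟩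
  · have : w - w 2 • u.1 - w 3 • v.1 = 0 := by
      refine hd _ (M.sub_mem (M.sub_mem hw (M.smul_mem _ u.2)) (M.smul_mem _ v.2)) ?_ ?_ <;>
        simp [u2, u3, v2, v3]
    have e0 := congrFun this 0
    have e1 := congrFun this 1
    simp only [Pi.sub_apply, Pi.smul_apply, smul_eq_mul, Pi.zero_apply] at e0 e1
    exact ⟨by linear_combination e0, by linear_combination e1⟩
  · have : w = w 2 • u.1 + w 3 • v.1 := by
      funext i
      fin_cases i
      · simp [hw.1]; ring
      · simp [hw.2]; ring
      · simp [u2, v2]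
      · simp [u3, v3]
    rw [this]
    exact M.add_mem (M.smul_mem _ u.2) (M.smul_mem _ v.2)

theorem card_disjoint_lines_le [Infinite k] {f P : MvPolynomial (Fin 4) k} {d e m : ℕ}
    (hf : Prime f) (hfd : f.IsHomogeneous d) (hP : P.IsHomogeneous e) (hfP : ¬ f ∣ P)
    (hm : ∀ s ∈ f.support, s 0 + s 1 ≤ m) (T : Finset (Submodule k (Fin 4 → k)))
    (hT : ∀ M ∈ T, IsLineOn f M ∧ (∀ v ∈ M, eval v P = 0) ∧
      ∀ v ∈ M, v 2 = 0 → v 3 = 0 → v = 0) :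
    T.card ≤ m * e := by
  classical
  have h : ∀ M : Submodule k (Fin 4 → k), ∃ a : k × k × k × k, M ∈ T → ∀ v, v ∈ M ↔
      v 0 = a.1 * v 2 + a.2.1 * v 3 ∧ v 1 = a.2.2.1 * v 2 + a.2.2.2 * v 3 := by
    intro M
    by_cases hM : M ∈ T
    · obtain ⟨a, ha⟩ := exists_graph_of_disjoint_axis (hT M hM).1.1 (hT M hM).2.2
      exact ⟨a, fun _ => ha⟩
    · exact ⟨0, fun h => absurd h hM⟩
  choose a ha using h
  have hinj : Set.InjOn a T := by
    intro M hM N hN hMN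
    ext v
    rw [ha M hM, ha N hN, hMN]
  rw [← Finset.card_image_of_injOn hinj]
  refine card_skew_lines_le hf hfd hP hfP hm _ ?_
  intro b hb t
  obtain ⟨M, hM, rfl⟩ := Finset.mem_image.1 hb
  have hv : ![(a M).1 + t * (a M).2.1, (a M).2.2.1 + t * (a M).2.2.2, 1, t] ∈ M := by
    rw [ha M hM]
    constructor <;> simp <;> ring
  exact ⟨(hT M hM).1.2 _ hv, (hT M hM).2.1 _ hv⟩

lemma exists_linearEquiv_of_notMem {a b c e : Fin 4 → k} (ha : a ≠ 0)
    (hb : b ∉ Submodule.span k {a}) (hc : c ∉ Submodule.span k {a, b})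
    (he : e ∉ Submodule.span k {a, b, c}) :
    ∃ T : (Fin 4 → k) ≃ₗ[k] (Fin 4 → k), ∀ v, T v = v 0 • a + v 1 • b + v 2 • e + v 3 • c := by
  have h : LinearIndependent k ![e, c, b, a] := by
    refine linearIndependent_finCons.2 ⟨linearIndependent_finCons.2 ⟨linearIndependent_finCons.2
      ⟨linearIndependent_finCons.2 ⟨linearIndependent_empty_type, by simpa⟩, by simpa⟩, ?_⟩, ?_⟩
    · simpa [Set.pair_comm] using hc
    · have : Set.range ![c, b, a] = {a, b, c} := by
        ext v; simp only [Matrix.range_cons, Matrix.range_empty, Set.mem_union,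
          Set.mem_singleton_iff, Set.mem_insert_iff, Set.mem_empty_iff_false]; tauto
      exact this ▸ he
  let B := basisOfLinearIndependentOfCardEqFinrank h (by simp)
  refine ⟨LinearEquiv.funCongrLeft k k (Equiv.ofBijective ![2, 3, 1, 0] (by decide)) ≪≫ₗ
    B.equivFun.symm, fun v => ?_⟩
  rw [LinearEquiv.trans_apply, Module.Basis.equivFun_symm_apply, Fin.sum_univ_four]
  simp [B, LinearEquiv.funCongrLeft_apply, LinearMap.funLeft_apply]
  abel

lemma exists_notMem_of_finite [Infinite k] {ι : Type*} (s : Finset ι)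
    (W : ι → Submodule k (Fin 4 → k)) (hW : ∀ i ∈ s, Module.finrank k (W i) < 4) :
    ∃ v : Fin 4 → k, ∀ i ∈ s, v ∉ W i := by
  by_contra! h
  obtain ⟨i, hi⟩ := Subspace.exists_eq_top_of_iUnion_eq_univ (p := fun i : s => W i) (by
    rw [Set.eq_univ_iff_forall]
    intro v
    obtain ⟨i, hi, hv⟩ := h v
    exact Set.mem_iUnion.2 ⟨⟨i, hi⟩, hv⟩)
  have := hW i i.2
  rw [hi, finrank_top] at this
  simp at this

lemma finrank_span_singleton_le_one (v : Fin 4 → k) :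
    Module.finrank k (Submodule.span k {v}) ≤ 1 := by
  simpa using finrank_span_le_card (R := k) ({v} : Set (Fin 4 → k))

lemma finrank_sup_span_singleton_le (W : Submodule k (Fin 4 → k)) (v : Fin 4 → k) :
    Module.finrank k (W ⊔ Submodule.span k {v} : Submodule k (Fin 4 → k)) ≤
      Module.finrank k W + 1 :=
  (Submodule.finrank_add_le_finrank_add_finrank _ _).trans
    (Nat.add_le_add_left (finrank_span_singleton_le_one v) _)

lemma exists_notMem_span [Infinite k] (a b : Fin 4 → k) : ∃ c, c ∉ Submodule.span k {a, b} := by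
  obtain ⟨c, hc⟩ := exists_notMem_of_finite {()} (fun _ => Submodule.span k {a, b}) (by
    intro _ _
    rw [Submodule.span_insert]
    have h1 := finrank_sup_span_singleton_le (Submodule.span k {a}) b
    have h2 := finrank_span_singleton_le_one a
    omega)
  exact ⟨c, hc () (by simp)⟩

lemma exists_notMem_span' [Infinite k] (a b c : Fin 4 → k) :
    ∃ e, e ∉ Submodule.span k {a, b, c} := by
  obtain ⟨e, he⟩ := exists_notMem_of_finite {()} (fun _ => Submodule.span k {a, b, c}) (by
    intro _ _
    rw [Submodule.span_insert, Submodule.span_insert, ← sup_assoc]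
    have h1 := finrank_sup_span_singleton_le (Submodule.span k {a}) b
    have h2 := finrank_span_singleton_le_one a
    have h3 := finrank_sup_span_singleton_le (Submodule.span k {a} ⊔ Submodule.span k {b}) c
    omega)
  exact ⟨e, he () (by simp)⟩

theorem card_lines_le [IsAlgClosed k] {f P : MvPolynomial (Fin 4) k} {d e : ℕ}
    (hd : d ≠ 0) (hf : IsSmoothSurface f d) (hP : P.IsHomogeneous e) (hfP : ¬ f ∣ P)
    (T : Finset (Submodule k (Fin 4 → k)))
    (hT : ∀ M ∈ T, IsLineOn f M ∧ ∀ v ∈ M, eval v P = 0) :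
    T.card ≤ d * e := by
  classical
  have : Infinite k := IsAlgClosed.instInfinite
  rcases T.eq_empty_or_nonempty with rfl | ⟨M₀, hM₀⟩
  · simp
  obtain ⟨a, ha⟩ := exists_notMem_of_finite T id fun M hM => by
    rw [id, (hT M hM).1.1]; omega
  obtain ⟨b, hb⟩ := exists_notMem_of_finite T (fun M => M ⊔ Submodule.span k {a})
    fun M hM => by
      have := finrank_sup_span_singleton_le M a
      rw [(hT M hM).1.1] at this
      omega
  have ha0 : a ≠ 0 := fun h => ha M₀ hM₀ (h ▸ M₀.zero_mem)
  obtain ⟨c, hc⟩ := exists_notMem_span a b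
  obtain ⟨c', hc'⟩ := exists_notMem_span' a b c
  obtain ⟨E, hE⟩ := exists_linearEquiv_of_notMem ha0
    (fun h => hb M₀ hM₀ (Submodule.mem_sup_right h)) hc hc'
  have hinj : Function.Injective fun M : Submodule k (Fin 4 → k) => M.map E.symm.toLinearMap :=
    Submodule.map_injective_of_injective E.symm.injective
  rw [← Finset.card_image_of_injective T hinj]
  have hf' := hf.lsub E
  have hback : ∀ M : Submodule k (Fin 4 → k),
      (M.map E.symm.toLinearMap).map E.toLinearMap = M := fun M => by
    rw [← Submodule.map_comp]; simp
  refine card_disjoint_lines_le (hf'.prime hd) hf'.2.1 (P := lsub E.toLinearMap P)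
    (lsub_isHomogeneous _ hP) ?_ ?_ _ ?_
  · intro hdvd
    obtain ⟨v, hv1, hv2⟩ := exists_eval_ne_zero_of_not_dvd (hf.prime hd) hfP
    apply hv2
    have h1 := map_dvd (eval (E.symm v)) hdvd
    rw [eval_lsub, eval_lsub] at h1
    simp only [LinearEquiv.coe_coe, LinearEquiv.apply_symm_apply] at h1
    rw [hv1] at h1
    exact zero_dvd_iff.1 h1
  · intro s hs
    have := hf'.2.1 (mem_support_iff.1 hs)
    rw [Finsupp.weight_apply, Finsupp.sum_fintype _ _ (by simp), Fin.sum_univ_four] at this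
    simp at this
    omega
  · intro M' hM'
    obtain ⟨M, hM, rfl⟩ := Finset.mem_image.1 hM'
    refine ⟨?_, ?_, ?_⟩
    · rw [isLineOn_lsub, hback]
      exact (hT M hM).1
    · rintro _ ⟨v, hv, rfl⟩
      rw [eval_lsub]
      simpa using (hT M hM).2 v hv
    · rintro v hv h2 h3
      have hv' : E v ∈ M := by
        obtain ⟨u, hu, rfl⟩ := hv
        simpa using hu
      rw [hE, h2, h3] at hv'
      simp only [zero_smul, add_zero] at hv'
      have h1 : v 1 = 0 := by
        by_contra h1
        apply hb M hM
        have : b = (v 1)⁻¹ • (v 0 • a + v 1 • b) + (-((v 1)⁻¹ * v 0)) • a := by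
          rw [smul_add, smul_smul, smul_smul, inv_mul_cancel₀ h1, neg_smul, one_smul]
          abel
        rw [this]
        exact Submodule.add_mem_sup (M.smul_mem _ hv')
          (Submodule.smul_mem _ _ (Submodule.mem_span_singleton_self a))
      have h0 : v 0 = 0 := by
        by_contra h0
        rw [h1, zero_smul, add_zero] at hv'
        exact ha M hM ((M.smul_mem_iff h0).1 hv')
      funext i
      fin_cases i <;> assumption

end LineCount

section Resultant

variable {K : Type*} [Field K]

private lemma comp_C_mul_X_eq_scaleRoots (h : Polynomial K) {a : K} (ha : a ≠ 0) :
    h.comp (Polynomial.C a * Polynomial.X) =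
      Polynomial.C (a ^ h.natDegree) * h.scaleRoots a⁻¹ := by
  ext i
  rw [Polynomial.comp_C_mul_X_coeff, Polynomial.coeff_C_mul, Polynomial.coeff_scaleRoots]
  rcases le_or_gt i h.natDegree with hi | hi
  · obtain ⟨c, hc⟩ := Nat.exists_eq_add_of_le hi
    rw [hc, Nat.add_sub_cancel_left, pow_add, inv_pow]
    field_simp
  · rw [Polynomial.coeff_eq_zero_of_natDegree_lt hi, zero_mul, zero_mul, mul_zero]

private lemma resultant_comp_of_natDegree (f g : Polynomial K) {a : K} (ha : a ≠ 0) (b : K) :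
    Polynomial.resultant (f.comp (Polynomial.C a * Polynomial.X + Polynomial.C b))
      (g.comp (Polynomial.C a * Polynomial.X + Polynomial.C b)) f.natDegree g.natDegree =
      a ^ (f.natDegree * g.natDegree) * Polynomial.resultant f g := by
  have key : ∀ h : Polynomial K, h.comp (Polynomial.C a * Polynomial.X + Polynomial.C b) =
      Polynomial.C (a ^ h.natDegree) * (Polynomial.taylor b h).scaleRoots a⁻¹ := by
    intro h
    rw [← Polynomial.natDegree_taylor h b, ← comp_C_mul_X_eq_scaleRoots _ ha,
      Polynomial.taylor_apply, Polynomial.comp_assoc]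
    simp
  have h1 := Polynomial.resultant_scaleRoots (Polynomial.taylor b f) (Polynomial.taylor b g) a⁻¹
  rw [Polynomial.resultant_taylor, Polynomial.natDegree_scaleRoots,
    Polynomial.natDegree_scaleRoots, Polynomial.natDegree_taylor, Polynomial.natDegree_taylor] at h1
  rw [key, key, Polynomial.resultant_C_mul_left, Polynomial.resultant_C_mul_right, h1,
    ← pow_mul, ← pow_mul, mul_comm g.natDegree, inv_pow]
  field_simp

lemma resultant_comp_affine {f g : Polynomial K} {m n : ℕ} (hf : f.natDegree ≤ m)
    (hg : g.natDegree ≤ n) {a : K} (ha : a ≠ 0) (b : K) :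
    Polynomial.resultant (f.comp (Polynomial.C a * Polynomial.X + Polynomial.C b))
      (g.comp (Polynomial.C a * Polynomial.X + Polynomial.C b)) m n =
      a ^ (m * n) * Polynomial.resultant f g m n := by
  have hdeg : ∀ h : Polynomial K,
      (h.comp (Polynomial.C a * Polynomial.X + Polynomial.C b)).natDegree = h.natDegree := by
    intro h
    rw [Polynomial.natDegree_comp, Polynomial.natDegree_linear ha, mul_one]
  have hcoeff : ∀ (h : Polynomial K),
      (h.comp (Polynomial.C a * Polynomial.X + Polynomial.C b)).coeff h.natDegree =
        a ^ h.natDegree * h.coeff h.natDegree := by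
    intro h
    rw [← hdeg, Polynomial.coeff_natDegree, Polynomial.leadingCoeff_comp (by
      rw [Polynomial.natDegree_linear ha]; simp), Polynomial.leadingCoeff_linear ha, hdeg,
      Polynomial.coeff_natDegree, mul_comm]
  rcases hf.lt_or_eq with hf' | rfl
  · rcases hg.lt_or_eq with hg' | rfl
    · rw [Polynomial.resultant_eq_zero_of_lt_lt _ _ _ _ (by rwa [hdeg]) (by rwa [hdeg]),
        Polynomial.resultant_eq_zero_of_lt_lt _ _ _ _ hf' hg', mul_zero]
    · obtain ⟨c, rfl⟩ := Nat.exists_eq_add_of_le hf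
      rw [Polynomial.resultant_add_left_deg _ _ _ _ _ (hdeg f).le,
        Polynomial.resultant_add_left_deg _ _ _ _ _ le_rfl, resultant_comp_of_natDegree f g ha,
        hcoeff]
      ring
  · obtain ⟨c, rfl⟩ := Nat.exists_eq_add_of_le hg
    rw [Polynomial.resultant_add_right_deg _ _ _ _ _ (hdeg g).le,
      Polynomial.resultant_add_right_deg _ _ _ _ _ le_rfl, resultant_comp_of_natDegree f g ha,
      hcoeff]
    ring

lemma resultant_ne_zero_of_no_common_root [IsAlgClosed K] {f g : Polynomial K} {m n : ℕ}
    (hf : f.natDegree = m) (hf0 : f ≠ 0) (hg : g.natDegree ≤ n)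
    (h : ∀ x, f.eval x = 0 → g.eval x ≠ 0) : Polynomial.resultant f g m n ≠ 0 := by
  subst hf
  rw [Polynomial.resultant_eq_prod_eval _ _ _ hg (IsAlgClosed.splits f)]
  refine mul_ne_zero (pow_ne_zero _ (Polynomial.leadingCoeff_ne_zero.2 hf0)) ?_
  refine Multiset.prod_ne_zero fun h0 => ?_
  obtain ⟨x, hx, hx'⟩ := Multiset.mem_map.1 h0
  exact h x ((Polynomial.mem_roots hf0).1 hx) hx'

lemma resultant_eq_zero_of_common_root {R : Type*} [CommRing R] {f g : Polynomial R}
    {m n : ℕ} (hf : f.natDegree ≤ m)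
    (hg : g.natDegree ≤ n) (hm : m ≠ 0) {x : R} (h1 : f.eval x = 0) (h2 : g.eval x = 0) :
    Polynomial.resultant f g m n = 0 := by
  obtain ⟨p, q, -, -, h⟩ := Polynomial.exists_mul_add_mul_eq_C_resultant f g hf hg (Or.inl hm)
  have := congrArg (Polynomial.eval x) h
  simpa [h1, h2] using this.symm

end Resultant

section Elimination

variable {k : Type*} [Field k] {R S : Type*} [CommRing R] [Algebra k R] [CommRing S] [Algebra k S]

/-- The `j`-th coefficient of the expansion of `f(q + s (n + Z p))`, as a polynomial in `Z`. -/
noncomputable def lineExpAlong (f : MvPolynomial (Fin 4) k) (j : ℕ) (q n p : Fin 4 → R) :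
    Polynomial R :=
  (lineExp f (fun i => Polynomial.C (q i))
    (fun i => Polynomial.C (n i) + Polynomial.X * Polynomial.C (p i))).coeff j

lemma lineExpAlong_eval (f : MvPolynomial (Fin 4) k) (j : ℕ) (q n p : Fin 4 → R) (x : R) :
    (lineExpAlong f j q n p).eval x = (lineExp f q (fun i => n i + x * p i)).coeff j := by
  have := lineExp_coeff_map f (fun i => Polynomial.C (q i))
    (fun i => Polynomial.C (n i) + Polynomial.X * Polynomial.C (p i))
    ((Polynomial.aeval x).restrictScalars k : Polynomial R →ₐ[k] R) j
  have h1 : ∀ P : Polynomial R,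
      ((Polynomial.aeval x).restrictScalars k : Polynomial R →ₐ[k] R) P = P.eval x :=
    fun P => Polynomial.coe_aeval_eq_eval x ▸ rfl
  simp only [h1] at this
  rw [lineExpAlong, this]
  congr 2 <;> funext i
  · exact Polynomial.eval_C
  · rw [Polynomial.eval_add, Polynomial.eval_mul, Polynomial.eval_C, Polynomial.eval_C,
      Polynomial.eval_X]

lemma lineExpAlong_map (f : MvPolynomial (Fin 4) k) (j : ℕ) (q n p : Fin 4 → R) (ψ : R →ₐ[k] S) :
    (lineExpAlong f j q n p).map (ψ : R →+* S) =
      lineExpAlong f j (fun i => ψ (q i)) (fun i => ψ (n i)) (fun i => ψ (p i)) := by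
  have := lineExp_coeff_map f (fun i => Polynomial.C (q i))
    (fun i => Polynomial.C (n i) + Polynomial.X * Polynomial.C (p i)) (Polynomial.mapAlgHom ψ) j
  simpa [lineExpAlong] using this

lemma lineExpAlong_natDegree_le {f : MvPolynomial (Fin 4) k} {d j : ℕ} (hf : f.IsHomogeneous d)
    (hj : j ≤ d) (q n p : Fin 4 → R) : (lineExpAlong f j q n p).natDegree ≤ j := by
  let 𝒟 : ℕ → Submodule k (Polynomial R) := fun n => (Polynomial.degreeLE R n).restrictScalars k
  have h𝒟 : ∀ (n : ℕ) (P : Polynomial R), P ∈ 𝒟 n ↔ P.natDegree ≤ n := fun n P => by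
    rw [Polynomial.natDegree_le_iff_degree_le, ← Polynomial.mem_degreeLE]; rfl
  have : SetLike.GradedMonoid 𝒟 :=
    { one_mem := by rw [h𝒟]; simp
      mul_mem := fun a b P Q hP hQ => by
        rw [h𝒟] at hP hQ ⊢
        exact Polynomial.natDegree_mul_le.trans (add_le_add hP hQ) }
  have := lineExp_coeff_mem 𝒟 (a := 0) (b := 1) (e := d - j) (j := j) hf
    (u := fun i => Polynomial.C (q i))
    (v := fun i => Polynomial.C (n i) + Polynomial.X * Polynomial.C (p i))
    (fun i => by rw [h𝒟]; simp) (fun i => by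
      rw [h𝒟]
      refine (Polynomial.natDegree_add_le _ _).trans (max_le (by simp) ?_)
      exact Polynomial.natDegree_mul_le.trans (by simpa using Polynomial.natDegree_X_le))
    (by omega)
  rw [h𝒟] at this
  simpa [lineExpAlong] using this

private def homPoly (k σ : Type*) [Field k] (n : ℕ) :
    Submodule k (Polynomial (MvPolynomial σ k)) where
  carrier := {P | ∀ i, (P.coeff i).IsHomogeneous n}
  add_mem' hP hQ i := by rw [Polynomial.coeff_add]; exact (hP i).add (hQ i)
  zero_mem' i := by rw [Polynomial.coeff_zero]; exact isHomogeneous_zero _ _ _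
  smul_mem' c P hP i := by
    rw [Polynomial.coeff_smul]
    exact (homogeneousSubmodule σ k n).smul_mem c (hP i)

private instance (σ : Type*) : SetLike.GradedMonoid (homPoly k σ) where
  one_mem i := by
    rw [Polynomial.coeff_one]
    split_ifs
    · exact isHomogeneous_one _ _
    · exact isHomogeneous_zero _ _ _
  mul_mem a b P Q hP hQ i := by
    rw [Polynomial.coeff_mul]
    exact IsHomogeneous.sum _ _ _ fun x _ => (hP _).mul (hQ _)

lemma lineExpAlong_coeff_isHomogeneous {σ : Type*} {f : MvPolynomial (Fin 4) k} {d a b j : ℕ}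
    (hf : f.IsHomogeneous d) (hj : j ≤ d) {q n p : Fin 4 → MvPolynomial σ k}
    (hq : ∀ i, (q i).IsHomogeneous a) (hn : ∀ i, (n i).IsHomogeneous b)
    (hp : ∀ i, (p i).IsHomogeneous b) (l : ℕ) :
    ((lineExpAlong f j q n p).coeff l).IsHomogeneous ((d - j) * a + j * b) := by
  have := lineExp_coeff_mem (homPoly k σ) (a := a) (b := b) (e := d - j) (j := j) hf
    (u := fun i => Polynomial.C (q i))
    (v := fun i => Polynomial.C (n i) + Polynomial.X * Polynomial.C (p i))
    (fun i l => by
      rw [Polynomial.coeff_C]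
      split_ifs
      · exact hq i
      · exact isHomogeneous_zero _ _ _)
    (fun i l => by
      rw [Polynomial.coeff_add, Polynomial.coeff_C]
      refine IsHomogeneous.add ?_ ?_
      · split_ifs
        · exact hn i
        · exact isHomogeneous_zero _ _ _
      · rw [Polynomial.coeff_mul_C, Polynomial.coeff_X]
        split_ifs
        · simpa using hp i
        · simpa using isHomogeneous_zero _ _ _)
    (by omega)
  exact this l

lemma resultant_isHomogeneous {σ : Type*} {F G : Polynomial (MvPolynomial σ k)} {m n a b : ℕ}
    (hF : ∀ i, (F.coeff i).IsHomogeneous a) (hG : ∀ i, (G.coeff i).IsHomogeneous b) :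
    (Polynomial.resultant F G m n).IsHomogeneous (m * b + n * a) := by
  rw [Polynomial.resultant, Matrix.det_apply]
  refine IsHomogeneous.sum _ _ _ fun τ _ => ?_
  rw [Units.smul_def]
  refine (homogeneousSubmodule σ k _).toAddSubgroup.zsmul_mem ?_ _
  change (∏ i, Polynomial.sylvester F G m n (τ i) i).IsHomogeneous (m * b + n * a)
  have := IsHomogeneous.prod Finset.univ (fun i => Polynomial.sylvester F G m n (τ i) i)
    (fun i => Fin.addCases (fun _ => b) (fun _ => a) i) (fun i _ => by
      refine Fin.addCases (fun i => ?_) (fun i => ?_) i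
      · simp only [Polynomial.sylvester, Matrix.of_apply, Fin.addCases_left]
        split_ifs
        · exact hG _
        · exact isHomogeneous_zero _ _ _
      · simp only [Polynomial.sylvester, Matrix.of_apply, Fin.addCases_right]
        split_ifs
        · exact hF _
        · exact isHomogeneous_zero _ _ _)
  convert this using 1
  rw [Fin.sum_univ_add]
  simp

/-- The two parametrizations of the line `l₀ x + l₁ z + l₂ w = 0` in the plane `y = β x`. -/
noncomputable def resZ (G f : MvPolynomial (Fin 4) k) (m j : ℕ) (β : k) (q : Fin 4 → R)
    (l₀ l₁ l₂ : R) : R :=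
  Polynomial.resultant (lineExp G ![-l₀, 0, l₂, algebraMap k R β * l₂] ![-l₁, l₂, 0, 0])
    (lineExpAlong f j q ![-l₀, 0, l₂, algebraMap k R β * l₂] ![-l₁, l₂, 0, 0]) m j

noncomputable def resW (G f : MvPolynomial (Fin 4) k) (m j : ℕ) (β : k) (q : Fin 4 → R)
    (l₀ l₁ l₂ : R) : R :=
  Polynomial.resultant (lineExp G ![0, -l₀, l₁, algebraMap k R β * l₁] ![l₁, -l₂, 0, 0])
    (lineExpAlong f j q ![0, -l₀, l₁, algebraMap k R β * l₁] ![l₁, -l₂, 0, 0]) m j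

private lemma comp_vec4 (ψ : R →ₐ[k] S) (a b c e : R) :
    (fun i => ψ ((![a, b, c, e] : Fin 4 → R) i)) = ![ψ a, ψ b, ψ c, ψ e] := by
  funext i; fin_cases i <;> rfl

lemma resZ_map (G f : MvPolynomial (Fin 4) k) (m j : ℕ) (β : k) (q : Fin 4 → R)
    (l₀ l₁ l₂ : R) (ψ : R →ₐ[k] S) :
    ψ (resZ G f m j β q l₀ l₁ l₂) = resZ G f m j β (fun i => ψ (q i)) (ψ l₀) (ψ l₁) (ψ l₂) := by
  have := Polynomial.resultant_map_map
    (lineExp G ![-l₀, 0, l₂, algebraMap k R β * l₂] ![-l₁, l₂, 0, 0])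
    (lineExpAlong f j q ![-l₀, 0, l₂, algebraMap k R β * l₂] ![-l₁, l₂, 0, 0]) m j (ψ : R →+* S)
  rw [lineExp_map, lineExpAlong_map, comp_vec4, comp_vec4] at this
  rw [resZ, resZ, ← AlgHom.coe_toRingHom, ← this]
  rw [AlgHom.coe_toRingHom, map_neg ψ l₀, map_neg ψ l₁, map_mul, AlgHom.commutes, map_zero]

lemma resW_map (G f : MvPolynomial (Fin 4) k) (m j : ℕ) (β : k) (q : Fin 4 → R)
    (l₀ l₁ l₂ : R) (ψ : R →ₐ[k] S) :
    ψ (resW G f m j β q l₀ l₁ l₂) = resW G f m j β (fun i => ψ (q i)) (ψ l₀) (ψ l₁) (ψ l₂) := by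
  have := Polynomial.resultant_map_map
    (lineExp G ![0, -l₀, l₁, algebraMap k R β * l₁] ![l₁, -l₂, 0, 0])
    (lineExpAlong f j q ![0, -l₀, l₁, algebraMap k R β * l₁] ![l₁, -l₂, 0, 0]) m j (ψ : R →+* S)
  rw [lineExp_map, lineExpAlong_map, comp_vec4, comp_vec4] at this
  rw [resW, resW, ← AlgHom.coe_toRingHom, ← this]
  rw [AlgHom.coe_toRingHom, map_neg ψ l₀, map_neg ψ l₂, map_mul, AlgHom.commutes, map_zero]

end Elimination

section Elimination

variable {k : Type*} [Field k] {K : Type*} [Field K] [Algebra k K]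

private lemma lineExp_comp {G : MvPolynomial (Fin 4) k} {m : ℕ} (hG : G.IsHomogeneous m)
    {u u' v v' : Fin 4 → K} {a b c : K} (h1 : ∀ i, u' i + b * v' i = c * u i)
    (h2 : ∀ i, a * v' i = c * v i) :
    (lineExp G u' v').comp (Polynomial.C a * Polynomial.X + Polynomial.C b) =
      Polynomial.C (c ^ m) * lineExp G u v := by
  let ψ : Polynomial K →ₐ[k] Polynomial K :=
    (Polynomial.aeval (Polynomial.C a * Polynomial.X + Polynomial.C b)).restrictScalars k
  have hψ : ∀ P : Polynomial K,
      ψ P = P.comp (Polynomial.C a * Polynomial.X + Polynomial.C b) := fun P => rfl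
  rw [← hψ, lineExp, lineExp, Polynomial.C_pow, ← IsHomogeneous.aeval_smul hG, ← AlgHom.comp_apply,
    comp_aeval]
  congr 2
  funext i
  rw [hψ]
  simp only [Polynomial.add_comp, Polynomial.mul_comp, Polynomial.C_comp, Polynomial.X_comp]
  have e1 := congrArg Polynomial.C (h1 i)
  have e2 := congrArg Polynomial.C (h2 i)
  simp only [Polynomial.C_add, Polynomial.C_mul] at e1 e2
  linear_combination e1 + Polynomial.X * e2

private lemma lineExpAlong_comp (f : MvPolynomial (Fin 4) k) (j : ℕ)
    (q : Fin 4 → K) {u u' v v' : Fin 4 → K} {a b c : K} (h1 : ∀ i, u' i + b * v' i = c * u i)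
    (h2 : ∀ i, a * v' i = c * v i) :
    (lineExpAlong f j q u' v').comp (Polynomial.C a * Polynomial.X + Polynomial.C b) =
      Polynomial.C (c ^ j) * lineExpAlong f j q u v := by
  let ψ : Polynomial K →ₐ[k] Polynomial K :=
    (Polynomial.aeval (Polynomial.C a * Polynomial.X + Polynomial.C b)).restrictScalars k
  have hψ : ∀ P : Polynomial K,
      ψ P = P.comp (Polynomial.C a * Polynomial.X + Polynomial.C b) := fun P => rfl
  rw [← hψ, lineExpAlong, lineExpAlong, Polynomial.C_pow, ← lineExp_coeff_smul_right,
    lineExp_coeff_map]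
  congr 2
  · funext i
    rw [hψ, Polynomial.C_comp]
  funext i
  rw [hψ]
  simp only [Polynomial.add_comp, Polynomial.mul_comp, Polynomial.C_comp, Polynomial.X_comp]
  have e1 := congrArg Polynomial.C (h1 i)
  have e2 := congrArg Polynomial.C (h2 i)
  simp only [Polynomial.C_add, Polynomial.C_mul] at e1 e2
  linear_combination e1 + Polynomial.X * e2

private lemma resZ_resW_field {G f : MvPolynomial (Fin 4) k} {m d j : ℕ} (hG : G.IsHomogeneous m)
    (hf : f.IsHomogeneous d) (hj : j ≤ d) (β : k) (q : Fin 4 → K) (l₀ : K) {l₁ l₂ : K}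
    (h1 : l₁ ≠ 0) (h2 : l₂ ≠ 0) :
    l₁ ^ (m * j) * resZ G f m j β q l₀ l₁ l₂ =
      (-1) ^ (m * j) * (l₂ ^ (m * j) * resW G f m j β q l₀ l₁ l₂) := by
  have e1 : ∀ i, (![0, -l₀, l₁, algebraMap k K β * l₁] : Fin 4 → K) i +
      (-l₀ / l₂) * (![l₁, -l₂, 0, 0] : Fin 4 → K) i =
      (l₁ / l₂) * (![-l₀, 0, l₂, algebraMap k K β * l₂] : Fin 4 → K) i := by
    intro i; fin_cases i <;> simp <;> field_simp; ring
  have e2 : ∀ i, (-l₁ / l₂) * (![l₁, -l₂, 0, 0] : Fin 4 → K) i =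
      (l₁ / l₂) * (![-l₁, l₂, 0, 0] : Fin 4 → K) i := by
    intro i; fin_cases i <;> simp <;> field_simp
  have ha : -l₁ / l₂ ≠ 0 := div_ne_zero (neg_ne_zero.2 h1) h2
  have key := resultant_comp_affine
    (lineExp_natDegree_le hG ![0, -l₀, l₁, algebraMap k K β * l₁] ![l₁, -l₂, 0, 0])
    (lineExpAlong_natDegree_le hf hj q ![0, -l₀, l₁, algebraMap k K β * l₁] ![l₁, -l₂, 0, 0])
    ha (-l₀ / l₂)
  rw [lineExp_comp hG e1 e2, lineExpAlong_comp f j q e1 e2, Polynomial.resultant_C_mul_left,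
    Polynomial.resultant_C_mul_right] at key
  have key' : (l₁ / l₂) ^ (m * j) * ((l₁ / l₂) ^ (m * j) * resZ G f m j β q l₀ l₁ l₂) =
      (l₁ / l₂) ^ (m * j) * ((-1) ^ (m * j) * resW G f m j β q l₀ l₁ l₂) := by
    rw [show -l₁ / l₂ = -1 * (l₁ / l₂) by ring, mul_pow] at key
    rw [resZ, resW]
    rw [← pow_mul, ← pow_mul, mul_comm j m] at key
    linear_combination key
  have key2 := mul_left_cancel₀ (pow_ne_zero _ (div_ne_zero h1 h2)) key'
  rw [div_pow] at key2
  have h2' : l₂ ^ (m * j) ≠ 0 := pow_ne_zero _ h2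
  field_simp at key2
  linear_combination key2

variable {B : Type*} [CommRing B] [IsDomain B] [Algebra k B]

private lemma resZ_resW {G f : MvPolynomial (Fin 4) k} {m d j : ℕ} (hG : G.IsHomogeneous m)
    (hf : f.IsHomogeneous d) (hj : j ≤ d) (β : k) (q : Fin 4 → B) (l₀ : B) {l₁ l₂ : B}
    (h1 : l₁ ≠ 0) (h2 : l₂ ≠ 0) :
    l₁ ^ (m * j) * resZ G f m j β q l₀ l₁ l₂ =
      (-1) ^ (m * j) * (l₂ ^ (m * j) * resW G f m j β q l₀ l₁ l₂) := by
  let ψ : B →ₐ[k] FractionRing B := IsScalarTower.toAlgHom k B (FractionRing B)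
  have hψ : Function.Injective ψ := IsFractionRing.injective B (FractionRing B)
  apply hψ
  have := resZ_resW_field hG hf hj β (fun i => ψ (q i)) (ψ l₀)
    ((map_ne_zero_iff ψ hψ).2 h1) ((map_ne_zero_iff ψ hψ).2 h2)
  rw [map_mul ψ, map_mul ψ, map_mul ψ, map_pow ψ, map_pow ψ, map_pow ψ, map_neg ψ, map_one ψ,
    resZ_map, resW_map]
  exact this

/-- The resultant in the `Z`-coordinate is divisible by a power of `l₂`, with a quotient that
computes the resultant in the `W`-coordinate as well. -/
theorem exists_eliminant {G f : MvPolynomial (Fin 4) k} {m d j : ℕ} (hG : G.IsHomogeneous m)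
    (hf : f.IsHomogeneous d) (hj : j ≤ d) (β : k) (q : Fin 4 → B) (l₀ l₁ l₂ : B) :
    ∃ E : B, resZ G f m j β q l₀ l₁ l₂ = l₂ ^ (m * j) * E ∧
      resW G f m j β q l₀ l₁ l₂ = (-1) ^ (m * j) * (l₁ ^ (m * j) * E) := by
  let A := MvPolynomial (Fin 3) B
  have h := resZ_resW hG hf hj β (fun i => (C (q i) : A)) (X 0) (l₁ := X 1) (l₂ := X 2)
    (X_ne_zero _) (X_ne_zero _)
  obtain ⟨E, hE⟩ : (X 2 : A) ^ (m * j) ∣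
      resZ G f m j β (fun i => (C (q i) : A)) (X 0) (X 1) (X 2) := by
    refine (X_prime (R := B) (i := (2 : Fin 3))).pow_dvd_of_dvd_mul_left (a := X 1 ^ (m * j)) _ ?_ ?_
    · intro h'
      have := (X_prime (R := B) (i := (2 : Fin 3))).dvd_of_dvd_pow h'
      rw [X_dvd_X] at this
      exact absurd this (by simp)
    · rw [h]
      exact ⟨(-1) ^ (m * j) * resW G f m j β (fun i => (C (q i) : A)) (X 0) (X 1) (X 2), by ring⟩
  have hE2 : resW G f m j β (fun i => (C (q i) : A)) (X 0) (X 1) (X 2) =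
      (-1) ^ (m * j) * (X 1 ^ (m * j) * E) := by
    have h3 : (X 2 : A) ^ (m * j) ≠ 0 := pow_ne_zero _ (X_ne_zero _)
    apply mul_left_cancel₀ h3
    rw [hE] at h
    have h4 : ((-1 : A) ^ (m * j)) * (-1) ^ (m * j) = 1 := by
      rw [← mul_pow, neg_one_mul, neg_neg, one_pow]
    linear_combination (-(-1) ^ (m * j)) * h -
      (X 2 ^ (m * j) * resW G f m j β (fun i => (C (q i) : A)) (X 0) (X 1) (X 2)) * h4
  let ψ : A →ₐ[k] B := (aeval (![l₀, l₁, l₂] : Fin 3 → B)).restrictScalars k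
  have hψC : ∀ b, ψ (C b) = b := fun b => by
    change aeval _ (C b) = b
    rw [aeval_C]; rfl
  have hψX : ∀ i, ψ (X i) = (![l₀, l₁, l₂] : Fin 3 → B) i := fun i => aeval_X _ _
  refine ⟨ψ E, ?_, ?_⟩
  · have := congrArg ψ hE
    rw [resZ_map, map_mul ψ, map_pow ψ, hψX, hψX, hψX] at this
    simp only [hψC] at this
    exact this
  · have := congrArg ψ hE2
    rw [resW_map, map_mul ψ, map_mul ψ, map_pow ψ, map_pow ψ, map_neg ψ, map_one ψ, hψX, hψX,
      hψX] at this
    simp only [hψC] at this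
    exact this

end Elimination

section Axis

variable {k : Type*} [Field k] {f : MvPolynomial (Fin 4) k} {d m : ℕ}

lemma linearIndependent_pair_of_apply_eq_zero {σ : Type*} {q p : σ → k} (i : σ) (hq : q i ≠ 0)
    (hp : p i = 0) (hp0 : p ≠ 0) : LinearIndependent k ![q, p] := by
  rw [LinearIndependent.pair_iff]
  intro s t h
  have h1 := congrFun h i
  simp only [Pi.add_apply, Pi.smul_apply, smul_eq_mul, hp, mul_zero, add_zero, Pi.zero_apply] at h1
  have hs := (mul_eq_zero.1 h1).resolve_right hq
  rw [hs, zero_smul, zero_add] at h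
  exact ⟨hs, (smul_eq_zero.1 h).resolve_right hp0⟩

lemma eval_lineExp_coeff {σ : Type*} (f : MvPolynomial (Fin 4) k)
    (u v : Fin 4 → MvPolynomial σ k) (j : ℕ) (q : σ → k) :
    eval q ((lineExp f u v).coeff j) =
      (lineExp f (fun i => eval q (u i)) (fun i => eval q (v i))).coeff j :=
  lineExp_coeff_map f u v (aeval q) j

lemma lineExp_coeff_isHomogeneous {σ : Type*} {a b j : ℕ} (hf : f.IsHomogeneous d)
    {u v : Fin 4 → MvPolynomial σ k} (hu : ∀ i, (u i).IsHomogeneous a)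
    (hv : ∀ i, (v i).IsHomogeneous b) (hj : j ≤ d) :
    ((lineExp f u v).coeff j).IsHomogeneous ((d - j) * a + j * b) :=
  lineExp_coeff_mem (homogeneousSubmodule σ k) hf hu hv (by omega)

lemma dirDeriv_four {A : Type*} [CommRing A] [Algebra k A] (f : MvPolynomial (Fin 4) k)
    (u v : Fin 4 → A) : dirDeriv f u v = v 0 * aeval u (pderiv 0 f) + v 1 * aeval u (pderiv 1 f) +
      v 2 * aeval u (pderiv 2 f) + v 3 * aeval u (pderiv 3 f) := by
  rw [dirDeriv, Fin.sum_univ_four]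

lemma dirDeriv_eval (f : MvPolynomial (Fin 4) k) (u v : Fin 4 → k) :
    dirDeriv f u v = v 0 * eval u (pderiv 0 f) + v 1 * eval u (pderiv 1 f) +
      v 2 * eval u (pderiv 2 f) + v 3 * eval u (pderiv 3 f) :=
  dirDeriv_four f u v

lemma lineExp_eq_zero_of_forall [Infinite k] {u v : Fin 4 → k}
    (h : ∀ s : k, eval (u + s • v) f = 0) : lineExp f u v = 0 :=
  Polynomial.funext fun s => by rw [lineExp_eval_field, h, Polynomial.eval_zero]

lemma lineExp_eq_zero_of_mem [Infinite k] {W : Submodule k (Fin 4 → k)} (hW : ∀ v ∈ W, eval v f = 0)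
    {u v : Fin 4 → k} (hu : u ∈ W) (hv : v ∈ W) : lineExp f u v = 0 :=
  lineExp_eq_zero_of_forall fun s => hW _ (W.add_mem hu (W.smul_mem s hv))

/-- A line through two points on which `f` expands to zero lies on the surface. -/
lemma isLineOn_span_pair (hf : f.IsHomogeneous d) {u v : Fin 4 → k}
    (huv : LinearIndependent k ![u, v]) (h : lineExp f u v = 0) :
    IsLineOn f (Submodule.span k {u, v}) := by
  constructor
  · have := finrank_span_eq_card huv
    rwa [Matrix.range_cons, Matrix.range_cons, Matrix.range_empty, Set.union_empty,
      Set.singleton_union] at this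
  · intro w hw
    obtain ⟨a, b, rfl⟩ := Submodule.mem_span_pair.1 hw
    have hd : eval v f = 0 := by
      have := lineExp_coeff_top hf u v
      rw [h, Polynomial.coeff_zero] at this
      rw [← coe_aeval_eq_eval]; exact this.symm
    by_cases ha : a = 0
    · rw [ha, zero_smul, zero_add, IsHomogeneous.eval_smul hf, hd, mul_zero]
    · have : a • u + b • v = a • (u + (a⁻¹ * b) • v) := by
        rw [smul_add, smul_smul, mul_inv_cancel_left₀ ha]
      rw [this, IsHomogeneous.eval_smul hf, ← lineExp_eval_field, h, Polynomial.eval_zero, mul_zero]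

lemma axis_support [Infinite k] (hL : ∀ v : Fin 4 → k, v 2 = 0 → v 3 = 0 → eval v f = 0) :
    ∀ s ∈ f.support, s 2 ≠ 0 ∨ s 3 ≠ 0 := by
  have h0 : aeval (![X 0, X 1, 0, 0] : Fin 4 → MvPolynomial (Fin 4) k) f = 0 := by
    refine funext fun v => ?_
    have h1 : eval v (aeval (![X 0, X 1, 0, 0] : Fin 4 → MvPolynomial (Fin 4) k) f) =
        eval ![v 0, v 1, 0, 0] f := by
      rw [← coe_aeval_eq_eval, ← coe_aeval_eq_eval, RingHom.coe_coe, RingHom.coe_coe,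
        ← AlgHom.comp_apply, comp_aeval]
      congr 2
      funext i
      fin_cases i <;> simp
    rw [h1, hL _ rfl rfl, map_zero]
  have hmem : f ∈ Ideal.span (X '' ({2, 3} : Set (Fin 4))) := by
    have hq : (Ideal.Quotient.mkₐ k (Ideal.span (X '' ({2, 3} : Set (Fin 4))) :
        Ideal (MvPolynomial (Fin 4) k))) =
        (Ideal.Quotient.mkₐ k (Ideal.span (X '' ({2, 3} : Set (Fin 4))))).comp
          (aeval (![X 0, X 1, 0, 0] : Fin 4 → MvPolynomial (Fin 4) k)) := by
      ext i
      have h2 : ∀ i ∈ ({2, 3} : Set (Fin 4)), (Ideal.Quotient.mkₐ k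
          (Ideal.span (X '' ({2, 3} : Set (Fin 4))) : Ideal (MvPolynomial (Fin 4) k))) (X i) = 0 :=
        fun i hi => Ideal.Quotient.eq_zero_iff_mem.2 (Ideal.subset_span ⟨i, hi, rfl⟩)
      fin_cases i
      · simp
      · simp
      · rw [AlgHom.comp_apply, aeval_X]; exact (h2 2 (by simp)).trans (map_zero _).symm
      · rw [AlgHom.comp_apply, aeval_X]; exact (h2 3 (by simp)).trans (map_zero _).symm
    have := congrArg (fun F => F f) hq
    simp only [AlgHom.comp_apply, h0, map_zero] at this
    exact Ideal.Quotient.eq_zero_iff_mem.1 this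
  rw [mem_ideal_span_X_image] at hmem
  intro s hs
  obtain ⟨i, hi, h⟩ := hmem s hs
  rcases hi with rfl | rfl
  · exact Or.inl h
  · exact Or.inr h

lemma axis_support_le [Infinite k] (hf : f.IsHomogeneous (m + 1))
    (hL : ∀ v : Fin 4 → k, v 2 = 0 → v 3 = 0 → eval v f = 0) :
    ∀ s ∈ f.support, s 0 + s 1 ≤ m := by
  intro s hs
  have h1 : s.degree = m + 1 := by
    have := hf (mem_support_iff.1 hs)
    rw [Finsupp.degree_eq_weight_one]; exact this
  rw [Finsupp.degree_eq_sum, Fin.sum_univ_four] at h1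
  have := axis_support hL s hs
  omega

lemma axis_decomposition [Infinite k] (hf : f.IsHomogeneous (m + 1))
    (hL : ∀ v : Fin 4 → k, v 2 = 0 → v 3 = 0 → eval v f = 0) :
    ∃ f₁ f₂ : MvPolynomial (Fin 4) k, f₁.IsHomogeneous m ∧ f₂.IsHomogeneous m ∧
      f = X 2 * f₁ + X 3 * f₂ := by
  have hmem : f ∈ Ideal.span (X '' ({2, 3} : Set (Fin 4))) := by
    rw [mem_ideal_span_X_image]
    intro s hs
    rcases axis_support hL s hs with h | h
    exacts [⟨2, by simp, h⟩, ⟨3, by simp, h⟩]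
  rw [Set.image_pair, Ideal.mem_span_pair] at hmem
  obtain ⟨a, b, hab⟩ := hmem
  refine ⟨homogeneousComponent m a, homogeneousComponent m b, homogeneousComponent_isHomogeneous _ _,
    homogeneousComponent_isHomogeneous _ _, ?_⟩
  have key : ∀ (i : Fin 4) (a : MvPolynomial (Fin 4) k), homogeneousComponent (m + 1) (a * X i) =
      X i * homogeneousComponent m a := by
    intro i a
    ext s
    rw [coeff_homogeneousComponent, coeff_mul_X', coeff_X_mul', coeff_homogeneousComponent]
    by_cases hi : i ∈ s.support
    · have h1 : s.degree = (s - Finsupp.single i 1).degree + 1 := by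
        have h2 : s = (s - Finsupp.single i 1) + Finsupp.single i 1 := by
          rw [tsub_add_cancel_of_le]
          rw [Finsupp.single_le_iff]
          exact Nat.one_le_iff_ne_zero.2 (Finsupp.mem_support_iff.1 hi)
        conv_lhs => rw [h2]
        rw [map_add, Finsupp.degree_single]
      simp only [hi, if_true, h1, add_left_inj]
    · simp [hi]
  have h3 := congrArg (homogeneousComponent (m + 1)) hab
  rw [map_add, key, key, homogeneousComponent_of_mem hf, if_pos rfl] at h3
  exact h3.symm

end Axis

section AxisForms

variable {k : Type*} [Field k] {f : MvPolynomial (Fin 4) k} {d m : ℕ}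

/-- The point where the tangent plane at the generic point meets the axis `x = y = 0`. -/
noncomputable def axisPoint (f : MvPolynomial (Fin 4) k) : Fin 4 → MvPolynomial (Fin 4) k :=
  ![-pderiv 1 f, pderiv 0 f, 0, 0]

/-- The coefficients of the expansion of `f` along the line from `q` to its axis point. -/
noncomputable def axisForm (f : MvPolynomial (Fin 4) k) (j : ℕ) : MvPolynomial (Fin 4) k :=
  (lineExp f X (axisPoint f)).coeff j

lemma eval_axisPoint (f : MvPolynomial (Fin 4) k) (q : Fin 4 → k) :
    (fun i => eval q (axisPoint f i)) =
      ![-eval q (pderiv 1 f), eval q (pderiv 0 f), 0, 0] := by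
  funext i; fin_cases i <;> simp [axisPoint]

lemma eval_axisForm (f : MvPolynomial (Fin 4) k) (j : ℕ) (q : Fin 4 → k) :
    eval q (axisForm f j) =
      (lineExp f q ![-eval q (pderiv 1 f), eval q (pderiv 0 f), 0, 0]).coeff j := by
  rw [axisForm, eval_lineExp_coeff, eval_axisPoint]
  simp only [eval_X]

lemma axisForm_isHomogeneous (hf : f.IsHomogeneous (m + 1)) {j : ℕ} (hj : j ≤ m + 1) :
    (axisForm f j).IsHomogeneous (m + 1 - j + j * m) := by
  have hp : ∀ i, (axisPoint f i).IsHomogeneous m := by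
    intro i
    fin_cases i
    · exact (hf.pderiv (i := 1)).neg
    · exact hf.pderiv (i := 0)
    · exact isHomogeneous_zero _ _ _
    · exact isHomogeneous_zero _ _ _
  have := lineExp_coeff_isHomogeneous hf (fun i => isHomogeneous_X k i) hp hj
  rwa [mul_one] at this

lemma dirDeriv_axisPoint (f : MvPolynomial (Fin 4) k) (q : Fin 4 → k) :
    dirDeriv f q ![-eval q (pderiv 1 f), eval q (pderiv 0 f), 0, 0] = 0 := by
  rw [dirDeriv_eval]
  simp [mul_comm]

/-- If `f` is not divided by a form `h`, some point of the surface off all lines with `x = 1`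
does not annihilate `h`. -/
lemma IsSmoothSurface.exists_general_point [IsAlgClosed k] (hf : IsSmoothSurface f d) (hd : 3 ≤ d)
    (hfin : {W | IsLineOn f W}.Finite) {h : MvPolynomial (Fin 4) k} {e : ℕ}
    (hh : h.IsHomogeneous e) (hfh : ¬ f ∣ h) :
    ∃ q : Fin 4 → k, eval q f = 0 ∧ q 2 = 1 ∧ (∀ W, IsLineOn f W → q ∉ W) ∧ eval q h ≠ 0 := by
  classical
  have hp : Prime f := hf.prime (by omega)
  have hdeg : f.totalDegree = d := hf.2.1.totalDegree hf.1
  have hl : ∀ W : Submodule k (Fin 4 → k), ∃ l : MvPolynomial (Fin 4) k, IsLineOn f W →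
      l ≠ 0 ∧ l.IsHomogeneous 1 ∧ ∀ v ∈ W, eval v l = 0 := by
    intro W
    by_cases hW : IsLineOn f W
    · obtain ⟨φ, hφ, hφW⟩ := Submodule.exists_dual_map_eq_bot_of_lt_top (p := W) (by
        rw [lt_top_iff_ne_top]
        rintro rfl
        have := hW.1
        rw [finrank_top, Module.finrank_fin_fun] at this
        omega) inferInstance
      have hev : ∀ v, eval v (∑ i, C (φ (Pi.single i 1)) * X i : MvPolynomial (Fin 4) k) = φ v := by
        intro v
        rw [map_sum]
        conv_rhs => rw [LinearMap.pi_apply_eq_sum_univ φ v]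
        refine Finset.sum_congr rfl fun i _ => ?_
        rw [map_mul, eval_C, eval_X, smul_eq_mul, mul_comm]
        congr 2
        funext j
        simp [Pi.single_apply, eq_comm]
      refine ⟨∑ i, C (φ (Pi.single i 1)) * X i, fun _ => ⟨?_, ?_, ?_⟩⟩
      · intro h0
        apply hφ
        refine LinearMap.ext fun v => ?_
        rw [← hev v, h0, map_zero, LinearMap.zero_apply]
      · refine IsHomogeneous.sum _ _ _ fun i _ => ?_
        simpa using (isHomogeneous_C _ _).mul (isHomogeneous_X k i)
      · intro v hv
        rw [hev]
        have : φ v ∈ W.map φ := Submodule.mem_map_of_mem hv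
        rwa [hφW, Submodule.mem_bot] at this
    · exact ⟨0, fun h => absurd h hW⟩
  choose l hl using hl
  obtain ⟨q, hq, hne⟩ := exists_eval_ne_zero_of_not_dvd hp
    (h := X 2 * h * ∏ W ∈ hfin.toFinset, l W) (by
      intro hdvd
      have hlin : ∀ g : MvPolynomial (Fin 4) k, g ≠ 0 → g.IsHomogeneous 1 → ¬ f ∣ g :=
        fun g h0 h1 => not_dvd_of_totalDegree_lt h0 (by rw [h1.totalDegree h0, hdeg]; omega)
      rcases hp.dvd_or_dvd hdvd with h1 | h1
      · rcases hp.dvd_or_dvd h1 with h1 | h1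
        · exact hlin _ (X_ne_zero _) (isHomogeneous_X _ _) h1
        · exact hfh h1
      · obtain ⟨W, hW, h2⟩ := (hp.dvd_finsetProd_iff _).1 h1
        obtain ⟨h3, h4, -⟩ := hl W (by simpa using hW)
        exact hlin _ h3 h4 h2)
  rw [map_mul, map_mul, map_prod, eval_X] at hne
  have h2 : q 2 ≠ 0 := left_ne_zero_of_mul (left_ne_zero_of_mul hne)
  have h3 : eval q h ≠ 0 := right_ne_zero_of_mul (left_ne_zero_of_mul hne)
  have h4 := Finset.prod_ne_zero_iff.1 (right_ne_zero_of_mul hne)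
  refine ⟨(q 2)⁻¹ • q, ?_, ?_, ?_, ?_⟩
  · rw [IsHomogeneous.eval_smul hf.2.1, hq, mul_zero]
  · simp [h2]
  · intro W hW hqW
    have hq' : q ∈ W := by
      have := W.smul_mem (q 2) hqW
      rwa [smul_smul, mul_inv_cancel₀ h2, one_smul] at this
    exact h4 W (by simpa using hW) ((hl W hW).2.2 q hq')
  · rw [IsHomogeneous.eval_smul hh]
    exact mul_ne_zero (pow_ne_zero _ (inv_ne_zero h2)) h3

lemma pderiv_not_dvd (hf : f.IsHomogeneous (m + 1)) (i : Fin 4) (h : pderiv i f ≠ 0) :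
    ¬ f ∣ pderiv i f := by
  have hf0 : f ≠ 0 := fun h0 => h (by rw [h0, map_zero])
  refine not_dvd_of_totalDegree_lt h ?_
  have h1 : (pderiv i f).IsHomogeneous m := hf.pderiv
  rw [h1.totalDegree h, hf.totalDegree hf0]
  omega

/-- Not all the intermediate axis forms vanish on the surface. -/
lemma exists_axisForm_not_dvd [IsAlgClosed k] (hf : IsSmoothSurface f (m + 1)) (hm : 2 ≤ m)
    (hfin : {W | IsLineOn f W}.Finite)
    (hL : ∀ v : Fin 4 → k, v 2 = 0 → v 3 = 0 → eval v f = 0) (hw : pderiv 0 f ≠ 0) :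
    ∃ j, 2 ≤ j ∧ j ≤ m ∧ ¬ f ∣ axisForm f j := by
  by_contra! hno
  obtain ⟨q, hq, hq2, hqW, hqw⟩ := hf.exists_general_point (by omega) hfin
    (hf.2.1.pderiv (i := 0)) (pderiv_not_dvd hf.2.1 0 hw)
  set p : Fin 4 → k := ![-eval q (pderiv 1 f), eval q (pderiv 0 f), 0, 0] with hp
  have h0 : lineExp f q p = 0 := by
    ext j
    rw [Polynomial.coeff_zero]
    rcases Nat.lt_or_ge (m + 1) j with h | h
    · exact Polynomial.coeff_eq_zero_of_natDegree_lt ((lineExp_natDegree_le hf.2.1 q p).trans_lt h)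
    rcases Nat.lt_or_ge j 2 with h2 | h2
    · interval_cases j
      · rw [lineExp_coeff_zero]; exact hq
      · rw [lineExp_coeff_one, hp, dirDeriv_axisPoint]
    rcases h.lt_or_eq with h3 | rfl
    · obtain ⟨g, hg⟩ := hno j h2 (by omega)
      rw [hp, ← eval_axisForm, hg, map_mul, hq, zero_mul]
    · rw [lineExp_coeff_top hf.2.1]
      exact hL p (by simp [hp]) (by simp [hp])
  refine hqW _ (isLineOn_span_pair hf.2.1 ?_ h0) (Submodule.subset_span (by simp))
  refine linearIndependent_pair_of_apply_eq_zero 2 (by rw [hq2]; exact one_ne_zero) (by simp [hp]) ?_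
  intro h
  exact hqw (by simpa [hp] using congrFun h 1)

/-- A line on the surface meeting the axis lies on every axis form. -/
lemma axisForm_eval_eq_zero [IsAlgClosed k] {W : Submodule k (Fin 4 → k)}
    (hW : IsLineOn f W) {c : Fin 4 → k} (hc : c ∈ W) (hc0 : c ≠ 0) (hc2 : c 2 = 0) (hc3 : c 3 = 0)
    {j : ℕ} {q : Fin 4 → k} (hq : q ∈ W) : eval q (axisForm f (j + 1)) = 0 := by
  rw [eval_axisForm]
  have h1 : lineExp f q c = 0 := lineExp_eq_zero_of_mem hW.2 hq hc
  have h2 := lineExp_coeff_one f q c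
  rw [h1, Polynomial.coeff_zero, dirDeriv_eval, hc2, hc3] at h2
  simp only [zero_mul, add_zero] at h2
  obtain ⟨t, ht⟩ : ∃ t : k, (![-eval q (pderiv 1 f), eval q (pderiv 0 f), 0, 0] : Fin 4 → k) =
      fun i => t * c i := by
    by_cases h0 : c 0 = 0
    · have hc1 : c 1 ≠ 0 := fun h1 => hc0 (by funext i; fin_cases i <;> assumption)
      refine ⟨eval q (pderiv 0 f) / c 1, ?_⟩
      rw [h0, zero_mul, zero_add] at h2
      have h3 := ((mul_eq_zero.1 h2.symm).resolve_left hc1)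
      funext i
      fin_cases i <;> simp [h0, hc1, hc2, hc3, h3]
    · refine ⟨-eval q (pderiv 1 f) / c 0, ?_⟩
      funext i
      fin_cases i <;> simp [hc2, hc3, h0]
      field_simp
      linear_combination -h2
  rw [ht, lineExp_coeff_smul_right, h1, Polynomial.coeff_zero, mul_zero]

end AxisForms

section GeneralPosition

variable {k : Type*} [Field k] {f : MvPolynomial (Fin 4) k} {d m : ℕ}

lemma polynomial_eq_zero_of_eval [Infinite k] {P Q : Polynomial k} (hQ : Q ≠ 0)
    (h : ∀ t, Q.eval t ≠ 0 → P.eval t = 0) : P = 0 := by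
  have : P * Q = 0 := Polynomial.funext fun t => by
    by_cases ht : Q.eval t = 0
    · simp [ht]
    · simp [h t ht]
  exact (mul_eq_zero.1 this).resolve_right hQ

lemma IsHomogeneous.eval_smul_add_smul (hf : f.IsHomogeneous d) (q v : Fin 4 → k) (a s : k) :
    eval (a • q + s • v) f =
      ∑ i ∈ Finset.range (d + 1), (lineExp f q v).coeff i * a ^ (d - i) * s ^ i := by
  by_cases ha : a = 0
  · subst ha
    rw [zero_smul, zero_add, IsHomogeneous.eval_smul hf, Finset.sum_range_succ,
      Finset.sum_eq_zero, zero_add, lineExp_coeff_top hf, Nat.sub_self, pow_zero, mul_one, mul_comm]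
    · rfl
    · intro i hi
      rw [Finset.mem_range] at hi
      rw [zero_pow (by omega), mul_zero, zero_mul]
  · have : a • q + s • v = a • (q + (a⁻¹ * s) • v) := by
      rw [smul_add, smul_smul, mul_inv_cancel_left₀ ha]
    rw [this, IsHomogeneous.eval_smul hf, ← lineExp_eval_field,
      Polynomial.eval_eq_sum_range' (Nat.lt_succ_of_le (lineExp_natDegree_le hf q v)),
      Finset.mul_sum]
    refine Finset.sum_congr rfl fun i hi => ?_
    rw [Finset.mem_range] at hi
    have h1 : a ^ d = a ^ (d - i) * a ^ i := by rw [← pow_add, Nat.sub_add_cancel (by omega)]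
    rw [mul_pow, inv_pow, h1]
    field_simp

lemma lineExp_coeff_add_smul_self [Infinite k] (hf : f.IsHomogeneous d) {q v : Fin 4 → k} {j : ℕ}
    (hj : j ≤ d) (h : ∀ i < j, (lineExp f q v).coeff i = 0) (c : k) :
    (lineExp f q (v + c • q)).coeff j = (lineExp f q v).coeff j := by
  have key : lineExp f q (v + c • q) = ∑ i ∈ Finset.range (d + 1),
      Polynomial.C ((lineExp f q v).coeff i) *
        (1 + Polynomial.C c * Polynomial.X) ^ (d - i) * Polynomial.X ^ i := by
    refine Polynomial.funext fun s => ?_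
    rw [lineExp_eval_field, Polynomial.eval_finsetSum,
      show q + s • (v + c • q) = (1 + c * s) • q + s • v by
        ext i; simp; ring, IsHomogeneous.eval_smul_add_smul hf]
    refine Finset.sum_congr rfl fun i _ => ?_
    simp
  rw [key, Polynomial.finsetSum_coeff, Finset.sum_eq_single j]
  · rw [Polynomial.coeff_mul_X_pow', if_pos le_rfl, Nat.sub_self, Polynomial.coeff_zero_eq_eval_zero]
    simp
  · intro i _ hij
    rw [Polynomial.coeff_mul_X_pow']
    split_ifs with h1
    · rw [h i (lt_of_le_of_ne h1 hij)]; simp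
    · rfl
  · intro h1
    exact absurd (Finset.mem_range.2 (by omega)) h1

lemma dirDeriv_self [Infinite k] (hf : f.IsHomogeneous d) {q : Fin 4 → k} (hq : eval q f = 0) :
    dirDeriv f q q = 0 := by
  have h : lineExp f q q = 0 := lineExp_eq_zero_of_forall fun s => by
    rw [show q + s • q = (1 + s) • q by ext i; simp; ring, IsHomogeneous.eval_smul hf, hq, mul_zero]
  rw [← lineExp_coeff_one, h, Polynomial.coeff_zero]

/-- Only finitely many planes through the axis contain a point of the surface on an asymptotic
direction of a general point. -/
lemma finite_asymptotic_planes [Infinite k] (hf : f.IsHomogeneous d) {j : ℕ} (hj : j ≤ d)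
    {q : Fin 4 → k} (hq : eval q f = 0) (hq2 : q 2 = 1) (hw : eval q (pderiv 0 f) ≠ 0)
    (hline : ∀ W, IsLineOn f W → q ∉ W)
    (hflat : ∀ u, dirDeriv f q u = 0 → ∀ i < j, (lineExp f q u).coeff i = 0)
    (hex : ∃ u, dirDeriv f q u = 0 ∧ (lineExp f q u).coeff j ≠ 0) :
    {β | β ≠ q 3 ∧ ∃ v : Fin 4 → k, v 2 = 1 ∧ v 3 = β ∧ dirDeriv f q v = 0 ∧ eval v f = 0 ∧
      (lineExp f q v).coeff j = 0}.Finite := by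
  classical
  have hqq := dirDeriv_self hf hq
  set fw := eval q (pderiv 0 f) with hfw
  set fz := eval q (pderiv 1 f) with hfz
  set fx := eval q (pderiv 2 f) with hfx
  set fy := eval q (pderiv 3 f) with hfy
  have hdir : ∀ u : Fin 4 → k, dirDeriv f q u = u 0 * fw + u 1 * fz + u 2 * fx + u 3 * fy :=
    fun u => dirDeriv_eval f q u
  set n : Fin 4 → k := ![-fy / fw, 0, 0, 1] with hn
  set p : Fin 4 → k := ![-fz / fw, 1, 0, 0] with hp
  set r : k → Fin 4 → k := fun κ i => n i + κ * p i with hr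
  have hr0 : ∀ κ, r κ 0 = -fy / fw + κ * (-fz / fw) := fun κ => rfl
  have hr1 : ∀ κ, r κ 1 = κ := fun κ => by simp [hr, hn, hp]
  have hr2 : ∀ κ, r κ 2 = 0 := fun κ => by simp [hr, hn, hp]
  have hr3 : ∀ κ, r κ 3 = 1 := fun κ => by simp [hr, hn, hp]
  have hdr : ∀ κ, dirDeriv f q (r κ) = 0 := by
    intro κ
    rw [hdir, hr0, hr1, hr2, hr3]
    field_simp
    ring
  set φ := lineExpAlong f j q n p with hφ
  have hφe : ∀ κ, φ.eval κ = (lineExp f q (r κ)).coeff j := fun κ => lineExpAlong_eval f j q n p κ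
  -- a tangent vector without `x`-coordinate is a multiple of some `r κ`
  have htan : ∀ u : Fin 4 → k, dirDeriv f q u = 0 → u 2 = 0 → u 3 ≠ 0 →
      u = fun i => u 3 * r (u 1 / u 3) i := by
    intro u hu hu2 hu3
    rw [hdir, hu2] at hu
    funext i
    fin_cases i
    · change u 0 = u 3 * r (u 1 / u 3) 0
      rw [hr0]
      field_simp
      linear_combination hu
    · change u 1 = u 3 * r (u 1 / u 3) 1
      rw [hr1]; field_simp
    · change u 2 = u 3 * r (u 1 / u 3) 2
      rw [hr2, hu2, mul_zero]
    · change u 3 = u 3 * r (u 1 / u 3) 3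
      rw [hr3, mul_one]
  have hcoef : ∀ u : Fin 4 → k, dirDeriv f q u = 0 → u 2 = 0 → u 3 ≠ 0 →
      (lineExp f q u).coeff j = u 3 ^ j * φ.eval (u 1 / u 3) := by
    intro u hu hu2 hu3
    rw [hφe, ← lineExp_coeff_smul_right, ← htan u hu hu2 hu3]
  have hφ0 : φ ≠ 0 := by
    intro h0
    obtain ⟨u, hu, huj⟩ := hex
    set u' : Fin 4 → k := u + (-u 2) • q with hu'
    have hu'0 : dirDeriv f q u' = 0 := by
      rw [hdir] at hu hqq ⊢
      simp only [hu', Pi.add_apply, Pi.smul_apply, smul_eq_mul]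
      linear_combination hu - u 2 * hqq
    have hu'2 : u' 2 = 0 := by simp [hu', hq2]
    have hu'j : (lineExp f q u').coeff j ≠ 0 := by
      rwa [hu', lineExp_coeff_add_smul_self hf hj (hflat u hu)]
    have hg : lineExpAlong f j q u' n = 0 := by
      refine polynomial_eq_zero_of_eval (Q := Polynomial.X + Polynomial.C (u' 3))
        (Polynomial.X_add_C_ne_zero _) fun t ht => ?_
      rw [Polynomial.eval_add, Polynomial.eval_X, Polynomial.eval_C] at ht
      rw [lineExpAlong_eval, hcoef _ _ _ _, h0, Polynomial.eval_zero, mul_zero]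
      · rw [hdir] at hu'0 ⊢
        simp only [hn, Matrix.cons_val]
        field_simp
        linear_combination hu'0
      · simp [hn, hu'2]
      · simpa [hn, add_comm] using ht
    apply hu'j
    have := lineExpAlong_eval f j q u' n 0
    rw [hg, Polynomial.eval_zero] at this
    simpa using this.symm
  have hline' : ∀ κ, lineExp f q (r κ) ≠ 0 := by
    intro κ h0
    refine hline _ (isLineOn_span_pair hf ?_ h0) (Submodule.subset_span (by simp))
    refine linearIndependent_pair_of_apply_eq_zero 2 (by rw [hq2]; exact one_ne_zero) (hr2 κ) ?_
    intro h
    have := hr3 κ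
    rw [h] at this
    exact zero_ne_one this
  refine Set.Finite.subset (Set.Finite.biUnion (φ.roots.toFinset.finite_toSet)
    (t := fun κ => (fun τ => q 3 + τ) '' ((lineExp f q (r κ)).roots.toFinset : Set k))
    fun κ _ => Set.Finite.image _ (Finset.finite_toSet _)) ?_
  rintro β ⟨hβ, v, hv2, hv3, hvd, hvf, hvj⟩
  set u : Fin 4 → k := v + (-1 : k) • q with hu
  have hτ : u 3 ≠ 0 := by
    have : u 3 = β - q 3 := by simp [hu, hv3]; ring
    rw [this]
    exact sub_ne_zero.2 hβ
  have hu2 : u 2 = 0 := by simp [hu, hv2, hq2]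
  have hud : dirDeriv f q u = 0 := by
    rw [hdir] at hvd hqq ⊢
    simp only [hu, Pi.add_apply, Pi.smul_apply, smul_eq_mul]
    linear_combination hvd - hqq
  have huj : (lineExp f q u).coeff j = 0 := by
    rw [hu, lineExp_coeff_add_smul_self hf hj (hflat v hvd), hvj]
  rw [hcoef u hud hu2 hτ] at huj
  have hroot := (mul_eq_zero.1 huj).resolve_left (pow_ne_zero _ hτ)
  refine Set.mem_biUnion (x := u 1 / u 3) ?_ ⟨u 3, ?_, ?_⟩
  · simp only [Finset.mem_coe, Multiset.mem_toFinset]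
    exact (Polynomial.mem_roots hφ0).2 hroot
  · simp only [Finset.mem_coe, Multiset.mem_toFinset]
    refine (Polynomial.mem_roots (hline' _)).2 ?_
    rw [Polynomial.IsRoot, lineExp_eval_field]
    have h1 : u 3 • r (u 1 / u 3) = u := (htan u hud hu2 hτ).symm
    rw [h1, show q + u = v by rw [hu]; simp]
    exact hvf
  · simp [hu, hv3]

end GeneralPosition

section Eliminant

variable {k : Type*} [Field k] {f : MvPolynomial (Fin 4) k} {d m : ℕ}

lemma homogeneousComponent_mul_of_isHomogeneous {σ : Type*} {n : ℕ} {a : MvPolynomial σ k}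
    (ha : a.IsHomogeneous n) (b : MvPolynomial σ k) (e : ℕ) :
    homogeneousComponent (n + e) (a * b) = a * homogeneousComponent e b := by
  conv_lhs => rw [← sum_homogeneousComponent b]
  rw [Finset.mul_sum, map_sum]
  have h : ∀ i, homogeneousComponent (n + e) (a * homogeneousComponent i b) =
      if i = e then a * homogeneousComponent e b else 0 := by
    intro i
    rw [homogeneousComponent_of_mem (ha.mul (homogeneousComponent_isHomogeneous i b))]
    by_cases hi : i = e
    · rw [if_pos (by omega), if_pos hi, hi]
    · rw [if_neg (by omega), if_neg hi]
  simp only [h, Finset.sum_ite_eq', Finset.mem_range]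
  split_ifs with hlt
  · rfl
  · rw [homogeneousComponent_eq_zero _ _ (by omega), mul_zero]

lemma IsHomogeneous.of_mul_left {σ : Type*} {n e : ℕ} {a b : MvPolynomial σ k}
    (ha : a.IsHomogeneous n) (ha0 : a ≠ 0) (hab : (a * b).IsHomogeneous (n + e)) :
    b.IsHomogeneous e := by
  have h1 := homogeneousComponent_mul_of_isHomogeneous ha b e
  rw [homogeneousComponent_of_mem hab, if_pos rfl] at h1
  rw [mul_left_cancel₀ ha0 h1]
  exact homogeneousComponent_isHomogeneous _ _

/-- A form in the point `q` detecting a common point of the tangent plane at `q`, the plane curve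
`G = 0` and the cone of asymptotic directions of order `j` in the plane `y = β x`. -/
lemma exists_tangent_eliminant [IsAlgClosed k] {G : MvPolynomial (Fin 4) k} {j : ℕ}
    (hf : f.IsHomogeneous (m + 1)) (hG : G.IsHomogeneous m) (hm : m ≠ 0) (hj : j ≤ m)
    (hw : pderiv 0 f ≠ 0) (β : k) :
    ∃ E : MvPolynomial (Fin 4) k, E.IsHomogeneous (m * (m * j + m + 1 - j)) ∧
      (∀ q v : Fin 4 → k, (eval q (pderiv 1 f) ≠ 0 ∨ eval q (pderiv 0 f) ≠ 0) → v 2 = 1 → v 3 = β →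
        dirDeriv f q v = 0 → eval v G = 0 → (lineExp f q v).coeff j = 0 → eval q E = 0) ∧
      (∀ q : Fin 4 → k, eval q (pderiv 0 f) ≠ 0 →
        eval ![-eval q (pderiv 1 f), eval q (pderiv 0 f), 0, 0] G ≠ 0 →
        (∀ v : Fin 4 → k, v 2 = 1 → v 3 = β → dirDeriv f q v = 0 → eval v G = 0 →
          (lineExp f q v).coeff j ≠ 0) → eval q E ≠ 0) := by
  set l₀ : MvPolynomial (Fin 4) k := pderiv 2 f + C β * pderiv 3 f with hl₀
  obtain ⟨E, hE1, hE2⟩ := exists_eliminant hG hf (hj.trans m.le_succ) β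
    (X : Fin 4 → MvPolynomial (Fin 4) k) l₀ (pderiv 1 f) (pderiv 0 f)
  have hom : ∀ i, (pderiv i f).IsHomogeneous m := fun i => hf.pderiv
  have hom0 : l₀.IsHomogeneous m := by
    refine (hom 2).add ?_
    simpa using (isHomogeneous_C _ β).mul (hom 3)
  have hEh : E.IsHomogeneous (m * (m * j + m + 1 - j)) := by
    refine IsHomogeneous.of_mul_left ((hom 0).pow (m * j)) (pow_ne_zero _ hw) ?_
    rw [← hE1, resZ]
    have hn : ∀ i, ((![-l₀, 0, pderiv 0 f, algebraMap k _ β * pderiv 0 f] :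
        Fin 4 → MvPolynomial (Fin 4) k) i).IsHomogeneous m := by
      intro i
      fin_cases i
      · exact hom0.neg
      · exact isHomogeneous_zero _ _ _
      · exact hom 0
      · have := (isHomogeneous_C (Fin 4) β).mul (hom 0)
        rwa [zero_add] at this
    have hp : ∀ i, ((![-pderiv 1 f, pderiv 0 f, 0, 0] :
        Fin 4 → MvPolynomial (Fin 4) k) i).IsHomogeneous m := by
      intro i
      fin_cases i
      · exact (hom 1).neg
      · exact hom 0
      · exact isHomogeneous_zero _ _ _
      · exact isHomogeneous_zero _ _ _
    have h1 : ∀ i, ((lineExp G ![-l₀, 0, pderiv 0 f, algebraMap k _ β * pderiv 0 f]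
        ![-pderiv 1 f, pderiv 0 f, 0, 0]).coeff i).IsHomogeneous (m * m) := by
      intro i
      rcases Nat.lt_or_ge m i with h | h
      · rw [Polynomial.coeff_eq_zero_of_natDegree_lt ((lineExp_natDegree_le hG _ _).trans_lt h)]
        exact isHomogeneous_zero _ _ _
      · have := lineExp_coeff_isHomogeneous hG hn hp h
        rwa [← add_mul, Nat.sub_add_cancel h] at this
    have h2 := lineExpAlong_coeff_isHomogeneous hf (hj.trans m.le_succ)
      (fun i => isHomogeneous_X k i) hn hp
    have h3 := resultant_isHomogeneous (m := m) (n := j) h1 h2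
    convert h3 using 1
    obtain ⟨c, rfl⟩ := Nat.exists_eq_add_of_le hj
    rw [show (j + c) * j + (j + c) + 1 - j = (j + c) * j + c + 1 by omega,
      show j + c + 1 - j = c + 1 by omega]
    ring
  have hev0 : ∀ q, eval q l₀ = eval q (pderiv 2 f) + β * eval q (pderiv 3 f) := fun q => by
    simp [hl₀]
  have hZ : ∀ q : Fin 4 → k, resZ G f m j β q (eval q l₀) (eval q (pderiv 1 f))
      (eval q (pderiv 0 f)) = eval q (pderiv 0 f) ^ (m * j) * eval q E := by
    intro q
    rw [← map_pow, ← map_mul, ← hE1]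
    have := resZ_map G f m j β X l₀ (pderiv 1 f) (pderiv 0 f) (aeval q : _ →ₐ[k] k)
    simp only [aeval_X] at this
    exact this.symm
  have hW : ∀ q : Fin 4 → k, resW G f m j β q (eval q l₀) (eval q (pderiv 1 f))
      (eval q (pderiv 0 f)) = (-1) ^ (m * j) * (eval q (pderiv 1 f) ^ (m * j) * eval q E) := by
    intro q
    have := resW_map G f m j β X l₀ (pderiv 1 f) (pderiv 0 f) (aeval q : _ →ₐ[k] k)
    simp only [aeval_X, hE2] at this
    refine this.symm.trans ?_
    change eval q _ = _
    simp
  refine ⟨E, hEh, ?_, ?_⟩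
  · intro q v hq hv2 hv3 hd hvG hvj
    rw [dirDeriv_eval, hv2, hv3] at hd
    have hsc : ∀ (c : k) (w : Fin 4 → k), w = (fun i => c * v i) →
        eval w G = 0 ∧ (lineExp f q w).coeff j = 0 := by
      rintro c w rfl
      refine ⟨?_, by rw [lineExp_coeff_smul_right, hvj, mul_zero]⟩
      have := IsHomogeneous.eval_smul hG c v
      rw [hvG, mul_zero] at this
      exact this
    by_cases h0 : eval q (pderiv 0 f) = 0
    · have h1 : eval q (pderiv 1 f) ≠ 0 := hq.resolve_right (not_not.2 h0)
      have h2 := hW q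
      obtain ⟨h3, h4⟩ := hsc (eval q (pderiv 1 f)) (fun i =>
        (![0, -eval q l₀, eval q (pderiv 1 f), algebraMap k k β * eval q (pderiv 1 f)] : Fin 4 → k) i +
          v 0 * (![eval q (pderiv 1 f), -eval q (pderiv 0 f), 0, 0] : Fin 4 → k) i) (by
        funext i
        fin_cases i
        · simp [mul_comm]
        · simp only [hev0]
          simp
          linear_combination -hd
        · simp [hv2]
        · simp [hv3, mul_comm])
      rw [resW, resultant_eq_zero_of_common_root (x := v 0) (lineExp_natDegree_le hG _ _)
        (lineExpAlong_natDegree_le hf (hj.trans m.le_succ) _ _ _) hm] at h2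
      · have h5 := (mul_eq_zero.1 h2.symm).resolve_left (pow_ne_zero _ (by simp))
        exact (mul_eq_zero.1 h5).resolve_left (pow_ne_zero _ h1)
      · rw [lineExp_eval]; exact h3
      · rw [lineExpAlong_eval]; exact h4
    · have h2 := hZ q
      obtain ⟨h3, h4⟩ := hsc (eval q (pderiv 0 f)) (fun i =>
        (![-eval q l₀, 0, eval q (pderiv 0 f), algebraMap k k β * eval q (pderiv 0 f)] : Fin 4 → k) i +
          v 1 * (![-eval q (pderiv 1 f), eval q (pderiv 0 f), 0, 0] : Fin 4 → k) i) (by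
        funext i
        fin_cases i
        · simp only [hev0]
          simp
          linear_combination -hd
        · simp [mul_comm]
        · simp [hv2]
        · simp [hv3, mul_comm])
      rw [resZ, resultant_eq_zero_of_common_root (x := v 1) (lineExp_natDegree_le hG _ _)
        (lineExpAlong_natDegree_le hf (hj.trans m.le_succ) _ _ _) hm] at h2
      · exact (mul_eq_zero.1 h2.symm).resolve_left (pow_ne_zero _ h0)
      · rw [lineExp_eval]; exact h3
      · rw [lineExpAlong_eval]; exact h4
  · intro q h0 hp hno hE0
    have h2 := hZ q
    rw [hE0, mul_zero] at h2
    refine resultant_ne_zero_of_no_common_root (m := m) (n := j) ?_ ?_ ?_ ?_ h2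
    · refine le_antisymm (lineExp_natDegree_le hG _ _) ?_
      refine Polynomial.le_natDegree_of_ne_zero ?_
      rw [lineExp_coeff_top hG]
      exact hp
    · intro h
      have := lineExp_coeff_top hG (![-eval q l₀, 0, eval q (pderiv 0 f),
        algebraMap k k β * eval q (pderiv 0 f)] : Fin 4 → k)
        ![-eval q (pderiv 1 f), eval q (pderiv 0 f), 0, 0]
      rw [h, Polynomial.coeff_zero] at this
      exact hp this.symm
    · exact lineExpAlong_natDegree_le hf (hj.trans m.le_succ) _ _ _
    · intro x hx1 hx2
      rw [lineExp_eval] at hx1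
      rw [lineExpAlong_eval] at hx2
      set w : Fin 4 → k := (fun i =>
        (![-eval q l₀, 0, eval q (pderiv 0 f), algebraMap k k β * eval q (pderiv 0 f)] : Fin 4 → k) i +
          x * (![-eval q (pderiv 1 f), eval q (pderiv 0 f), 0, 0] : Fin 4 → k) i) with hwdef
      have hw0 : w 0 = -eval q l₀ - x * eval q (pderiv 1 f) := by
        simp only [hwdef]; simp; ring
      have hw1 : w 1 = x * eval q (pderiv 0 f) := by
        simp only [hwdef]; simp
      have hw2 : w 2 = eval q (pderiv 0 f) := by
        simp only [hwdef]; simp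
      have hw3 : w 3 = β * eval q (pderiv 0 f) := by
        simp only [hwdef]; simp
      refine hno ((eval q (pderiv 0 f))⁻¹ • w) ?_ ?_ ?_ ?_ ?_
      · simp [hw2, h0]
      · simp [hw3]
        field_simp
      · rw [dirDeriv_eval]
        simp only [Pi.smul_apply, smul_eq_mul, hw0, hw1, hw2, hw3, hev0]
        field_simp
        ring
      · rw [IsHomogeneous.eval_smul hG]
        exact mul_eq_zero_of_right _ hx1
      · have := lineExp_coeff_smul_right (f := f) q w (eval q (pderiv 0 f))⁻¹ j
        rw [hx2, mul_zero] at this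
        exact this

end Eliminant

section Flat

variable {k : Type*} [Field k] {f : MvPolynomial (Fin 4) k} {d m : ℕ}

/-- Every tangent line at a zero of `f` is annihilated by the order `j` term of `f`. -/
def IsFlat (f : MvPolynomial (Fin 4) k) (j : ℕ) : Prop :=
  ∀ q u : Fin 4 → k, eval q f = 0 → dirDeriv f q u = 0 → (lineExp f q u).coeff j = 0

lemma lineExp_zero_coeff (hf : f.IsHomogeneous d) {j : ℕ} (hj : j < d) (u : Fin 4 → k) :
    (lineExp f 0 u).coeff j = 0 := by
  have h1 := lineExp_coeff_isHomogeneous (σ := Fin 4) (u := X) (v := fun i => C (u i)) hf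
    (fun i => isHomogeneous_X k i) (fun i => isHomogeneous_C _ (u i)) hj.le
  have h2 := IsHomogeneous.eval_smul h1 0 0
  rw [smul_zero, zero_pow (by omega), zero_mul, eval_lineExp_coeff] at h2
  simp only [eval_X, eval_C] at h2
  exact h2

lemma exists_form_of_not_isFlat (hf : IsSmoothSurface f (m + 1)) {j : ℕ} (hj : j ≤ m)
    (h : ¬ IsFlat f j) : ∃ (h : MvPolynomial (Fin 4) k) (e : ℕ), h.IsHomogeneous e ∧ ¬ f ∣ h ∧
      ∀ q, eval q h ≠ 0 → ∃ u, dirDeriv f q u = 0 ∧ (lineExp f q u).coeff j ≠ 0 := by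
  classical
  simp only [IsFlat, not_forall] at h
  obtain ⟨q, u, hq, hu, huj⟩ := h
  have hq0 : q ≠ 0 := by
    rintro rfl
    exact huj (lineExp_zero_coeff hf.2.1 (by omega) u)
  obtain ⟨i, hi⟩ := hf.exists_pderiv hq0 hq
  set D : MvPolynomial (Fin 4) k := ∑ l, C (u l) * pderiv l f with hD
  set V : Fin 4 → MvPolynomial (Fin 4) k :=
    fun l => C (u l) * pderiv i f - if l = i then D else 0 with hV
  have hom : ∀ l, (C (u l) * pderiv i f).IsHomogeneous m := fun l => by
    have := (isHomogeneous_C (Fin 4) (u l)).mul (hf.2.1.pderiv (i := i))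
    rwa [zero_add] at this
  have homD : D.IsHomogeneous m := by
    refine IsHomogeneous.sum _ _ _ fun l _ => ?_
    have := (isHomogeneous_C (Fin 4) (u l)).mul (hf.2.1.pderiv (i := l))
    rwa [zero_add] at this
  have homV : ∀ l, (V l).IsHomogeneous m := fun l => by
    refine (hom l).sub ?_
    split_ifs
    exacts [homD, isHomogeneous_zero _ _ _]
  have hevD : ∀ r, eval r D = dirDeriv f r u := fun r => by
    simp only [hD, map_sum, map_mul, eval_C, dirDeriv]
    rfl
  have hevV : ∀ r l, eval r (V l) =
      u l * eval r (pderiv i f) - if l = i then dirDeriv f r u else 0 := fun r l => by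
    rw [hV]
    simp only [map_sub, map_mul, eval_C]
    split_ifs
    · rw [hevD]
    · simp
  refine ⟨(lineExp f X V).coeff j, _, lineExp_coeff_isHomogeneous hf.2.1
    (fun i => isHomogeneous_X k i) homV (by omega), ?_, ?_⟩
  · rintro ⟨g, hg⟩
    have h1 := congrArg (eval q) hg
    rw [map_mul, hq, zero_mul, eval_lineExp_coeff] at h1
    have h2 : (fun l => eval q (V l)) = fun l => eval q (pderiv i f) * u l := by
      funext l
      rw [hevV, hu]
      simp [mul_comm]
    rw [h2, lineExp_coeff_smul_right] at h1
    simp only [eval_X] at h1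
    exact mul_ne_zero (pow_ne_zero _ hi) huj h1
  · intro r hr
    rw [eval_lineExp_coeff] at hr
    refine ⟨fun l => eval r (V l), ?_, by simpa using hr⟩
    have h3 : dirDeriv f r (fun l => eval r (V l)) = ∑ l, eval r (V l) * eval r (pderiv l f) := rfl
    have h4 : dirDeriv f r u = ∑ l, u l * eval r (pderiv l f) := rfl
    rw [h3]
    simp only [hevV, sub_mul, ite_mul, zero_mul, Finset.sum_sub_distrib, Finset.sum_ite_eq',
      Finset.mem_univ, if_true]
    rw [h4, sub_eq_zero, Finset.sum_mul]
    exact Finset.sum_congr rfl fun l _ => by ring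

lemma dvd_axisForm_of_isFlat [IsAlgClosed k] (hp : Prime f) {j : ℕ} (h : IsFlat f j) :
    f ∣ axisForm f j := by
  refine dvd_of_eval_eq_zero hp fun q hq => ?_
  rw [eval_axisForm]
  exact h q _ hq (by rw [dirDeriv_eval]; simp; ring)

/-- The forms of an axis decomposition of `f` are the derivatives of `f` along the axis. -/
lemma axis_decomposition_pderiv {f₁ f₂ : MvPolynomial (Fin 4) k} (h : f = X 2 * f₁ + X 3 * f₂)
    {p : Fin 4 → k} (h2 : p 2 = 0) (h3 : p 3 = 0) :
    eval p (pderiv 0 f) = 0 ∧ eval p (pderiv 1 f) = 0 ∧ eval p (pderiv 2 f) = eval p f₁ ∧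
      eval p (pderiv 3 f) = eval p f₂ := by
  subst h
  simp only [map_add, Derivation.leibniz, pderiv_X, smul_eq_mul, map_mul, eval_X, h2, h3]
  refine ⟨?_, ?_, ?_, ?_⟩ <;> simp

lemma card_disjoint_axis_le [IsAlgClosed k] (hf : IsSmoothSurface f (m + 1)) (hm : 2 ≤ m)
    (hfin : {W | IsLineOn f W}.Finite)
    (hL : ∀ v : Fin 4 → k, v 2 = 0 → v 3 = 0 → eval v f = 0) (hw : pderiv 0 f ≠ 0) {j : ℕ}
    (hj : j ≤ m) (hflat : ∀ i, 2 ≤ i → i < j → IsFlat f i) (hnf : ¬ IsFlat f j)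
    (T : Finset (Submodule k (Fin 4 → k)))
    (hT : ∀ M ∈ T, IsLineOn f M ∧ ∀ v ∈ M, v 2 = 0 → v 3 = 0 → v = 0) :
    T.card ≤ m * (m * (m * j + m + 1 - j)) := by
  classical
  have hp : Prime f := hf.prime (by omega)
  obtain ⟨h, e, hh, hfh, hhu⟩ := exists_form_of_not_isFlat hf hj hnf
  obtain ⟨q, hq, hq2, hqW, hqh⟩ := hf.exists_general_point (by omega) hfin
    ((hf.2.1.pderiv (i := 0)).mul hh) (fun hdvd => (hp.dvd_or_dvd hdvd).elim
      (pderiv_not_dvd hf.2.1 0 hw) hfh)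
  rw [map_mul] at hqh
  have hqw := left_ne_zero_of_mul hqh
  obtain ⟨f₁, f₂, hf₁, hf₂, hff⟩ := axis_decomposition hf.2.1 hL
  have hef : ∀ v, eval v f = v 2 * eval v f₁ + v 3 * eval v f₂ := fun v => by
    conv_lhs => rw [hff]
    simp
  set p : Fin 4 → k := ![-eval q (pderiv 1 f), eval q (pderiv 0 f), 0, 0] with hpdef
  have hp2 : p 2 = 0 := rfl
  have hp3 : p 3 = 0 := rfl
  have hp0 : p ≠ 0 := fun h0 => hqw (congrFun h0 1)
  obtain ⟨hd0, hd1, hd2, hd3⟩ := axis_decomposition_pderiv hff hp2 hp3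
  have hbad : {β : k | eval p f₁ + β * eval p f₂ = 0}.Finite := by
    refine Set.Subsingleton.finite fun a ha b hb => ?_
    rw [Set.mem_ofPred_eq] at ha hb
    have hne : eval p f₂ ≠ 0 := by
      intro h0
      rw [h0, mul_zero, add_zero] at ha
      obtain ⟨i, hi⟩ := hf.exists_pderiv hp0 (hL p hp2 hp3)
      fin_cases i
      exacts [hi hd0, hi hd1, hi (hd2.trans ha), hi (hd3.trans h0)]
    exact mul_right_cancel₀ hne (add_left_cancel (ha.trans hb.symm))
  have hasy := finite_asymptotic_planes hf.2.1 (hj.trans m.le_succ) hq hq2 hqw hqW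
    (fun u hu i hi => by
      rcases i with _ | _ | i
      · rw [lineExp_coeff_zero]; exact hq
      · rw [zero_add, lineExp_coeff_one]; exact hu
      · exact hflat (i + 2) (by omega) hi q u hq hu)
    (hhu q (right_ne_zero_of_mul hqh))
  obtain ⟨β, hβ⟩ := ((hbad.union hasy).union (Set.finite_singleton (q 3))).infinite_compl.nonempty
  simp only [Set.mem_compl_iff, Set.mem_union, not_or, Set.mem_singleton_iff] at hβ
  obtain ⟨⟨hβ1, hβ2⟩, hβ3⟩ := hβ
  have hG : (f₁ + C β * f₂).IsHomogeneous m := by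
    refine hf₁.add ?_
    have := (isHomogeneous_C (Fin 4) β).mul hf₂
    rwa [zero_add] at this
  have heG : ∀ v, eval v (f₁ + C β * f₂) = eval v f₁ + β * eval v f₂ := fun v => by simp
  obtain ⟨E, hE, hE1, hE2⟩ := exists_tangent_eliminant hf.2.1 hG (by omega) hj hw β
  have hqE : eval q E ≠ 0 := by
    refine hE2 q hqw ?_ fun v hv2 hv3 hv hvG hvj => hβ2 ?_
    · rw [heG]; exact hβ1
    · refine ⟨hβ3, v, hv2, hv3, hv, ?_, hvj⟩
      rw [hef, hv2, hv3, one_mul, ← heG, hvG]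
  have hfE : ¬ f ∣ E := by
    rintro ⟨g, rfl⟩
    exact hqE (by rw [map_mul, hq, zero_mul])
  refine card_disjoint_lines_le hp hf.2.1 hE hfE (axis_support_le hf.2.1 hL) T fun M hM =>
    ⟨(hT M hM).1, ?_, (hT M hM).2⟩
  obtain ⟨hML, hMd⟩ := hT M hM
  obtain ⟨a, ha⟩ := exists_graph_of_disjoint_axis hML.1 hMd
  have hvM : ∀ t : k, (![a.1 + a.2.1 * t, a.2.2.1 + a.2.2.2 * t, 1, t] : Fin 4 → k) ∈ M :=
    fun t => (ha _).2 (by simp)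
  have key : ∀ r ∈ M, r 2 ≠ 0 → r 3 - β * r 2 ≠ 0 → eval r E = 0 := by
    intro r hr hr2 hr3
    set v : Fin 4 → k := ![a.1 + a.2.1 * β, a.2.2.1 + a.2.2.2 * β, 1, β] with hv
    have hv2 : v 2 = 1 := rfl
    have hv3 : v 3 = β := rfl
    have hl := lineExp_eq_zero_of_mem hML.2 hr (hvM β)
    have hdv : dirDeriv f r v = 0 := by
      rw [← lineExp_coeff_one, hl, Polynomial.coeff_zero]
    have hdr : dirDeriv f r r = 0 := dirDeriv_self hf.2.1 (hML.2 r hr)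
    refine hE1 r v ?_ hv2 hv3 hdv ?_ (by rw [hl, Polynomial.coeff_zero])
    · by_contra! hno
      rw [dirDeriv_eval, hno.1, hno.2, hv2, hv3] at hdv
      rw [dirDeriv_eval, hno.1, hno.2] at hdr
      have h3 : eval r (pderiv 3 f) = 0 := by
        refine (mul_eq_zero.1 ?_).resolve_left hr3
        linear_combination hdr - r 2 * hdv
      have h2 : eval r (pderiv 2 f) = 0 := by linear_combination hdv - β * h3
      obtain ⟨i, hi⟩ := hf.exists_pderiv (v := r) (fun h0 => hr2 (congrFun h0 2)) (hML.2 r hr)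
      fin_cases i
      exacts [hi hno.2, hi hno.1, hi h2, hi h3]
    · rw [heG, ← hML.2 v (hvM β), hef, hv2, hv3, one_mul]
  intro v hv
  have h0 : lineExp E v ![a.1 + a.2.1 * (β + 1), a.2.2.1 + a.2.2.2 * (β + 1), 1, β + 1] = 0 := by
    refine polynomial_eq_zero_of_eval
      (Q := (Polynomial.X + Polynomial.C (v 2)) * (Polynomial.X + Polynomial.C (v 3 - β * v 2)))
      (mul_ne_zero (Polynomial.X_add_C_ne_zero _) (Polynomial.X_add_C_ne_zero _)) fun t ht => ?_
    rw [Polynomial.eval_mul] at ht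
    rw [lineExp_eval_field]
    refine key _ (M.add_mem hv (M.smul_mem t (hvM _))) ?_ ?_
    · refine fun h0 => left_ne_zero_of_mul ht ?_
      simp at h0 ⊢
      linear_combination h0
    · refine fun h0 => right_ne_zero_of_mul ht ?_
      simp at h0 ⊢
      linear_combination h0
  have h1 := lineExp_coeff_zero E v ![a.1 + a.2.1 * (β + 1), a.2.2.1 + a.2.2.2 * (β + 1), 1, β + 1]
  rw [h0, Polynomial.coeff_zero] at h1
  exact h1.symm

end Flat

section AxisCount

variable {k : Type*} [Field k] {f : MvPolynomial (Fin 4) k} {d m : ℕ}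

variable (k) in
/-- The line `x = y = 0`. -/
def axis : Submodule k (Fin 4 → k) where
  carrier := {v | v 2 = 0 ∧ v 3 = 0}
  add_mem' := by rintro a b ⟨h1, h2⟩ ⟨h3, h4⟩; simp [h1, h2, h3, h4]
  zero_mem' := by simp
  smul_mem' := by rintro c a ⟨h1, h2⟩; simp [h1, h2]

lemma mem_axis {v : Fin 4 → k} : v ∈ axis k ↔ v 2 = 0 ∧ v 3 = 0 := Iff.rfl

lemma card_lines_le_of_not_isFlat [IsAlgClosed k] (hf : IsSmoothSurface f (m + 1)) (hm : 2 ≤ m)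
    (hfin : {W | IsLineOn f W}.Finite)
    (hL : ∀ v : Fin 4 → k, v 2 = 0 → v 3 = 0 → eval v f = 0) (hw : pderiv 0 f ≠ 0) {j₀ : ℕ}
    (h2 : 2 ≤ j₀) (hj₀ : j₀ ≤ m) (hnf : ¬ IsFlat f j₀) :
    ∃ j, 2 ≤ j ∧ j ≤ j₀ ∧ {W | IsLineOn f W}.ncard ≤ m * (m * (m * j + m + 1 - j)) + 1 +
      {W | IsLineOn f W ∧ W ≠ axis k ∧ ∃ c ∈ W, c ≠ 0 ∧ c 2 = 0 ∧ c 3 = 0}.ncard := by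
  classical
  have hex : ∃ j, 2 ≤ j ∧ ¬ IsFlat f j := ⟨j₀, h2, hnf⟩
  have hjle : Nat.find hex ≤ j₀ := Nat.find_min' hex ⟨h2, hnf⟩
  refine ⟨Nat.find hex, (Nat.find_spec hex).1, hjle, ?_⟩
  have hfinD : {W | IsLineOn f W ∧ ∀ v ∈ W, v 2 = 0 → v 3 = 0 → v = 0}.Finite :=
    hfin.subset fun W hW => hW.1
  have hD := card_disjoint_axis_le hf hm hfin hL hw (hjle.trans hj₀)
    (fun i hi hij => not_not.1 fun h => Nat.find_min hex hij ⟨hi, h⟩) (Nat.find_spec hex).2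
    hfinD.toFinset (fun M hM => by simpa using hM)
  rw [← Set.ncard_eq_toFinset_card _ hfinD] at hD
  refine (Set.ncard_le_ncard (t := ({W | IsLineOn f W ∧ ∀ v ∈ W, v 2 = 0 → v 3 = 0 → v = 0} ∪
    {axis k}) ∪ {W | IsLineOn f W ∧ W ≠ axis k ∧ ∃ c ∈ W, c ≠ 0 ∧ c 2 = 0 ∧ c 3 = 0}) ?_
    ((hfinD.union (Set.finite_singleton _)).union (hfin.subset fun W hW => hW.1))).trans ?_
  · intro W hW
    by_cases h1 : W = axis k
    · exact Or.inl (Or.inr h1)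
    · by_cases h3 : ∀ v ∈ W, v 2 = 0 → v 3 = 0 → v = 0
      · exact Or.inl (Or.inl ⟨hW, h3⟩)
      · push Not at h3
        obtain ⟨c, hc, hc2, hc3, hc0⟩ := h3
        exact Or.inr ⟨hW, h1, c, hc, hc0, hc2, hc3⟩
  · refine (Set.ncard_union_le _ _).trans (Nat.add_le_add_right ?_ _)
    refine (Set.ncard_union_le _ _).trans ?_
    rw [Set.ncard_singleton]
    exact Nat.add_le_add_right hD 1

lemma exists_meeting_line [IsAlgClosed k] (hf : IsSmoothSurface f (m + 1)) (hm : 2 ≤ m)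
    (hcount : {W | IsLineOn f W}.ncard = (m + 1) * (m ^ 3 + 1))
    (hL : ∀ v : Fin 4 → k, v 2 = 0 → v 3 = 0 → eval v f = 0) (hw : pderiv 0 f ≠ 0) :
    ∃ M, IsLineOn f M ∧ M ≠ axis k ∧ ∃ c ∈ M, c ≠ 0 ∧ c 2 = 0 ∧ c 3 = 0 := by
  have hfin : {W | IsLineOn f W}.Finite := Set.finite_of_ncard_pos (by rw [hcount]; positivity)
  obtain ⟨j₀, h2, hj₀, hdvd⟩ := exists_axisForm_not_dvd hf hm hfin hL hw
  obtain ⟨j, hj2, hj, hle⟩ := card_lines_le_of_not_isFlat hf hm hfin hL hw h2 hj₀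
    fun h => hdvd (dvd_axisForm_of_isFlat (hf.prime (by omega)) h)
  by_contra hno
  have hempty : {W | IsLineOn f W ∧ W ≠ axis k ∧ ∃ c ∈ W, c ≠ 0 ∧ c 2 = 0 ∧ c 3 = 0} = ∅ :=
    Set.eq_empty_of_forall_notMem fun W hW => hno ⟨W, hW⟩
  rw [hempty, Set.ncard_empty, hcount, add_zero] at hle
  obtain ⟨i, rfl⟩ := Nat.exists_eq_add_of_le (hj.trans hj₀)
  have h1 : (j + i) * j + (j + i) + 1 - j = (j + i) * j + i + 1 := by omega
  have h3 : (j + i) * j + i + 1 ≤ (j + i) * (j + i) + 1 := by nlinarith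
  rw [h1] at hle
  set n := j + i
  have h4 : n * (n * (n * j + i + 1)) ≤ n * (n * (n * n + 1)) :=
    Nat.mul_le_mul_left _ (Nat.mul_le_mul_left _ h3)
  nlinarith [mul_pos (show 0 < n by omega) (show 0 < n by omega)]

lemma dvd_axisForm_of_lt [IsAlgClosed k] (hf : IsSmoothSurface f (m + 1)) (hm : 3 ≤ m)
    (hcount : {W | IsLineOn f W}.ncard = (m + 1) * (m ^ 3 + 1))
    (hL : ∀ v : Fin 4 → k, v 2 = 0 → v 3 = 0 → eval v f = 0) (hw : pderiv 0 f ≠ 0) {j₀ : ℕ}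
    (h2 : 2 ≤ j₀) (hj₀ : j₀ < m) : f ∣ axisForm f j₀ := by
  classical
  have hfin : {W | IsLineOn f W}.Finite := Set.finite_of_ncard_pos (by rw [hcount]; positivity)
  by_contra hdvd
  obtain ⟨j, hj2, hj, hle⟩ := card_lines_le_of_not_isFlat hf (by omega) hfin hL hw h2 hj₀.le
    fun h => hdvd (dvd_axisForm_of_isFlat (hf.prime (by omega)) h)
  have hfinE : {W | IsLineOn f W ∧ W ≠ axis k ∧ ∃ c ∈ W, c ≠ 0 ∧ c 2 = 0 ∧ c 3 = 0}.Finite :=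
    hfin.subset fun W hW => hW.1
  have hE := card_lines_le (by omega) hf (axisForm_isHomogeneous hf.2.1 (show j₀ ≤ m + 1 by omega))
    hdvd hfinE.toFinset (fun M hM => by
      simp only [Set.Finite.mem_toFinset, Set.mem_ofPred_eq] at hM
      obtain ⟨hM, -, c, hc, hc0, hc2, hc3⟩ := hM
      refine ⟨hM, fun v hv => ?_⟩
      obtain ⟨j', rfl⟩ := Nat.exists_eq_add_of_le' (show 1 ≤ j₀ by omega)
      exact axisForm_eval_eq_zero hM hc hc0 hc2 hc3 hv)
  rw [← Set.ncard_eq_toFinset_card _ hfinE] at hE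
  rw [hcount] at hle
  have h1 : m + 1 - j₀ + j₀ * m ≤ m * m - m + 2 := by
    obtain ⟨i, rfl⟩ := Nat.exists_eq_add_of_lt hj₀
    have h3 : j₀ + i + 1 + 1 - j₀ = i + 2 := by omega
    rw [h3]
    apply le_trans _ (Nat.add_le_add_right (Nat.le_sub_of_add_le
      (show i + j₀ * (j₀ + i + 1) + (j₀ + i + 1) ≤ _ by nlinarith)) 2)
    omega
  have h3 : m * j + m + 1 - j ≤ m * m - m + 2 := by
    obtain ⟨i, rfl⟩ := Nat.exists_eq_add_of_lt (hj.trans_lt hj₀)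
    have h3 : (j + i + 1) * j + (j + i + 1) + 1 - j = (j + i + 1) * j + i + 2 := by omega
    rw [h3]
    apply le_trans _ (Nat.add_le_add_right (Nat.le_sub_of_add_le
      (show (j + i + 1) * j + i + (j + i + 1) ≤ _ by nlinarith)) 2)
    omega
  obtain ⟨B, hB⟩ : ∃ B, B = m * m - m + 2 := ⟨_, rfl⟩
  have hB' : B + m = m * m + 2 := by
    have : m ≤ m * m := Nat.le_mul_self m
    omega
  rw [← hB] at h1 h3
  have h4 : m * (m * (m * j + m + 1 - j)) ≤ m * (m * B) :=
    Nat.mul_le_mul_left _ (Nat.mul_le_mul_left _ h3)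
  have h5 : (m + 1) * (m + 1 - j₀ + j₀ * m) ≤ (m + 1) * B := Nat.mul_le_mul_left _ h1
  have h6 : (m + 1) * (m ^ 3 + 1) ≤ m * (m * B) + 1 + (m + 1) * B := by omega
  zify at h6 hB' hm
  have hB2 : (B : ℤ) = m * m + 2 - m := by linarith
  rw [hB2] at h6
  nlinarith [mul_nonneg (show (0 : ℤ) ≤ m by linarith) (show (0 : ℤ) ≤ m by linarith),
    mul_nonneg (mul_nonneg (show (0 : ℤ) ≤ m by linarith) (show (0 : ℤ) ≤ m by linarith))
      (show (0 : ℤ) ≤ m - 3 by linarith)]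

end AxisCount

section PlaneSections

variable {k : Type*} [Field k] {f : MvPolynomial (Fin 4) k} {d m : ℕ}

/-- The restriction of `f` to `H` is a product of `d` linear forms, up to a constant. -/
def SplitsOn (f : MvPolynomial (Fin 4) k) (H : Submodule k (Fin 4 → k)) (d : ℕ) : Prop :=
  ∃ (c : k) (ℓ : Fin d → Module.Dual k (Fin 4 → k)), ∀ v ∈ H, eval v f = c * ∏ i, ℓ i v

lemma exists_zero_of_isHomogeneous [IsAlgClosed k] {g : MvPolynomial (Fin 4) k} {n : ℕ}
    (hg : g.IsHomogeneous n) (hn : n ≠ 0) {M : Submodule k (Fin 4 → k)}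
    (hM : 2 ≤ Module.finrank k M) : ∃ v ∈ M, v ≠ 0 ∧ eval v g = 0 := by
  obtain ⟨b, hb⟩ := exists_linearIndependent_of_le_finrank (R := k) (M := M) hM
  have hb' : LinearIndependent k (fun i => (b i : Fin 4 → k)) :=
    hb.map' M.subtype (Submodule.ker_subtype M)
  by_cases h1 : eval (b 1 : Fin 4 → k) g = 0
  · exact ⟨b 1, (b 1).2, hb'.ne_zero 1, h1⟩
  · have h2 : (lineExp g (b 0 : Fin 4 → k) (b 1 : Fin 4 → k)).coeff n ≠ 0 := by
      rw [lineExp_coeff_top hg]; exact h1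
    obtain ⟨s, hs⟩ := IsAlgClosed.exists_root (lineExp g (b 0 : Fin 4 → k) (b 1 : Fin 4 → k))
      (fun h0 => h2 (Polynomial.coeff_eq_zero_of_degree_lt (by
        rw [h0]; exact_mod_cast Nat.pos_of_ne_zero hn)))
    rw [Polynomial.IsRoot, lineExp_eval_field] at hs
    refine ⟨_, M.add_mem (b 0).2 (M.smul_mem s (b 1).2), fun h0 => ?_, hs⟩
    have h3 := Fintype.linearIndependent_iff.1 hb' ![1, s] (by simpa [Fin.sum_univ_two] using h0) 0
    simp at h3

lemma dirDeriv_add_smul (f : MvPolynomial (Fin 4) k) (v u w : Fin 4 → k) (c : k) :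
    dirDeriv f v (u + c • w) = dirDeriv f v u + c * dirDeriv f v w := by
  simp only [dirDeriv_eval, Pi.add_apply, Pi.smul_apply, smul_eq_mul]
  ring

lemma dirDeriv_single (f : MvPolynomial (Fin 4) k) (v : Fin 4 → k) (i : Fin 4) :
    dirDeriv f v (Pi.single i 1) = eval v (pderiv i f) := by
  rw [dirDeriv, Finset.sum_eq_single i]
  · simp
  · intro j _ hj
    rw [Pi.single_eq_of_ne hj, zero_mul]
  · simp

lemma dirDeriv_isHomogeneous (hf : f.IsHomogeneous d) (u : Fin 4 → k) :
    ∃ g : MvPolynomial (Fin 4) k, g.IsHomogeneous (d - 1) ∧ ∀ v, eval v g = dirDeriv f v u := by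
  refine ⟨∑ l, C (u l) * pderiv l f, IsHomogeneous.sum _ _ _ fun l _ => ?_, fun v => ?_⟩
  · have := (isHomogeneous_C (Fin 4) (u l)).mul (hf.pderiv (i := l))
    rwa [zero_add] at this
  · simp only [map_sum, map_mul, eval_C, dirDeriv]
    rfl

lemma exists_eq_add_smul_of_finrank_eq_three {H : Submodule k (Fin 4 → k)}
    (hH : Module.finrank k H = 3) {u₀ : Fin 4 → k} (hu₀ : u₀ ∉ H) (v : Fin 4 → k) :
    ∃ u ∈ H, ∃ c : k, v = u + c • u₀ := by
  have htop : H ⊔ Submodule.span k {u₀} = ⊤ := by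
    refine Submodule.eq_top_of_finrank_eq (le_antisymm (Submodule.finrank_le _) ?_)
    have hlt : H < H ⊔ Submodule.span k {u₀} := by
      refine lt_of_le_of_ne le_sup_left fun h => hu₀ ?_
      rw [h]
      exact Submodule.mem_sup_right (Submodule.mem_span_singleton_self u₀)
    have := Submodule.finrank_lt_finrank_of_lt hlt
    rw [Module.finrank_fin_fun]
    omega
  have hv : v ∈ H ⊔ Submodule.span k {u₀} := htop ▸ Submodule.mem_top
  obtain ⟨u, hu, w, hw, rfl⟩ := Submodule.mem_sup.1 hv
  obtain ⟨c, rfl⟩ := Submodule.mem_span_singleton.1 hw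
  exact ⟨u, hu, c, rfl⟩

/-- A smooth surface is not tangent to a plane along a line. -/
lemma IsSmoothSurface.finrank_le_one_of_tangent [IsAlgClosed k] (hf : IsSmoothSurface f d)
    (hd : 2 ≤ d) {H M : Submodule k (Fin 4 → k)} (hH : Module.finrank k H = 3)
    (hM : ∀ v ∈ M, eval v f = 0 ∧ ∀ u ∈ H, dirDeriv f v u = 0) : Module.finrank k M ≤ 1 := by
  by_contra! hM2
  have hne : H ≠ ⊤ := by
    rintro rfl
    rw [finrank_top, Module.finrank_fin_fun] at hH
    omega
  obtain ⟨u₀, -, hu₀⟩ := SetLike.exists_of_lt hne.lt_top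
  obtain ⟨g, hg, hgv⟩ := dirDeriv_isHomogeneous hf.2.1 u₀
  obtain ⟨v, hv, hv0, hvg⟩ := exists_zero_of_isHomogeneous hg (by omega) hM2
  rw [hgv] at hvg
  obtain ⟨i, hi⟩ := hf.exists_pderiv hv0 (hM v hv).1
  obtain ⟨u, hu, c, hc⟩ := exists_eq_add_smul_of_finrank_eq_three hH hu₀ (Pi.single i 1)
  rw [← dirDeriv_single, hc, dirDeriv_add_smul, (hM v hv).2 u hu, hvg] at hi
  simp at hi

lemma lineExp_eq_prod [Infinite k] {H : Submodule k (Fin 4 → k)} {c : k}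
    {ℓ : Fin d → Module.Dual k (Fin 4 → k)} (h : ∀ v ∈ H, eval v f = c * ∏ i, ℓ i v)
    {u v : Fin 4 → k} (hu : u ∈ H) (hv : v ∈ H) : lineExp f u v =
      Polynomial.C c * ∏ i, (Polynomial.C (ℓ i u) + Polynomial.X * Polynomial.C (ℓ i v)) := by
  refine Polynomial.funext fun s => ?_
  rw [lineExp_eval_field, h _ (H.add_mem hu (H.smul_mem s hv)), Polynomial.eval_mul,
    Polynomial.eval_C, Polynomial.eval_prod]
  congr 1
  refine Finset.prod_congr rfl fun i _ => ?_
  rw [map_add, map_smul, smul_eq_mul, Polynomial.eval_add, Polynomial.eval_mul, Polynomial.eval_C,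
    Polynomial.eval_X, Polynomial.eval_C]

lemma finrank_inf_ker {H : Submodule k (Fin 4 → k)} (hH : Module.finrank k H = 3)
    (ℓ : Module.Dual k (Fin 4 → k)) : 2 ≤ Module.finrank k (H ⊓ LinearMap.ker ℓ : Submodule k _) := by
  have h1 := Submodule.finrank_sup_add_finrank_inf_eq H (LinearMap.ker ℓ)
  have h2 := LinearMap.finrank_range_add_finrank_ker ℓ
  have h3 := Submodule.finrank_le (LinearMap.range ℓ)
  have h4 := Submodule.finrank_le (H ⊔ LinearMap.ker ℓ)
  rw [Module.finrank_fin_fun] at h2 h4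
  rw [Module.finrank_self] at h3
  omega

/-- A plane section of a smooth surface that is a product of linear forms consists of `d` distinct
lines. -/
lemma IsSmoothSurface.lines_of_splitsOn [IsAlgClosed k] (hf : IsSmoothSurface f d) (hd : 2 ≤ d)
    {H : Submodule k (Fin 4 → k)} (hH : Module.finrank k H = 3) (h : SplitsOn f H d) :
    {M | IsLineOn f M ∧ M ≤ H}.ncard = d ∧
      ∀ v ∈ H, eval v f = 0 → ∃ M, IsLineOn f M ∧ M ≤ H ∧ v ∈ M := by
  classical
  obtain ⟨c, ℓ, h⟩ := h
  have hc : c ≠ 0 := by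
    rintro rfl
    have := hf.finrank_le_one_of_tangent hd hH (M := H) fun v hv =>
      ⟨by rw [h v hv, zero_mul], fun u hu => by
        rw [← lineExp_coeff_one, lineExp_eq_prod h hv hu]; simp⟩
    omega
  set N : Fin d → Submodule k (Fin 4 → k) := fun i => H ⊓ LinearMap.ker (ℓ i) with hN
  have hN0 : ∀ i, ∀ v ∈ N i, eval v f = 0 := fun i v hv => by
    have hv2 : ℓ i v = 0 := hv.2
    rw [h v hv.1, Finset.prod_eq_zero (Finset.mem_univ i) hv2, mul_zero]
  have hab : ∀ a b, a ≠ b → Module.finrank k (N a ⊓ N b : Submodule k _) ≤ 1 := by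
    intro a b hab
    refine hf.finrank_le_one_of_tangent hd hH fun v hv => ⟨hN0 a v hv.1, fun u hu => ?_⟩
    rw [← lineExp_coeff_one, lineExp_eq_prod h hv.1.1 hu,
      ← Finset.mul_prod_erase _ _ (Finset.mem_univ a),
      ← Finset.mul_prod_erase _ _ (Finset.mem_erase.2 ⟨hab.symm, Finset.mem_univ b⟩)]
    have ha : ℓ a v = 0 := hv.1.2
    have hb : ℓ b v = 0 := hv.2.2
    rw [ha, hb, Polynomial.C_0, zero_add, zero_add]
    have : ∀ (p q : Polynomial k) (x y : k), (p * (Polynomial.X * Polynomial.C x *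
        (Polynomial.X * Polynomial.C y * q))).coeff 1 = 0 := fun p q x y => by
      rw [show p * (Polynomial.X * Polynomial.C x * (Polynomial.X * Polynomial.C y * q)) =
        Polynomial.X ^ 2 * (p * Polynomial.C x * Polynomial.C y * q) by ring,
        Polynomial.coeff_X_pow_mul', if_neg (by norm_num)]
    exact this _ _ _ _
  have hN2 : ∀ a, Module.finrank k (N a) = 2 := by
    intro a
    have h1 := finrank_inf_ker hH (ℓ a)
    refine le_antisymm ?_ h1
    by_contra! h2
    have h3 : N a = H := Submodule.eq_of_le_of_finrank_le inf_le_left (by omega)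
    have : Nontrivial (Fin d) := Fin.nontrivial_iff_two_le.2 hd
    obtain ⟨b, hb⟩ := exists_ne a
    have h4 := hab a b hb.symm
    have h5 := finrank_inf_ker hH (ℓ b)
    have h6 : N a ⊓ N b = N b := by rw [h3]; exact inf_eq_right.2 inf_le_left
    rw [h6] at h4
    change 2 ≤ Module.finrank k (N b) at h5
    omega
  have hinj : Function.Injective N := by
    intro a b hN'
    by_contra hne
    have h4 := hab a b hne
    rw [hN', inf_idem, hN2] at h4
    omega
  have hline : ∀ i, IsLineOn f (N i) := fun i => ⟨hN2 i, hN0 i⟩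
  have hset : {M | IsLineOn f M ∧ M ≤ H} = Set.range N := by
    ext M
    constructor
    · rintro ⟨hM, hMH⟩
      obtain ⟨b, hb⟩ := exists_linearIndependent_of_le_finrank (R := k) (M := M) hM.1.ge
      have h1 := lineExp_eq_prod h (hMH (b 0).2) (hMH (b 1).2)
      rw [lineExp_eq_zero_of_mem hM.2 (b 0).2 (b 1).2] at h1
      have h2 := (mul_eq_zero.1 h1.symm).resolve_left (Polynomial.C_ne_zero.2 hc)
      obtain ⟨i, -, hi⟩ := Finset.prod_eq_zero_iff.1 h2
      have e0 : ℓ i (b 0 : Fin 4 → k) = 0 := by simpa using congrArg (Polynomial.coeff · 0) hi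
      have e1 : ℓ i (b 1 : Fin 4 → k) = 0 := by simpa using congrArg (Polynomial.coeff · 1) hi
      have hle : M ≤ N i := by
        intro v hv
        refine ⟨hMH hv, ?_⟩
        have hspan : Submodule.span k (Set.range b) = ⊤ :=
          hb.span_eq_top_of_card_eq_finrank (by simp [hM.1])
        have hz : ∀ w : M, ℓ i (w : Fin 4 → k) = 0 := by
          intro w
          have hw : w ∈ Submodule.span k (Set.range b) := hspan ▸ Submodule.mem_top
          have hle : Submodule.span k (Set.range b) ≤ LinearMap.ker (ℓ i ∘ₗ M.subtype) := by
            rw [Submodule.span_le]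
            rintro _ ⟨j, rfl⟩
            fin_cases j
            exacts [e0, e1]
          exact hle hw
        exact hz ⟨v, hv⟩
      exact ⟨i, (Submodule.eq_of_le_of_finrank_le hle (by rw [hN2, hM.1])).symm⟩
    · rintro ⟨i, rfl⟩
      exact ⟨hline i, inf_le_left⟩
  refine ⟨?_, fun v hv hv0 => ?_⟩
  · rw [hset, ← Set.image_univ, Set.ncard_image_of_injective _ hinj, Set.ncard_univ,
      Nat.card_eq_fintype_card, Fintype.card_fin]
  · rw [h v hv] at hv0
    obtain ⟨i, -, hi⟩ := Finset.prod_eq_zero_iff.1 ((mul_eq_zero.1 hv0).resolve_left hc)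
    exact ⟨N i, hline i, inf_le_left, hv, hi⟩

end PlaneSections

section Fibres

variable {k : Type*} [Field k] {f : MvPolynomial (Fin 4) k} {d m : ℕ}

lemma taylor_lineExp [Infinite k] (f : MvPolynomial (Fin 4) k) (u v : Fin 4 → k) (s : k) :
    Polynomial.taylor s (lineExp f u v) = lineExp f (u + s • v) v := by
  refine Polynomial.funext fun t => ?_
  rw [Polynomial.taylor_eval, lineExp_eval_field, lineExp_eval_field, add_assoc, ← add_smul,
    add_comm t s]

lemma eval_derivative_lineExp [Infinite k] (f : MvPolynomial (Fin 4) k) (u v : Fin 4 → k) (s : k) :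
    (lineExp f u v).derivative.eval s = dirDeriv f (u + s • v) v := by
  rw [← lineExp_coeff_one, ← taylor_lineExp, Polynomial.taylor_coeff_one]

lemma Polynomial.exists_C_eq_add_of_prime {R : Type*} [CommRing R] [IsDomain R] {F B : Polynomial R}
    (hF : Prime F) (hB : ¬ F ∣ B) :
    ∃ r : R, r ≠ 0 ∧ ∃ g h, Polynomial.C r = F * g + B * h := by
  have : IsDomain (AdjoinRoot F) := AdjoinRoot.isDomain_of_prime hF
  have hB' : AdjoinRoot.mk F B ≠ 0 := fun h => hB (AdjoinRoot.mk_eq_zero.1 h)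
  have halg : IsAlgebraic R (AdjoinRoot.mk F B) := by
    refine (Algebra.isAlgebraic_adjoin_singleton_iff.2 (AdjoinRoot.isAlgebraic_root hF.ne_zero))
      _ ?_
    rw [AdjoinRoot.adjoinRoot_eq_top]
    trivial
  obtain ⟨r, hr, c, hc⟩ := halg.exists_nonzero_dvd (mem_nonZeroDivisors_of_ne_zero hB')
  obtain ⟨h, rfl⟩ := AdjoinRoot.mk_surjective c
  have h1 : AdjoinRoot.mk F (Polynomial.C r - B * h) = 0 := by
    rw [map_sub, map_mul, ← hc, sub_eq_zero]
    rfl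
  obtain ⟨g, hg⟩ := AdjoinRoot.mk_eq_zero.1 h1
  exact ⟨r, hr, g, h, by rw [← hg]; ring⟩

lemma eval_homogeneousComponent_eq_zero [Infinite k] {σ : Type*} {r : MvPolynomial σ k} {v : σ → k}
    (h : ∀ t : k, eval (t • v) r = 0) (n : ℕ) : eval v (homogeneousComponent n r) = 0 := by
  have h1 : ∑ i ∈ Finset.range (r.totalDegree + 1),
      Polynomial.monomial i (eval v (homogeneousComponent i r)) = 0 := by
    refine Polynomial.funext fun t => ?_
    rw [Polynomial.eval_finsetSum, Polynomial.eval_zero, ← h t]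
    conv_rhs => rw [← sum_homogeneousComponent r, map_sum]
    refine Finset.sum_congr rfl fun i _ => ?_
    rw [Polynomial.eval_monomial, IsHomogeneous.eval_smul (homogeneousComponent_isHomogeneous i r),
      mul_comm]
  by_cases hn : n ∈ Finset.range (r.totalDegree + 1)
  · have h2 := congrArg (Polynomial.coeff · n) h1
    simp only [Polynomial.finsetSum_coeff, Polynomial.coeff_monomial, Finset.sum_ite_eq',
      Polynomial.coeff_zero] at h2
    rwa [if_pos hn] at h2
  · rw [homogeneousComponent_eq_zero _ _ (by simpa using hn), map_zero]

/-- Two forms without a common factor have a common zero over few points only, for the projection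
from `(1, 0, 0, 0)`. -/
lemma exists_form_of_common_zero [IsAlgClosed k] (hp : Prime f) {e : ℕ} (hf : f.IsHomogeneous d)
    {b : MvPolynomial (Fin 4) k} (hb : b.IsHomogeneous e) (hfb : ¬ f ∣ b) :
    ∃ (n : ℕ) (r : MvPolynomial (Fin 3) k), r.IsHomogeneous n ∧ r ≠ 0 ∧
      ∀ v : Fin 4 → k, eval v f = 0 → eval v b = 0 → eval (fun i => v (Fin.succ i)) r = 0 := by
  obtain ⟨r, hr, g, h, hgh⟩ := Polynomial.exists_C_eq_add_of_prime
    ((MulEquiv.prime_iff (finSuccEquiv k 3)).2 hp)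
    (B := finSuccEquiv k 3 b) (fun hd => hfb ((map_dvd_iff (finSuccEquiv k 3)).1 hd))
  obtain ⟨g, rfl⟩ := (finSuccEquiv k 3).surjective g
  obtain ⟨h, rfl⟩ := (finSuccEquiv k 3).surjective h
  have hr0 : ∀ v : Fin 4 → k, eval v f = 0 → eval v b = 0 →
      eval (fun i => v (Fin.succ i)) r = 0 := by
    intro v hvf hvb
    have h1 := congrArg (fun p => Polynomial.eval (v 0)
      (Polynomial.map (eval (fun i => v (Fin.succ i))) p)) hgh
    simp only [← map_mul, ← map_add] at h1
    have hv : v = Fin.cons (v 0) (fun i => v (Fin.succ i)) := (Fin.cons_self_tail v).symm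
    rw [← eval_eq_eval_mv_eval', ← hv, map_add, map_mul, map_mul, hvf, hvb, zero_mul, zero_mul,
      add_zero, Polynomial.map_C, Polynomial.eval_C] at h1
    exact h1
  obtain ⟨n, hn⟩ : ∃ n, homogeneousComponent n r ≠ 0 := by
    by_contra! hno
    exact hr (by rw [← sum_homogeneousComponent r, Finset.sum_eq_zero fun i _ => hno i])
  refine ⟨n, _, homogeneousComponent_isHomogeneous n r, hn, fun v hvf hvb =>
    eval_homogeneousComponent_eq_zero (fun t => ?_) n⟩
  exact hr0 (t • v) (by rw [IsHomogeneous.eval_smul hf, hvf, mul_zero])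
    (by rw [IsHomogeneous.eval_smul hb, hvb, mul_zero])

lemma finite_eval_line_eq_zero {σ : Type*} (g : MvPolynomial σ k) (a b : σ → k) {t₀ : k}
    (h : eval (a + t₀ • b) g ≠ 0) : {t : k | eval (a + t • b) g = 0}.Finite := by
  refine (Polynomial.finite_setOfPred_isRoot (p := lineExp g a b) ?_).subset fun t ht => ?_
  · intro h0
    exact h (by rw [← lineExp_eval_field, h0, Polynomial.eval_zero])
  · rw [Set.mem_ofPred_eq, Polynomial.IsRoot, lineExp_eval_field]
    exact ht

lemma exists_eval_ne_zero_of_ne_zero [Infinite k] {σ : Type*} {g : MvPolynomial σ k} (hg : g ≠ 0) :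
    ∃ v, eval v g ≠ 0 := by
  by_contra! h
  exact hg (MvPolynomial.funext fun v => by rw [h v, map_zero])

/-- The fibre of `V(f) \ V(b)` over a general point of a general plane through the axis consists of
`m` points. -/
lemma exists_card_fibre [IsAlgClosed k] (hf : IsSmoothSurface f (m + 1))
    (hL : ∀ v : Fin 4 → k, v 2 = 0 → v 3 = 0 → eval v f = 0)
    {b : MvPolynomial (Fin 4) k} {e : ℕ} (hb : b.IsHomogeneous e)
    (hfb : ¬ f ∣ b) (hwb : ∀ v, eval v f = 0 → eval v (pderiv 0 f) = 0 → eval v b = 0) :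
    ∃ Y : Set k, Y.Finite ∧ ∀ y ∉ Y, ∃ Z : Set k, Z.Finite ∧ ∀ z ∉ Z,
      ∃ W : Finset k, W.card = m ∧ ∀ w ∈ W, eval ![w, z, 1, y] f = 0 ∧ eval ![w, z, 1, y] b ≠ 0 := by
  classical
  obtain ⟨n, r, hr, hr0, hrv⟩ := exists_form_of_common_zero (hf.prime (by omega)) hf.2.1 hb hfb
  obtain ⟨v₀, hv₀⟩ := exists_eval_ne_zero_of_ne_zero (mul_ne_zero hr0 (X_ne_zero (1 : Fin 3)))
  rw [map_mul, eval_X] at hv₀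
  have hx := right_ne_zero_of_mul hv₀
  have hv₁ : eval ((v₀ 1)⁻¹ • v₀) r ≠ 0 := by
    rw [IsHomogeneous.eval_smul hr]
    exact mul_ne_zero (pow_ne_zero _ (inv_ne_zero hx)) (left_ne_zero_of_mul hv₀)
  set z₀ := (v₀ 1)⁻¹ * v₀ 0
  set y₀ := (v₀ 1)⁻¹ * v₀ 2
  have e1 : ∀ z y : k, (![z, 1, y] : Fin 3 → k) = ![z, 1, 0] + y • ![0, 0, 1] := fun z y => by
    funext i; fin_cases i <;> simp
  have e2 : ∀ z y : k, (![z, 1, y] : Fin 3 → k) = ![0, 1, y] + z • ![1, 0, 0] := fun z y => by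
    funext i; fin_cases i <;> simp
  have e3 : (v₀ 1)⁻¹ • v₀ = ![z₀, 1, y₀] := by
    funext i; fin_cases i
    · rfl
    · simp [hx]
    · rfl
  rw [e3] at hv₁
  obtain ⟨f₁, f₂, hf₁, hf₂, hff⟩ := axis_decomposition hf.2.1 hL
  set E : Fin 4 → k := ![1, 0, 0, 0] with hE
  have hE0 : E ≠ 0 := fun h => one_ne_zero (congrFun h 0)
  obtain ⟨hd0, hd1, hd2, hd3⟩ := axis_decomposition_pderiv hff (p := E) rfl rfl
  have hlead : ∃ y : k, eval E f₁ + y * eval E f₂ ≠ 0 := by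
    by_contra! hno
    have h1 : eval E f₁ = 0 := by simpa using hno 0
    have h2 : eval E f₂ = 0 := by simpa [h1] using hno 1
    obtain ⟨i, hi⟩ := hf.exists_pderiv hE0 (hL E rfl rfl)
    fin_cases i
    exacts [hi hd0, hi hd1, hi (hd2.trans h1), hi (hd3.trans h2)]
  have hlead' : {y : k | eval E f₁ + y * eval E f₂ = 0}.Finite := by
    obtain ⟨y, hy⟩ := hlead
    refine (Polynomial.finite_setOfPred_isRoot
      (p := Polynomial.C (eval E f₁) + Polynomial.X * Polynomial.C (eval E f₂)) ?_).subset
      fun t ht => ?_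
    · intro h0
      have h1 := congrArg (Polynomial.eval y) h0
      rw [Polynomial.eval_add, Polynomial.eval_mul, Polynomial.eval_C, Polynomial.eval_C,
        Polynomial.eval_X, Polynomial.eval_zero] at h1
      exact hy h1
    · rw [Set.mem_ofPred_eq, Polynomial.IsRoot, Polynomial.eval_add, Polynomial.eval_mul,
        Polynomial.eval_C, Polynomial.eval_C, Polynomial.eval_X]
      exact ht
  refine ⟨{y | eval ![z₀, 1, y] r = 0} ∪ {y | eval E f₁ + y * eval E f₂ = 0}, ?_, ?_⟩
  · refine Set.Finite.union ?_ hlead'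
    refine (finite_eval_line_eq_zero r _ _ (t₀ := y₀) (by rwa [← e1])).subset fun y hy => ?_
    rw [Set.mem_ofPred_eq, ← e1]
    exact hy
  intro y hy
  simp only [Set.mem_union, Set.mem_ofPred_eq, not_or] at hy
  refine ⟨{z | eval ![z, 1, y] r = 0}, ?_, ?_⟩
  · refine (finite_eval_line_eq_zero r _ _ (t₀ := z₀) (by rw [← e2]; exact hy.1)).subset
      fun z hz => ?_
    rw [Set.mem_ofPred_eq, ← e2]
    exact hz
  intro z hz
  rw [Set.mem_ofPred_eq] at hz
  have hG : (f₁ + C y * f₂).IsHomogeneous m := by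
    refine hf₁.add ?_
    have := (isHomogeneous_C (Fin 4) y).mul hf₂
    rwa [zero_add] at this
  set u : Fin 4 → k := ![0, z, 1, y] with hu
  have huw : ∀ w : k, u + w • E = ![w, z, 1, y] := fun w => by
    funext i; fin_cases i <;> simp [hu, hE]
  set p := lineExp (f₁ + C y * f₂) u E with hp
  have hpf : p = lineExp f u E := by
    refine Polynomial.funext fun w => ?_
    rw [hp, lineExp_eval_field, lineExp_eval_field, huw, hff]
    simp
  have hpm : p.coeff m ≠ 0 := by
    rw [hp, lineExp_coeff_top hG]
    have := hy.2
    simpa [coe_aeval_eq_eval] using this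
  have hp0 : p ≠ 0 := fun h => hpm (by rw [h, Polynomial.coeff_zero])
  have hdeg : p.natDegree = m :=
    le_antisymm (lineExp_natDegree_le hG _ _) (Polynomial.le_natDegree_of_ne_zero hpm)
  have hroot : ∀ w, p.IsRoot w → eval ![w, z, 1, y] f = 0 ∧ eval ![w, z, 1, y] b ≠ 0 := by
    intro w hw
    have h1 : eval ![w, z, 1, y] f = 0 := by
      rw [Polynomial.IsRoot, hpf, lineExp_eval_field, huw] at hw
      exact hw
    refine ⟨h1, fun h2 => hz ?_⟩
    have h3 := hrv _ h1 h2
    have h4 : (fun i => (![w, z, 1, y] : Fin 4 → k) (Fin.succ i)) = ![z, 1, y] := by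
      funext i; fin_cases i <;> rfl
    rwa [h4] at h3
  have hnd : p.roots.Nodup := by
    rw [Multiset.nodup_iff_count_le_one]
    intro w
    rw [Polynomial.count_roots]
    by_contra! h1
    rw [Polynomial.one_lt_rootMultiplicity_iff_isRoot hp0] at h1
    have h2 := hroot w h1.1
    have h3 := h1.2
    rw [Polynomial.IsRoot, hpf, eval_derivative_lineExp, huw] at h3
    have h4 : E = Pi.single 0 1 := by
      funext i; fin_cases i <;> simp [hE]
    rw [h4, dirDeriv_single] at h3
    exact h2.2 (hwb _ h2.1 h3)
  refine ⟨p.roots.toFinset, ?_, fun w hw => ?_⟩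
  · rw [Multiset.toFinset_card_of_nodup hnd, ← hdeg]
    exact ((IsAlgClosed.splits p).natDegree_eq_card_roots).symm
  · rw [Multiset.mem_toFinset, Polynomial.mem_roots hp0] at hw
    exact hroot w hw

end Fibres

section Characteristic

variable {k : Type*} [Field k] {f : MvPolynomial (Fin 4) k} {d m : ℕ}

lemma Derivation.map_mvPolynomial_aeval {σ B : Type*} [Fintype σ] [CommRing B] [Algebra k B]
    (D : Derivation k B B) (g : σ → B) (f : MvPolynomial σ k) :
    D (aeval g f) = ∑ i, D (g i) * aeval g (pderiv i f) := by
  classical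
  induction f using MvPolynomial.induction_on with
  | C a => simp
  | add p q hp hq => simp [hp, hq, mul_add, Finset.sum_add_distrib]
  | mul_X p i hp =>
    have h : ∀ j, aeval g (pderiv j (p * X i)) =
        g i * aeval g (pderiv j p) + if i = j then aeval g p else 0 := by
      intro j
      by_cases hij : i = j
      · subst hij
        simp [Derivation.leibniz, add_comm]
      · simp [Derivation.leibniz, pderiv_X, hij]
    simp only [h, mul_add, Finset.sum_add_distrib, mul_ite, mul_zero, Finset.sum_ite_eq,
      Finset.mem_univ, if_true]
    rw [map_mul, Derivation.leibniz, hp, aeval_X, smul_eq_mul, smul_eq_mul, Finset.mul_sum, add_comm,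
      mul_comm (aeval g p)]
    congr 1
    exact Finset.sum_congr rfl fun j _ => by ring

/-- The coefficientwise extension of a derivation to polynomials. -/
noncomputable def Derivation.polynomialExt {A : Type*} [CommRing A] [Algebra k A]
    (D : Derivation k A A) : Derivation k (Polynomial A) (Polynomial A) :=
  (PolynomialModule.equivPolynomialSelf (R := A)).toLinearMap.compDer D.mapCoeffs

lemma Derivation.coeff_polynomialExt {A : Type*} [CommRing A] [Algebra k A]
    (D : Derivation k A A) (p : Polynomial A) (n : ℕ) :
    (D.polynomialExt p).coeff n = D (p.coeff n) := rfl

lemma Derivation.polynomialExt_lineExp {σ A : Type*} [Fintype σ] [CommRing A] [Algebra k A]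
    (D : Derivation k A A) (f : MvPolynomial σ k) (u v : σ → A) :
    D.polynomialExt (lineExp f u v) = ∑ i, (Polynomial.C (D (u i)) +
      Polynomial.X * Polynomial.C (D (v i))) * lineExp (pderiv i f) u v := by
  rw [lineExp, Derivation.map_mvPolynomial_aeval]
  refine Finset.sum_congr rfl fun i _ => ?_
  have h : D.polynomialExt (Polynomial.C (u i) + Polynomial.X * Polynomial.C (v i)) =
      Polynomial.C (D (u i)) + Polynomial.X * Polynomial.C (D (v i)) := by
    ext n
    rw [Derivation.coeff_polynomialExt]
    rcases n with _ | n
    · simp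
    · simp [Polynomial.coeff_C, apply_ite D]
  rw [h]
  rfl

lemma derivative_lineExp {σ A : Type*} [Fintype σ] [CommRing A] [Algebra k A]
    (f : MvPolynomial σ k) (u v : σ → A) :
    (lineExp f u v).derivative = ∑ i, Polynomial.C (v i) * lineExp (pderiv i f) u v := by
  obtain ⟨D, hD⟩ : ∃ D : Derivation k (Polynomial A) (Polynomial A),
      ∀ p, D p = Polynomial.derivative p :=
    ⟨Derivation.restrictScalars k Polynomial.derivative', fun p => rfl⟩
  rw [← hD, lineExp, Derivation.map_mvPolynomial_aeval]
  refine Finset.sum_congr rfl fun i _ => ?_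
  rw [hD]
  simp [lineExp]

/-- If the axis meets the generic tangent section only asymptotically, then the degree of the
residual plane curves vanishes in `k`. -/
lemma natCast_eq_zero_of_dvd_axisForm (hp : Prime f) (hm : 3 ≤ m) (hw : ¬ f ∣ pderiv 0 f)
    (h : ∀ j, 2 ≤ j → j < m → f ∣ axisForm f j) (hm' : ¬ f ∣ axisForm f m) : (m : k) = 0 := by
  set D : Derivation k (MvPolynomial (Fin 4) k) (MvPolynomial (Fin 4) k) :=
    mkDerivation k (axisPoint f) with hD
  have hA0 : axisPoint f 0 = -pderiv 1 f := rfl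
  have hA1 : axisPoint f 1 = pderiv 0 f := rfl
  have hA2 : axisPoint f 2 = 0 := rfl
  have hA3 : axisPoint f 3 = 0 := rfl
  have hDX : ∀ i, D (X i) = axisPoint f i := fun i => mkDerivation_X _ _ _
  have hDg : ∀ g, D g = dirDeriv g X (axisPoint f) := by
    intro g
    have := Derivation.map_mvPolynomial_aeval D X g
    rw [aeval_X_left_apply] at this
    rw [this, dirDeriv]
    exact Finset.sum_congr rfl fun i _ => by rw [hDX]
  have hDg' : ∀ g, D g = pderiv 0 f * pderiv 1 g - pderiv 1 f * pderiv 0 g := by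
    intro g
    rw [hDg, dirDeriv, Fin.sum_univ_four]
    simp only [aeval_X_left_apply, axisPoint]
    simp
    ring
  have hDf : D f = 0 := by rw [hDg']; ring
  set Θ := lineExp f X (axisPoint f) with hΘ
  set a := lineExp (pderiv 0 f) X (axisPoint f) with ha
  set b := lineExp (pderiv 1 f) X (axisPoint f) with hb
  have h1 : D.polynomialExt Θ = (Polynomial.C (-pderiv 1 f) +
      Polynomial.X * Polynomial.C (D (-pderiv 1 f))) * a + (Polynomial.C (pderiv 0 f) +
      Polynomial.X * Polynomial.C (D (pderiv 0 f))) * b := by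
    rw [hΘ, Derivation.polynomialExt_lineExp, Fin.sum_univ_four]
    simp only [hDX, hA0, hA1, hA2, hA3, map_zero, mul_zero, add_zero, zero_mul]
    rfl
  have h2 : Θ.derivative = Polynomial.C (-pderiv 1 f) * a + Polynomial.C (pderiv 0 f) * b := by
    rw [hΘ, derivative_lineExp, Fin.sum_univ_four]
    simp only [hA0, hA1, hA2, hA3, map_zero, add_zero, zero_mul]
    rfl
  have h3 : 2 * axisForm f 2 = pderiv 0 f * D (pderiv 1 f) - pderiv 1 f * D (pderiv 0 f) := by
    have h4 := congrArg (Polynomial.coeff · 1) h2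
    simp only [Polynomial.coeff_derivative, Polynomial.coeff_add, Polynomial.coeff_C_mul] at h4
    rw [ha, hb, lineExp_coeff_one, lineExp_coeff_one, ← hDg, ← hDg] at h4
    have h5 : axisForm f 2 = Θ.coeff 2 := rfl
    rw [h5]
    norm_num at h4
    linear_combination h4
  have h4 : Polynomial.C (pderiv 0 f) * D.polynomialExt Θ = Polynomial.C (pderiv 0 f) * Θ.derivative
      + Polynomial.X * (Polynomial.C (D (pderiv 0 f)) * Θ.derivative)
      - Polynomial.X * (Polynomial.C (2 * axisForm f 2) * a) := by
    rw [h1, h2, h3]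
    simp only [map_neg, map_sub, map_mul]
    ring
  obtain ⟨n, rfl⟩ : ∃ n, m = n + 2 := ⟨m - 2, by omega⟩
  have h5 := congrArg (Polynomial.coeff · (n + 1)) h4
  simp only [Polynomial.coeff_add, Polynomial.coeff_sub, Polynomial.coeff_X_mul,
    Polynomial.coeff_C_mul, Derivation.coeff_polynomialExt, Polynomial.coeff_derivative] at h5
  have h6 : ∀ j, Θ.coeff j = axisForm f j := fun j => rfl
  simp only [h6] at h5
  have h7 : f ∣ D (axisForm f (n + 1)) := by
    obtain ⟨r, hr⟩ := h (n + 1) (by omega) (by omega)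
    exact ⟨D r, by rw [hr, Derivation.leibniz, hDf]; simp⟩
  have h8 : f ∣ pderiv 0 f * (axisForm f (n + 2) * ((n + 2 : ℕ) : MvPolynomial (Fin 4) k)) := by
    obtain ⟨r, hr⟩ := h7
    obtain ⟨s, hs⟩ := h (n + 1) (by omega) (by omega)
    obtain ⟨t, ht⟩ := h 2 le_rfl (by omega)
    rw [hr, hs, ht] at h5
    refine ⟨pderiv 0 f * r - D (pderiv 0 f) * (s * (n + 1)) + 2 * t * a.coeff n, ?_⟩
    push_cast at h5 ⊢
    linear_combination -h5
  rcases hp.dvd_or_dvd h8 with h9 | h9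
  · exact (hw h9).elim
  rcases hp.dvd_or_dvd h9 with h9 | h9
  · exact (hm' h9).elim
  by_contra hne
  apply hp.not_isUnit
  refine isUnit_of_dvd_unit h9 ?_
  rw [← map_natCast (C : k →+* MvPolynomial (Fin 4) k)]
  exact (IsUnit.mk0 _ hne).map C

end Characteristic

section PlaneCurves

variable {k : Type*} [Field k] {m : ℕ} {G : MvPolynomial (Fin 3) k}

lemma eval_smul_add_smul_of_asymptotic {σ : Type*} {G : MvPolynomial σ k} (hG : G.IsHomogeneous m)
    {q p : σ → k} (h : ∀ s : k, eval (q + s • p) G = s ^ m * eval p G) (a b : k) :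
    eval (a • q + b • p) G = b ^ m * eval p G := by
  rcases eq_or_ne a 0 with rfl | ha
  · rw [zero_smul, zero_add, IsHomogeneous.eval_smul hG]
  · have h1 : a • q + b • p = a • (q + (a⁻¹ * b) • p) := by
      rw [smul_add, smul_smul, mul_inv_cancel_left₀ ha]
    rw [h1, IsHomogeneous.eval_smul hG, h, ← mul_assoc, ← mul_pow, mul_inv_cancel_left₀ ha]

lemma dirDeriv_eq_zero_of_asymptotic [Infinite k] {σ : Type*} [Fintype σ] {G : MvPolynomial σ k}
    (hG : G.IsHomogeneous m) (hmk : (m : k) = 0) {q p u v : σ → k}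
    (h : ∀ s : k, eval (q + s • p) G = s ^ m * eval p G)
    (hu : u ∈ Submodule.span k {q, p}) (hv : v ∈ Submodule.span k {q, p}) :
    dirDeriv G u v = 0 := by
  obtain ⟨a, b, rfl⟩ := Submodule.mem_span_pair.1 hu
  obtain ⟨a', b', rfl⟩ := Submodule.mem_span_pair.1 hv
  have h1 : lineExp G (a • q + b • p) (a' • q + b' • p) =
      (Polynomial.C b + Polynomial.C b' * Polynomial.X) ^ m * Polynomial.C (eval p G) := by
    refine Polynomial.funext fun s => ?_
    have h2 : a • q + b • p + s • (a' • q + b' • p) = (a + s * a') • q + (b + s * b') • p := by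
      module
    rw [lineExp_eval_field, h2, eval_smul_add_smul_of_asymptotic hG h, Polynomial.eval_mul,
      Polynomial.eval_pow,
      Polynomial.eval_add, Polynomial.eval_mul, Polynomial.eval_C, Polynomial.eval_C,
      Polynomial.eval_C, Polynomial.eval_X, mul_comm s]
  rw [← lineExp_coeff_one]
  have h2 := Polynomial.coeff_derivative (lineExp G (a • q + b • p) (a' • q + b' • p)) 0
  rw [h1, Polynomial.derivative_mul, Polynomial.derivative_pow, Polynomial.derivative_C, hmk,
    ← h1] at h2
  simpa using h2.symm

/-- The differential of a form at a point. -/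
noncomputable def formGradient (G : MvPolynomial (Fin 3) k) (u : Fin 3 → k) :
    Module.Dual k (Fin 3 → k) :=
  ∑ i, eval u (pderiv i G) • LinearMap.proj i

lemma formGradient_apply (G : MvPolynomial (Fin 3) k) (u v : Fin 3 → k) :
    formGradient G u v = dirDeriv G u v := by
  simp [formGradient, dirDeriv, mul_comm]

/-- Data of points of a plane curve whose tangent lines meet the curve at only one point. -/
structure IsAsymptotic (G : MvPolynomial (Fin 3) k) (m : ℕ) (q p : Fin 3 → k) : Prop where
  coord : q 2 = 1
  coord' : p 2 = 0
  deriv : eval q (pderiv 0 G) ≠ 0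
  ne_zero : eval p G ≠ 0
  expansion : ∀ s : k, eval (q + s • p) G = s ^ m * eval p G

namespace IsAsymptotic

variable {q p q' p' : Fin 3 → k}

lemma right_ne_zero (h : IsAsymptotic G m q p) (hG : G.IsHomogeneous m) (hm : m ≠ 0) : p ≠ 0 := by
  rintro rfl
  apply h.ne_zero
  have := IsHomogeneous.eval_smul hG 0 (0 : Fin 3 → k)
  rwa [smul_zero, zero_pow hm, zero_mul] at this

lemma finrank_span (h : IsAsymptotic G m q p) (hG : G.IsHomogeneous m) (hm : m ≠ 0) :
    Module.finrank k (Submodule.span k {q, p}) = 2 := by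
  have hq : q 2 ≠ 0 := by rw [h.coord]; exact one_ne_zero
  have := finrank_span_eq_card
    (linearIndependent_pair_of_apply_eq_zero 2 hq h.coord' (h.right_ne_zero hG hm))
  rwa [Matrix.range_cons_cons_empty, Fintype.card_fin] at this

lemma eq_smul_of_eval_eq_zero (h : IsAsymptotic G m q p) (hG : G.IsHomogeneous m)
    {u : Fin 3 → k} (hu : u ∈ Submodule.span k {q, p}) (hu0 : eval u G = 0) :
    ∃ a : k, u = a • q := by
  obtain ⟨a, b, rfl⟩ := Submodule.mem_span_pair.1 hu
  rw [eval_smul_add_smul_of_asymptotic hG h.expansion] at hu0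
  have hb := eq_zero_of_pow_eq_zero ((mul_eq_zero.1 hu0).resolve_right h.ne_zero)
  exact ⟨a, by rw [hb, zero_smul, add_zero]⟩

lemma eval_left (h : IsAsymptotic G m q p) (hm : m ≠ 0) : eval q G = 0 := by
  have := h.expansion 0
  rwa [zero_smul, add_zero, zero_pow hm, zero_mul] at this

lemma eq_of_smul_eq_smul (h : IsAsymptotic G m q p) (h' : IsAsymptotic G m q' p') {a a' : k}
    (ha : a • q ≠ 0) (he : a • q = a' • q') : q = q' := by
  have h1 := congrFun he 2
  simp only [Pi.smul_apply, h.coord, h'.coord, smul_eq_mul, mul_one] at h1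
  subst h1
  have : a ≠ 0 := by rintro rfl; exact ha (zero_smul _ _)
  exact smul_right_injective _ this he

lemma eq_of_span_eq (h : IsAsymptotic G m q p) (h' : IsAsymptotic G m q' p')
    (hG : G.IsHomogeneous m) (hm : m ≠ 0)
    (he : Submodule.span k {q, p} = Submodule.span k {q', p'}) : q = q' := by
  obtain ⟨a, ha⟩ := h'.eq_smul_of_eval_eq_zero hG (u := q)
    (he ▸ Submodule.subset_span (by simp)) (h.eval_left hm)
  refine h.eq_of_smul_eq_smul h' (a := 1) (a' := a) ?_ (by rwa [one_smul])
  rw [one_smul]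
  intro h0
  simpa [h0] using h.coord

lemma gradient_eq_zero [Infinite k] (h : IsAsymptotic G m q p) (h' : IsAsymptotic G m q' p')
    (hG : G.IsHomogeneous m) (hm : m ≠ 0) (hmk : (m : k) = 0) (hne : q ≠ q') {u : Fin 3 → k}
    (hu : u ∈ Submodule.span k {q, p}) (hu' : u ∈ Submodule.span k {q', p'}) :
    formGradient G u = 0 := by
  by_contra h0
  have hker : Module.finrank k (LinearMap.ker (formGradient G u)) ≤ 2 := by
    have := Module.Dual.finrank_ker_add_one_of_ne_zero h0
    rw [Module.finrank_fin_fun] at this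
    omega
  have key : ∀ {q p}, IsAsymptotic G m q p → u ∈ Submodule.span k {q, p} →
      Submodule.span k {q, p} = LinearMap.ker (formGradient G u) := by
    intro q p h hu
    refine Submodule.eq_of_le_of_finrank_le (fun v hv => ?_) (by rwa [h.finrank_span hG hm])
    rw [LinearMap.mem_ker, formGradient_apply]
    exact dirDeriv_eq_zero_of_asymptotic hG hmk h.expansion hu hv
  exact hne (h.eq_of_span_eq h' hG hm ((key h hu).trans (key h' hu').symm))

lemma span_eq_ker_gradient [Infinite k] (h : IsAsymptotic G m q p)
    (hG : G.IsHomogeneous m) (hm : m ≠ 0) (hmk : (m : k) = 0) :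
    Submodule.span k {q, p} = LinearMap.ker (formGradient G q) := by
  have h0 : formGradient G q ≠ 0 := by
    intro h0
    apply h.deriv
    have := congrArg (fun φ => φ (Pi.single 0 1)) h0
    simpa [formGradient, Pi.single_apply] using this
  refine Submodule.eq_of_le_of_finrank_le (fun v hv => ?_) ?_
  · rw [LinearMap.mem_ker, formGradient_apply]
    exact dirDeriv_eq_zero_of_asymptotic hG hmk h.expansion (Submodule.subset_span (by simp)) hv
  · have := Module.Dual.finrank_ker_add_one_of_ne_zero h0
    rw [Module.finrank_fin_fun] at this
    rw [h.finrank_span hG hm]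
    omega

/-- The finitely many possible common points with other tangents. -/
lemma exists_finite_common_points [Infinite k] (h : IsAsymptotic G m q p)
    (hG : G.IsHomogeneous m) (hm : m ≠ 0) (hmk : (m : k) = 0) :
    ∃ F : Set (Fin 3 → k), F.Finite ∧ (∀ t ∈ F, t ≠ 0 ∧ t ∈ Submodule.span k {q, p}) ∧
      ∀ q' p', IsAsymptotic G m q' p' → q ≠ q' → ∃ t ∈ F, t ∈ Submodule.span k {q', p'} := by
  have hp0 := h.right_ne_zero hG hm
  refine ⟨insert p ((fun b : k => q + b • p) '' {b | eval (q + b • p) (pderiv 0 G) = 0}), ?_, ?_, ?_⟩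
  · refine Set.Finite.insert _ (Set.Finite.image _ (finite_eval_line_eq_zero _ _ _ (t₀ := 0) ?_))
    rw [zero_smul, add_zero]
    exact h.deriv
  · rintro t (rfl | ⟨b, -, rfl⟩)
    · exact ⟨hp0, Submodule.subset_span (by simp)⟩
    · refine ⟨fun h0 => ?_, Submodule.mem_span_pair.2 ⟨1, b, by rw [one_smul]⟩⟩
      have := congrFun h0 2
      simp [h.coord, h.coord'] at this
  · intro q' p' h' hne
    have h1 : Submodule.span k {q, p} ⊓ Submodule.span k {q', p'} ≠ ⊥ := by
      intro h0
      have h2 := Submodule.finrank_sup_add_finrank_inf_eq (Submodule.span k {q, p})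
        (Submodule.span k {q', p'})
      rw [h0, finrank_bot, h.finrank_span hG hm, h'.finrank_span hG hm] at h2
      have h3 := Submodule.finrank_le (Submodule.span k {q, p} ⊔ Submodule.span k {q', p'})
      rw [Module.finrank_fin_fun] at h3
      omega
    obtain ⟨u, ⟨hu, hu'⟩, hu0⟩ := Submodule.exists_mem_ne_zero_of_ne_bot h1
    have h2 := h.gradient_eq_zero h' hG hm hmk hne hu hu'
    obtain ⟨a, b, rfl⟩ := Submodule.mem_span_pair.1 hu
    rcases eq_or_ne a 0 with rfl | ha
    · refine ⟨p, Set.mem_insert _ _, ?_⟩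
      rw [zero_smul, zero_add] at hu' hu0
      have hb : b ≠ 0 := by rintro rfl; exact hu0 (zero_smul _ _)
      exact (Submodule.smul_mem_iff _ hb).1 hu'
    · have h3 : a • q + b • p = a • (q + (a⁻¹ * b) • p) := by
        rw [smul_add, smul_smul, mul_inv_cancel_left₀ ha]
      rw [h3] at hu' h2
      refine ⟨_, Set.mem_insert_of_mem _ ⟨a⁻¹ * b, ?_, rfl⟩, (Submodule.smul_mem_iff _ ha).1 hu'⟩
      have h4 := congrArg (fun φ => φ (Pi.single 0 1)) h2
      have h5 : eval (a • (q + (a⁻¹ * b) • p)) (pderiv 0 G) = 0 := by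
        simpa [formGradient, Pi.single_apply] using h4
      rw [IsHomogeneous.eval_smul hG.pderiv] at h5
      exact (mul_eq_zero.1 h5).resolve_left (pow_ne_zero _ ha)

end IsAsymptotic

end PlaneCurves

section StrangePoint

variable {k : Type*} [Field k] {m : ℕ} {G : MvPolynomial (Fin 3) k}

lemma eq_span_pair_of_mem {V : Type*} [AddCommGroup V] [Module k V]
    {T T' : Submodule k V} (hT : Module.finrank k T = 2) (hT' : Module.finrank k T' = 2)
    {s t : V} (hst : LinearIndependent k ![s, t]) (hs : s ∈ T) (hs' : s ∈ T') (ht : t ∈ T)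
    (ht' : t ∈ T') : T = T' := by
  have h2 := finrank_span_eq_card hst
  rw [Matrix.range_cons_cons_empty, Fintype.card_fin] at h2
  have key : ∀ {T : Submodule k V}, Module.finrank k T = 2 → s ∈ T → t ∈ T →
      Submodule.span k {s, t} = T := by
    intro T hT hs ht
    have : FiniteDimensional k T := FiniteDimensional.of_finrank_pos (by omega)
    refine Submodule.eq_of_le_of_finrank_le ?_ (by rw [hT, h2])
    rw [Submodule.span_le]
    rintro v (rfl | rfl)
    exacts [hs, ht]
  rw [← key hT hs ht, key hT' hs' ht']

/-- All the tangent lines pass through one point. -/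
lemma exists_mem_all_tangents [Infinite k] (hG : G.IsHomogeneous m) (hm : m ≠ 0)
    (hmk : (m : k) = 0) {Q : Set (Fin 3 → k)} (hQ : Q.Infinite) {p : (Fin 3 → k) → Fin 3 → k}
    (hQp : ∀ q ∈ Q, IsAsymptotic G m q (p q)) :
    ∃ c : Fin 3 → k, c ≠ 0 ∧ ∀ q ∈ Q, c ∈ Submodule.span k {q, p q} := by
  have pigeon : ∀ {F R : Set (Fin 3 → k)}, F.Finite → R.Infinite →
      (∀ q ∈ R, ∃ t ∈ F, t ∈ Submodule.span k {q, p q}) →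
      ∃ t ∈ F, {q ∈ R | t ∈ Submodule.span k {q, p q}}.Infinite := by
    intro F R hF hR h
    by_contra! hno
    refine hR ((hF.biUnion fun t ht => hno t ht).subset fun q hq => ?_)
    obtain ⟨t, ht, htq⟩ := h q hq
    exact Set.mem_biUnion ht ⟨hq, htq⟩
  obtain ⟨q₁, hq₁⟩ := hQ.nonempty
  obtain ⟨F, hF, hFt, hFq⟩ := (hQp q₁ hq₁).exists_finite_common_points hG hm hmk
  obtain ⟨c, hcF, hc⟩ := pigeon hF (hQ.sdiff (Set.finite_singleton q₁))
    fun q hq => hFq q (p q) (hQp q hq.1) (fun h => hq.2 h.symm)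
  refine ⟨c, (hFt c hcF).1, fun q hq => ?_⟩
  by_contra hcq
  obtain ⟨F', hF', hFt', hFq'⟩ := (hQp q hq).exists_finite_common_points hG hm hmk
  obtain ⟨t, htF, ht⟩ := pigeon hF' hc fun q' hq' =>
    hFq' q' (p q') (hQp q' hq'.1.1) (fun h => hcq (h ▸ hq'.2))
  obtain ⟨q₂, hq₂, q₃, hq₃, hne⟩ := ht.nontrivial
  refine hne ((hQp q₂ hq₂.1.1.1).eq_of_span_eq (hQp q₃ hq₃.1.1.1) hG hm ?_)
  refine eq_span_pair_of_mem ((hQp _ hq₂.1.1.1).finrank_span hG hm)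
    ((hQp _ hq₃.1.1.1).finrank_span hG hm) (s := c) (t := t) ?_ hq₂.1.2 hq₃.1.2 hq₂.2 hq₃.2
  rw [LinearIndependent.pair_iff' (hFt c hcF).1]
  intro a ha
  refine hcq ?_
  have ha0 : a ≠ 0 := by
    rintro rfl
    exact (hFt' t htF).1 (by rw [← ha, zero_smul])
  rw [← Submodule.smul_mem_iff _ ha0, ha]
  exact (hFt' t htF).2

/-- The cross product of the differentials of a form at two points. -/
noncomputable def crossGradient {A : Type*} [CommRing A] (a b : Fin 3 → A) : Fin 3 → A :=
  ![a 1 * b 2 - a 2 * b 1, a 2 * b 0 - a 0 * b 2, a 0 * b 1 - a 1 * b 0]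

lemma exists_smul_eq_crossGradient {a b c : Fin 3 → k} (hc : c ≠ 0)
    (ha : a 0 * c 0 + a 1 * c 1 + a 2 * c 2 = 0) (hb : b 0 * c 0 + b 1 * c 1 + b 2 * c 2 = 0) :
    ∃ s : k, s • c = crossGradient a b := by
  have h01 : c 0 * (a 2 * b 0 - a 0 * b 2) = c 1 * (a 1 * b 2 - a 2 * b 1) := by
    linear_combination a 2 * hb - b 2 * ha
  have h12 : c 1 * (a 0 * b 1 - a 1 * b 0) = c 2 * (a 2 * b 0 - a 0 * b 2) := by
    linear_combination a 0 * hb - b 0 * ha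
  have h20 : c 2 * (a 1 * b 2 - a 2 * b 1) = c 0 * (a 0 * b 1 - a 1 * b 0) := by
    linear_combination a 1 * hb - b 1 * ha
  have key : ∀ i j, crossGradient a b i * c j = crossGradient a b j * c i := by
    intro i j
    fin_cases i <;> fin_cases j <;> simp only [crossGradient, Fin.zero_eta, Fin.mk_one,
      Fin.reduceFinMk, Matrix.cons_val] <;>
      first
        | ring1
        | linear_combination h01
        | linear_combination -h01
        | linear_combination h12
        | linear_combination -h12
        | linear_combination h20
        | linear_combination -h20
  obtain ⟨i, hi⟩ : ∃ i, c i ≠ 0 := by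
    by_contra! h
    exact hc (funext h)
  refine ⟨crossGradient a b i / c i, funext fun j => ?_⟩
  rw [Pi.smul_apply, smul_eq_mul, div_mul_eq_mul_div, div_eq_iff hi, key]

/-- A plane curve all of whose general tangent lines meet it only once is strange. -/
lemma exists_strange_point [Infinite k] (hG : G.IsHomogeneous m) (hm : m ≠ 0)
    (hmk : (m : k) = 0) {Q : Set (Fin 3 → k)} (hQ : Q.Infinite) {p : (Fin 3 → k) → Fin 3 → k}
    (hQp : ∀ q ∈ Q, IsAsymptotic G m q (p q))
    (hform : ∀ (h : MvPolynomial (Fin 3) k) (e : ℕ), h.IsHomogeneous e → e < m →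
      (∀ q ∈ Q, eval q h = 0) → h = 0) :
    ∃ c : Fin 3 → k, c ≠ 0 ∧ eval c G ≠ 0 ∧
      (∀ j, 1 ≤ j → j < m → ∀ v, (lineExp G v c).coeff j = 0) ∧
      ∃ q₁ q₂, q₁ 2 = 1 ∧ q₂ 2 = 1 ∧ crossGradient (fun i => eval q₁ (pderiv i G))
        (fun i => eval q₂ (pderiv i G)) ≠ 0 := by
  obtain ⟨c, hc, hcQ⟩ := exists_mem_all_tangents hG hm hmk hQ hQp
  refine ⟨c, hc, ?_, ?_, ?_⟩
  · intro h0
    obtain ⟨q, hq, q', hq', hne⟩ := hQ.nontrivial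
    obtain ⟨a, ha⟩ := (hQp q hq).eq_smul_of_eval_eq_zero hG (hcQ q hq) h0
    obtain ⟨a', ha'⟩ := (hQp q' hq').eq_smul_of_eval_eq_zero hG (hcQ q' hq') h0
    exact hne ((hQp q hq).eq_of_smul_eq_smul (hQp q' hq') (ha ▸ hc) (ha ▸ ha'))
  · intro j hj hjm
    set g : MvPolynomial (Fin 3) k := (lineExp G X (fun i => C (c i))).coeff j with hg
    have hge : ∀ v, eval v g = (lineExp G v c).coeff j := by
      intro v
      have := lineExp_coeff_map G X (fun i => C (c i)) (aeval v : MvPolynomial (Fin 3) k →ₐ[k] k) j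
      simpa [coe_aeval_eq_eval] using this
    have hgh : g.IsHomogeneous (m - j) := by
      have := lineExp_coeff_mem (fun n => homogeneousSubmodule (Fin 3) k n) hG (a := 1) (b := 0)
        (u := X) (v := fun i => C (c i)) (fun i => isHomogeneous_X k i)
        (fun i => isHomogeneous_C _ _) (j := j) (e := m - j) (by omega)
      rw [mul_one, mul_zero, add_zero] at this
      exact this
    have hg0 : g = 0 := by
      refine hform g (m - j) hgh (by omega) fun q hq => ?_
      rw [hge]
      obtain ⟨a, b, hab⟩ := Submodule.mem_span_pair.1 (hcQ q hq)
      have h1 : lineExp G q c =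
          Polynomial.C (b ^ m * eval (p q) G) * Polynomial.X ^ m := by
        refine Polynomial.funext fun s => ?_
        have h2 : q + s • c = (1 + s * a) • q + (s * b) • p q := by
          rw [← hab]; module
        rw [lineExp_eval_field, h2,
          eval_smul_add_smul_of_asymptotic hG (hQp q hq).expansion, Polynomial.eval_mul,
          Polynomial.eval_C, Polynomial.eval_pow, Polynomial.eval_X]
        ring
      rw [h1, Polynomial.coeff_C_mul_X_pow, if_neg (by omega)]
    intro v
    rw [← hge, hg0, map_zero]
  · obtain ⟨q, hq, q', hq', hne⟩ := hQ.nontrivial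
    refine ⟨q, q', (hQp q hq).coord, (hQp q' hq').coord, fun h0 => hne ?_⟩
    refine (hQp q hq).eq_of_span_eq (hQp q' hq') hG hm ?_
    rw [(hQp q hq).span_eq_ker_gradient hG hm hmk, (hQp q' hq').span_eq_ker_gradient hG hm hmk]
    have h00 := congrFun h0 0
    have h01 := congrFun h0 1
    have h02 := congrFun h0 2
    simp only [crossGradient, Matrix.cons_val, Pi.zero_apply] at h00 h01 h02
    have hd := (hQp q hq).deriv
    have hd' := (hQp q' hq').deriv
    ext v
    have hae : ∀ (u : Fin 3 → k) (g : MvPolynomial (Fin 3) k), aeval u g = eval u g :=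
      fun _ _ => rfl
    simp only [LinearMap.mem_ker, formGradient_apply, dirDeriv, Fin.sum_univ_three, hae]
    constructor
    · intro h
      refine (mul_eq_zero.1 ?_).resolve_left hd
      linear_combination eval q' (pderiv 0 G) * h - v 2 * h01 + v 1 * h02
    · intro h
      refine (mul_eq_zero.1 ?_).resolve_left hd'
      linear_combination eval q (pderiv 0 G) * h + v 2 * h01 - v 1 * h02

end StrangePoint

section PlaneSections

variable {k A B : Type*} [Field k] [CommRing A] [Algebra k A] [CommRing B] [Algebra k B]
  {f f₁ f₂ : MvPolynomial (Fin 4) k} {m : ℕ}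

/-- The point of the plane `X₃ = y X₂` with given first three coordinates. -/
def planePoint (y : A) (v : Fin 3 → A) : Fin 4 → A := ![v 0, v 1, v 2, y * v 2]

lemma planePoint_add_smul (y : A) (u v : Fin 3 → A) (s : A) :
    planePoint y (u + s • v) = planePoint y u + s • planePoint y v := by
  ext i; fin_cases i <;> simp [planePoint]
  ring

/-- The form cutting out the residual of the axis in the plane `X₃ = y X₂` on the surface
`X₂ f₁ + X₃ f₂`. -/
noncomputable def residualForm (f₁ f₂ : MvPolynomial (Fin 4) k) (y : k) : MvPolynomial (Fin 3) k :=
  aeval (planePoint (C y) X) (f₁ + C y * f₂)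

lemma eval_residual (y : k) (v : Fin 3 → k) :
    eval v (residualForm f₁ f₂ y) = eval (planePoint y v) f₁ + y * eval (planePoint y v) f₂ := by
  have h : ∀ g : MvPolynomial (Fin 4) k,
      eval v (aeval (planePoint (C y) X) g : MvPolynomial (Fin 3) k) = eval (planePoint y v) g := by
    intro g
    rw [← coe_aeval_eq_eval, RingHom.coe_coe, ← AlgHom.comp_apply, comp_aeval]
    have : (fun i => (aeval v : MvPolynomial (Fin 3) k →ₐ[k] k) (planePoint (C y) X i)) =
        planePoint y v := by
      funext i; fin_cases i <;> simp [planePoint]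
    rw [this]; rfl
  rw [residualForm, h, map_add, map_mul, eval_C]

lemma eval_planePoint (hfd : f = X 2 * f₁ + X 3 * f₂) (y : k) (v : Fin 3 → k) :
    eval (planePoint y v) f = v 2 * eval v (residualForm f₁ f₂ y) := by
  rw [eval_residual, hfd]
  simp only [map_add, map_mul, eval_X]
  simp only [planePoint, Matrix.cons_val]
  ring

lemma residual_isHomogeneous (hf₁ : f₁.IsHomogeneous m) (hf₂ : f₂.IsHomogeneous m) (y : k) :
    (residualForm f₁ f₂ y).IsHomogeneous m := by
  have h1 : (f₁ + C y * f₂).IsHomogeneous m := by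
    refine hf₁.add ?_
    have := (isHomogeneous_C (Fin 4) y).mul hf₂
    rwa [zero_add] at this
  have := h1.aeval (planePoint (C y) X : Fin 4 → MvPolynomial (Fin 3) k) (n := 1) ?_
  · rwa [one_mul] at this
  · intro i
    fin_cases i
    · exact isHomogeneous_X k 0
    · exact isHomogeneous_X k 1
    · exact isHomogeneous_X k 2
    · have := (isHomogeneous_C (Fin 3) y).mul (isHomogeneous_X k (2 : Fin 3))
      rwa [zero_add] at this

/-- The expansion of the residual form over a `k`-algebra. -/
noncomputable def residualExp (f₁ f₂ : MvPolynomial (Fin 4) k) (y : A) (u v : Fin 3 → A) :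
    Polynomial A :=
  lineExp f₁ (planePoint y u) (planePoint y v) +
    Polynomial.C y * lineExp f₂ (planePoint y u) (planePoint y v)

lemma residualExp_coeff_map (y : A) (u v : Fin 3 → A) (ψ : A →ₐ[k] B) (j : ℕ) :
    ψ ((residualExp f₁ f₂ y u v).coeff j) =
      (residualExp f₁ f₂ (ψ y) (fun i => ψ (u i)) (fun i => ψ (v i))).coeff j := by
  have h : ∀ v : Fin 3 → A, (fun i => ψ (planePoint y v i)) =
      planePoint (ψ y) (fun i => ψ (v i)) := by
    intro v
    funext i; fin_cases i <;> simp [planePoint]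
  simp only [residualExp, Polynomial.coeff_add, Polynomial.coeff_C_mul, map_add, map_mul,
    lineExp_coeff_map, h]

lemma residualExp_eq_lineExp [Infinite k] (y : k) (u v : Fin 3 → k) :
    residualExp f₁ f₂ y u v = lineExp (residualForm f₁ f₂ y) u v := by
  refine Polynomial.funext fun s => ?_
  rw [lineExp_eval_field, residualExp, Polynomial.eval_add, Polynomial.eval_mul,
    lineExp_eval_field, lineExp_eval_field, Polynomial.eval_C, eval_residual, planePoint_add_smul]

lemma residualExp_coeff_smul_right (y : A) (u v : Fin 3 → A) (c : A) (j : ℕ) :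
    (residualExp f₁ f₂ y u (c • v)).coeff j = c ^ j * (residualExp f₁ f₂ y u v).coeff j := by
  have h : planePoint y (c • v) = fun i => c * planePoint y v i := by
    funext i; fin_cases i <;> simp [planePoint]
    ring
  simp only [residualExp, Polynomial.coeff_add, Polynomial.coeff_C_mul, h,
    lineExp_coeff_smul_right]
  ring

lemma lineExp_residual [Infinite k] (hfd : f = X 2 * f₁ + X 3 * f₂) (y : k) {u v : Fin 3 → k}
    (hu : u 2 = 1) (hv : v 2 = 0) :
    lineExp (residualForm f₁ f₂ y) u v = lineExp f (planePoint y u) (planePoint y v) := by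
  refine Polynomial.funext fun s => ?_
  rw [lineExp_eval_field, lineExp_eval_field, ← planePoint_add_smul, eval_planePoint hfd]
  simp [hu, hv]

lemma dirDeriv_residual [Infinite k] (hfd : f = X 2 * f₁ + X 3 * f₂) (y : k) {u v : Fin 3 → k}
    (hu : u 2 = 1) (hv : v 2 = 0) :
    dirDeriv (residualForm f₁ f₂ y) u v =
      v 0 * eval (planePoint y u) (pderiv 0 f) + v 1 * eval (planePoint y u) (pderiv 1 f) := by
  rw [← lineExp_coeff_one, lineExp_residual hfd y hu hv, lineExp_coeff_one, dirDeriv_eval]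
  simp [planePoint, hv]

lemma eval_pderiv_eq_coeff_residualExp [Infinite k] (y : k) (u : Fin 3 → k) (i : Fin 3) :
    eval u (pderiv i (residualForm f₁ f₂ y)) =
      (residualExp f₁ f₂ y u (Pi.single i 1)).coeff 1 := by
  rw [residualExp_eq_lineExp, lineExp_coeff_one, dirDeriv, Finset.sum_eq_single i]
  · rw [Pi.single_eq_same, one_mul]; rfl
  · intro j _ hj
    rw [Pi.single_eq_of_ne hj, zero_mul]
  · simp

/-- A point whose tangent line meets a plane section only once. -/
lemma isAsymptotic_residual [Infinite k] (hf₁ : f₁.IsHomogeneous m)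
    (hf₂ : f₂.IsHomogeneous m)
    (hfd : f = X 2 * f₁ + X 3 * f₂) (hdvd : ∀ j, 2 ≤ j → j < m → f ∣ axisForm f j)
    {y : k} {q : Fin 3 → k} (hq2 : q 2 = 1) (hq : eval (planePoint y q) f = 0)
    (hw : eval (planePoint y q) (pderiv 0 f) ≠ 0)
    (hP : eval (planePoint y q) (axisForm f m) ≠ 0) :
    IsAsymptotic (residualForm f₁ f₂ y) m q
      ![-eval (planePoint y q) (pderiv 1 f), eval (planePoint y q) (pderiv 0 f), 0] := by
  set p : Fin 3 → k :=
    ![-eval (planePoint y q) (pderiv 1 f), eval (planePoint y q) (pderiv 0 f), 0] with hp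
  have hp2 : p 2 = 0 := rfl
  have hpp : planePoint y p =
      ![-eval (planePoint y q) (pderiv 1 f), eval (planePoint y q) (pderiv 0 f), 0, 0] := by
    funext i; fin_cases i <;> simp [planePoint, hp]
  have hL := lineExp_residual hfd y hq2 hp2
  have hcoef : ∀ j, (lineExp (residualForm f₁ f₂ y) q p).coeff j =
      eval (planePoint y q) (axisForm f j) := by
    intro j
    rw [hL, hpp, eval_axisForm]
  have hG := residual_isHomogeneous hf₁ hf₂ y
  have htop : eval p (residualForm f₁ f₂ y) = eval (planePoint y q) (axisForm f m) := by
    rw [← hcoef, lineExp_coeff_top hG]; rfl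
  have hexp : lineExp (residualForm f₁ f₂ y) q p =
      Polynomial.C (eval p (residualForm f₁ f₂ y)) * Polynomial.X ^ m := by
    ext j
    rw [Polynomial.coeff_C_mul_X_pow]
    split_ifs with hj
    · rw [hj, lineExp_coeff_top hG]; rfl
    · rcases Nat.lt_or_ge m j with h | h
      · exact Polynomial.coeff_eq_zero_of_natDegree_lt ((lineExp_natDegree_le hG q p).trans_lt h)
      · have hjm : j < m := lt_of_le_of_ne h hj
        rcases Nat.lt_or_ge j 2 with h2 | h2
        · interval_cases j
          · rw [hL, lineExp_coeff_zero]; exact hq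
          · rw [hL, lineExp_coeff_one, hpp, dirDeriv_axisPoint]
        · obtain ⟨g, hg⟩ := hdvd j h2 hjm
          rw [hcoef, hg, map_mul, hq, zero_mul]
  refine ⟨hq2, hp2, ?_, htop ▸ hP, fun s => ?_⟩
  · have h1 := dirDeriv_residual hfd y (u := q) (v := Pi.single 0 1) hq2 (by simp)
    rw [← lineExp_coeff_one, ← residualExp_eq_lineExp, ← eval_pderiv_eq_coeff_residualExp] at h1
    rw [h1]
    simpa using hw
  · rw [← lineExp_eval_field, hexp, Polynomial.eval_mul, Polynomial.eval_C, Polynomial.eval_pow,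
      Polynomial.eval_X, mul_comm]

lemma eq_zero_of_card_fibre [Infinite k] {h : MvPolynomial (Fin 3) k} {e : ℕ}
    (hh : h.IsHomogeneous e) (he : e < m) {Z : Set k} (hZ : Z.Finite)
    (hW : ∀ z ∉ Z, ∃ W : Finset k, W.card = m ∧ ∀ w ∈ W, eval ![w, z, 1] h = 0) : h = 0 := by
  have h1 : ∀ z ∉ Z, ∀ w, eval ![w, z, 1] h = 0 := by
    intro z hz w
    obtain ⟨W, hWm, hW⟩ := hW z hz
    have hpt : ∀ t : k, (![0, z, 1] : Fin 3 → k) + t • ![1, 0, 0] = ![t, z, 1] := by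
      intro t; ext i; fin_cases i <;> simp
    have h0 : lineExp h ![0, z, 1] ![1, 0, 0] = 0 := by
      refine Polynomial.eq_zero_of_natDegree_lt_card_of_eval_eq_zero' _ W (fun w hw => ?_)
        ((lineExp_natDegree_le hh _ _).trans_lt (by omega))
      rw [lineExp_eval_field, hpt, hW w hw]
    rw [← hpt w, ← lineExp_eval_field, h0, Polynomial.eval_zero]
  by_contra hne
  obtain ⟨v, hv⟩ := exists_eval_ne_zero_of_ne_zero (mul_ne_zero hne (X_ne_zero (2 : Fin 3)))
  rw [map_mul, eval_X] at hv
  have hv2 := right_ne_zero_of_mul hv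
  have hv' : eval ((v 2)⁻¹ • v + (0 : k) • ![0, 1, 0]) h ≠ 0 := by
    rw [zero_smul, add_zero, IsHomogeneous.eval_smul hh]
    exact mul_ne_zero (pow_ne_zero _ (inv_ne_zero hv2)) (left_ne_zero_of_mul hv)
  have hfin := finite_eval_line_eq_zero h ((v 2)⁻¹ • v) ![0, 1, 0] hv'
  refine Set.infinite_univ (((hfin.union (hZ.image fun z => z - (v 2)⁻¹ * v 1))).subset ?_)
  intro t _
  by_cases ht : t + (v 2)⁻¹ * v 1 ∈ Z
  · exact Or.inr ⟨_, ht, by ring⟩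
  · refine Or.inl ?_
    have : (v 2)⁻¹ • v + t • ![0, 1, 0] = ![(v 2)⁻¹ * v 0, t + (v 2)⁻¹ * v 1, 1] := by
      ext i; fin_cases i <;> simp [hv2]
      ring
    change eval _ h = 0
    rw [this]
    exact h1 _ ht _

end PlaneSections

section StrangeSection

variable {k : Type*} [Field k] {f f₁ f₂ : MvPolynomial (Fin 4) k} {m : ℕ}

/-- General plane sections residual to the axis are strange curves. -/
lemma exists_strange_point_residual [IsAlgClosed k] (hf : IsSmoothSurface f (m + 1))
    (hf₁ : f₁.IsHomogeneous m) (hf₂ : f₂.IsHomogeneous m) (hfd : f = X 2 * f₁ + X 3 * f₂)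
    (hm : 2 ≤ m) (hmk : (m : k) = 0) (hw : ¬ f ∣ pderiv 0 f)
    (hdvd : ∀ j, 2 ≤ j → j < m → f ∣ axisForm f j) (hP : ¬ f ∣ axisForm f m) :
    ∃ Y : Set k, Y.Finite ∧ ∀ y ∉ Y, ∃ c : Fin 3 → k, c ≠ 0 ∧
      eval c (residualForm f₁ f₂ y) ≠ 0 ∧
      (∀ j, 1 ≤ j → j < m → ∀ v, (lineExp (residualForm f₁ f₂ y) v c).coeff j = 0) ∧
      ∃ q₁ q₂, q₁ 2 = 1 ∧ q₂ 2 = 1 ∧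
        crossGradient (fun i => eval q₁ (pderiv i (residualForm f₁ f₂ y)))
          (fun i => eval q₂ (pderiv i (residualForm f₁ f₂ y))) ≠ 0 := by
  have hL : ∀ v : Fin 4 → k, v 2 = 0 → v 3 = 0 → eval v f = 0 := by
    intro v h2 h3
    rw [hfd]; simp [h2, h3]
  have hfp := hf.prime (by omega)
  obtain ⟨Y, hY, hYZ⟩ := exists_card_fibre hf hL
    ((hf.2.1.pderiv (i := 0)).mul (axisForm_isHomogeneous hf.2.1 (j := m) (by omega)))
    (fun h => (hfp.dvd_or_dvd h).elim hw hP) (fun v _ h => by rw [map_mul, h, zero_mul])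
  refine ⟨Y, hY, fun y hy => ?_⟩
  obtain ⟨Z, hZ, hZW⟩ := hYZ y hy
  have hpt : ∀ w z : k, planePoint y ![w, z, 1] = ![w, z, 1, y] := by
    intro w z; simp [planePoint]
  set Q : Set (Fin 3 → k) := {q | q 2 = 1 ∧ eval (planePoint y q) f = 0 ∧
    eval (planePoint y q) (pderiv 0 f * axisForm f m) ≠ 0} with hQdef
  have hmem : ∀ z ∉ Z, ∃ W : Finset k, W.card = m ∧ ∀ w ∈ W, ![w, z, 1] ∈ Q := by
    intro z hz
    obtain ⟨W, hWm, hW⟩ := hZW z hz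
    refine ⟨W, hWm, fun w hw => ⟨rfl, ?_⟩⟩
    rw [hpt]
    exact hW w hw
  have hQ : Q.Infinite := by
    intro hfin
    refine Set.infinite_univ ((hZ.union (hfin.image fun q => q 1)).subset fun z _ => ?_)
    by_cases hz : z ∈ Z
    · exact Or.inl hz
    · obtain ⟨W, hWm, hW⟩ := hmem z hz
      obtain ⟨w, hw⟩ : W.Nonempty := Finset.card_pos.1 (by omega)
      exact Or.inr ⟨_, hW w hw, rfl⟩
  refine exists_strange_point (residual_isHomogeneous hf₁ hf₂ y) (by omega) hmk hQ
    (p := fun q => ![-eval (planePoint y q) (pderiv 1 f), eval (planePoint y q) (pderiv 0 f), 0])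
    (fun q hq => ?_) (fun h e hh he hqh => ?_)
  · have := hq.2.2
    rw [map_mul] at this
    exact isAsymptotic_residual hf₁ hf₂ hfd hdvd hq.1 hq.2.1 (left_ne_zero_of_mul this)
      (right_ne_zero_of_mul this)
  · refine eq_zero_of_card_fibre hh he hZ fun z hz => ?_
    obtain ⟨W, hWm, hW⟩ := hmem z hz
    exact ⟨W, hWm, fun w hw => hqh _ (hW w hw)⟩

lemma Polynomial.eq_zero_of_eval_eq_zero_of_finite [Infinite k] {P : Polynomial k} {Y : Set k}
    (hY : Y.Finite) (h : ∀ y ∉ Y, P.eval y = 0) : P = 0 :=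
  Polynomial.eq_zero_of_infinite_isRoot P (hY.infinite_compl.mono fun y hy => h y hy)

lemma eval_residualExp_coeff (u : Fin 3 → k) (v : Fin 3 → Polynomial k) (j : ℕ) (y : k) :
    ((residualExp f₁ f₂ (Polynomial.X : Polynomial k) (fun i => Polynomial.C (u i)) v).coeff
      j).eval y = (residualExp f₁ f₂ y u (fun i => (v i).eval y)).coeff j := by
  have := residualExp_coeff_map (f₁ := f₁) (f₂ := f₂) (Polynomial.X : Polynomial k)
    (fun i => Polynomial.C (u i)) v (Polynomial.aeval y : Polynomial k →ₐ[k] k) j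
  simpa [Polynomial.coe_aeval_eq_eval] using this

/-- The strange points form a section of the pencil of planes through the axis. -/
lemma exists_strange_section [IsAlgClosed k] (hf : IsSmoothSurface f (m + 1))
    (hf₁ : f₁.IsHomogeneous m) (hf₂ : f₂.IsHomogeneous m) (hfd : f = X 2 * f₁ + X 3 * f₂)
    (hm : 2 ≤ m) (hmk : (m : k) = 0) (hw : ¬ f ∣ pderiv 0 f)
    (hdvd : ∀ j, 2 ≤ j → j < m → f ∣ axisForm f j) (hP : ¬ f ∣ axisForm f m) :
    ∃ c : Fin 3 → Polynomial k, (∀ y, (fun i => (c i).eval y) ≠ 0) ∧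
      (∀ y j, 1 ≤ j → j < m → ∀ v,
        (lineExp (residualForm f₁ f₂ y) v (fun i => (c i).eval y)).coeff j = 0) ∧
      ∃ y, eval (fun i => (c i).eval y) (residualForm f₁ f₂ y) ≠ 0 := by
  obtain ⟨Y, hY, hs⟩ := exists_strange_point_residual hf hf₁ hf₂ hfd hm hmk hw hdvd hP
  obtain ⟨y₀, hy₀⟩ := hY.infinite_compl.nonempty
  obtain ⟨c₀, hc₀, hGc₀, hco₀, q₁, q₂, hq₁, hq₂, hne⟩ := hs y₀ hy₀
  set χ : Fin 3 → Polynomial k := crossGradient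
    (fun i => (residualExp f₁ f₂ (Polynomial.X : Polynomial k) (fun i => Polynomial.C (q₁ i))
      (Pi.single i 1)).coeff 1)
    (fun i => (residualExp f₁ f₂ (Polynomial.X : Polynomial k) (fun i => Polynomial.C (q₂ i))
      (Pi.single i 1)).coeff 1) with hχ
  have hχe : ∀ y, (fun i => (χ i).eval y) =
      crossGradient (fun i => eval q₁ (pderiv i (residualForm f₁ f₂ y)))
          (fun i => eval q₂ (pderiv i (residualForm f₁ f₂ y))) := by
    intro y
    have h : ∀ q i, eval q (pderiv i (residualForm f₁ f₂ y)) =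
        ((residualExp f₁ f₂ (Polynomial.X : Polynomial k) (fun i => Polynomial.C (q i))
          (Pi.single i 1)).coeff 1).eval y := by
      intro q i
      rw [eval_pderiv_eq_coeff_residualExp, eval_residualExp_coeff]
      congr 3
      funext i'
      by_cases hi : i' = i
      · subst hi; simp
      · simp [Pi.single_eq_of_ne hi]
    simp only [h]
    funext i
    fin_cases i <;> simp [hχ, crossGradient]
  have hχ0 : (fun i => (χ i).eval y₀) ≠ 0 := by rw [hχe]; exact hne
  have hsmul : ∀ y ∉ Y, ∀ c : Fin 3 → k, c ≠ 0 →
      (∀ j, 1 ≤ j → j < m → ∀ v, (lineExp (residualForm f₁ f₂ y) v c).coeff j = 0) →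
      ∃ s : k, s • c = fun i => (χ i).eval y := by
    intro y _ c hc hco
    rw [hχe]
    have h : ∀ q, eval q (pderiv 0 (residualForm f₁ f₂ y)) * c 0 +
        eval q (pderiv 1 (residualForm f₁ f₂ y)) * c 1 +
        eval q (pderiv 2 (residualForm f₁ f₂ y)) * c 2 = 0 := by
      intro q
      have h1 := hco 1 le_rfl (by omega) q
      rw [lineExp_coeff_one, dirDeriv, Fin.sum_univ_three] at h1
      rw [← h1]
      simp only [mul_comm]
      rfl
    exact exists_smul_eq_crossGradient hc (h q₁) (h q₂)
  have hχco : ∀ j, 1 ≤ j → j < m → ∀ v : Fin 3 → k,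
      (residualExp f₁ f₂ (Polynomial.X : Polynomial k) (fun i => Polynomial.C (v i)) χ).coeff
        j = 0 := by
    intro j hj hjm v
    refine Polynomial.eq_zero_of_eval_eq_zero_of_finite hY fun y hy => ?_
    obtain ⟨c, hc, -, hco, -⟩ := hs y hy
    obtain ⟨s, hsc⟩ := hsmul y hy c hc hco
    rw [eval_residualExp_coeff, ← hsc, residualExp_coeff_smul_right, residualExp_eq_lineExp,
      hco j hj hjm, mul_zero]
  set I : Ideal (Polynomial k) := Ideal.span (Set.range χ) with hI
  set δ := Submodule.IsPrincipal.generator I with hδ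
  have hIδ : I = Ideal.span {δ} := (Ideal.span_singleton_generator I).symm
  have hdiv : ∀ i, δ ∣ χ i := fun i => by
    rw [← Ideal.mem_span_singleton, ← hIδ]
    exact Ideal.subset_span ⟨i, rfl⟩
  choose c hc using hdiv
  have hχc : χ = δ • c := funext hc
  have hδ0 : δ ≠ 0 := by
    intro h0
    refine hχ0 (funext fun i => ?_)
    rw [hc i, h0, zero_mul]
    simp
  have hδ₀ : δ.eval y₀ ≠ 0 := by
    intro h0
    refine hχ0 (funext fun i => ?_)
    rw [hc i, Polynomial.eval_mul, h0, zero_mul]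
    rfl
  refine ⟨c, fun y h0 => ?_, fun y j hj hjm v => ?_, y₀, ?_⟩
  · obtain ⟨b, hb⟩ := (Ideal.mem_span_range_iff_exists_fun (R := Polynomial k)).1
      (show δ ∈ Ideal.span (Set.range χ) by
        rw [← hI, hIδ]; exact Ideal.mem_span_singleton_self δ)
    have h1 : δ * (∑ i, b i * c i) = δ * 1 := by
      rw [mul_one, Finset.mul_sum]
      refine (Finset.sum_congr rfl fun i _ => ?_).trans hb
      rw [hc i]; ring
    have h2 := congrArg (Polynomial.eval y) (mul_left_cancel₀ hδ0 h1)
    rw [Polynomial.eval_finsetSum, Finset.sum_eq_zero fun i _ => ?_, Polynomial.eval_one] at h2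
    · exact zero_ne_one h2
    · rw [Polynomial.eval_mul, congrFun h0 i]
      exact mul_zero _
  · have h := hχco j hj hjm v
    rw [hχc, residualExp_coeff_smul_right] at h
    have h1 := (mul_eq_zero.1 h).resolve_left (pow_ne_zero _ hδ0)
    rw [← residualExp_eq_lineExp, ← eval_residualExp_coeff, h1, Polynomial.eval_zero]
  · obtain ⟨s, hsc⟩ := hsmul y₀ hy₀ c₀ hc₀ hco₀
    intro h0
    have hs0 : s ≠ 0 := by
      rintro rfl
      exact hχ0 (by rw [← hsc, zero_smul])
    have h1 : c₀ = (s⁻¹ * δ.eval y₀) • fun i => (c i).eval y₀ := by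
      rw [mul_smul, eq_inv_smul_iff₀ hs0, hsc]
      funext i
      rw [hc i, Polynomial.eval_mul]
      rfl
    apply hGc₀
    rw [h1, IsHomogeneous.eval_smul (residual_isHomogeneous hf₁ hf₂ y₀), h0, mul_zero]

end StrangeSection

section DegreeBound

variable {k : Type*} [Field k] {f f₁ f₂ P Q : MvPolynomial (Fin 4) k} {m : ℕ}

lemma exists_affine_point_ne_zero [Infinite k] (hP : P.IsHomogeneous m) (hP0 : P ≠ 0)
    {a b : Polynomial k} (hab : ¬ (a = 0 ∧ b = 0)) :
    ∃ w z y : k, eval ![w, z, 1, y] P ≠ 0 ∧ a.eval y - b.eval y * z ≠ 0 := by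
  set P' : MvPolynomial (Fin 4) k := aeval ![X 0, X 1, 1, X 3] P with hP'
  set T : MvPolynomial (Fin 4) k := Polynomial.aeval (X 3) a - Polynomial.aeval (X 3) b * X 1
    with hT
  have hPe : ∀ v, eval v P' = eval ![v 0, v 1, 1, v 3] P := by
    intro v
    rw [hP', ← coe_aeval_eq_eval, RingHom.coe_coe, ← AlgHom.comp_apply, comp_aeval]
    have : (fun i => (aeval v : MvPolynomial (Fin 4) k →ₐ[k] k)
        ((![X 0, X 1, 1, X 3] : Fin 4 → MvPolynomial (Fin 4) k) i)) = ![v 0, v 1, 1, v 3] := by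
      funext i; fin_cases i <;> simp
    rw [this]; rfl
  have haux : ∀ (p : Polynomial k) (v : Fin 4 → k),
      eval v (Polynomial.aeval (X 3 : MvPolynomial (Fin 4) k) p) = p.eval (v 3) := by
    intro p v
    have := Polynomial.aeval_algHom_apply (aeval v : MvPolynomial (Fin 4) k →ₐ[k] k) (X 3) p
    rw [aeval_X] at this
    exact this.symm
  have hTe : ∀ v, eval v T = a.eval (v 3) - b.eval (v 3) * v 1 := by
    intro v
    rw [hT, map_sub, map_mul, eval_X, haux, haux]
  have hP'0 : P' ≠ 0 := by
    obtain ⟨v, hv⟩ := exists_eval_ne_zero_of_ne_zero (mul_ne_zero hP0 (X_ne_zero (2 : Fin 4)))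
    rw [map_mul, eval_X] at hv
    have hv2 := right_ne_zero_of_mul hv
    intro h0
    have h1 := hPe ((v 2)⁻¹ • v)
    have h2 : ![((v 2)⁻¹ • v) 0, ((v 2)⁻¹ • v) 1, 1, ((v 2)⁻¹ • v) 3] = (v 2)⁻¹ • v := by
      ext i; fin_cases i <;> simp [hv2]
    rw [h0, map_zero, h2, IsHomogeneous.eval_smul hP] at h1
    exact mul_ne_zero (pow_ne_zero _ (inv_ne_zero hv2)) (left_ne_zero_of_mul hv) h1.symm
  have hT0 : T ≠ 0 := by
    intro h0
    have h1 : ∀ y z, a.eval y - b.eval y * z = 0 := fun y z => by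
      simpa [h0] using (hTe ![0, z, 0, y]).symm
    have h2 : a = 0 := Polynomial.funext fun y => by simpa using h1 y 0
    refine hab ⟨h2, Polynomial.funext fun y => ?_⟩
    simpa [h2] using h1 y 1
  obtain ⟨v, hv⟩ := exists_eval_ne_zero_of_ne_zero (mul_ne_zero hP'0 hT0)
  rw [map_mul, hPe, hTe] at hv
  exact ⟨v 0, v 1, v 3, left_ne_zero_of_mul hv, right_ne_zero_of_mul hv⟩

lemma natDegree_le_of_syzygy [IsAlgClosed k] (hP : P.IsHomogeneous m) (hP0 : P ≠ 0)
    {a b c : Polynomial k} (habc : ∀ y, ¬ (a.eval y = 0 ∧ b.eval y = 0 ∧ c.eval y = 0))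
    (h : ∀ w z y : k, (b.eval y - c.eval y * z) * eval ![w, z, 1, y] Q +
      (a.eval y - c.eval y * w) * eval ![w, z, 1, y] P = 0) :
    b.natDegree ≤ m ∧ (Polynomial.X * c).natDegree ≤ m := by
  by_cases hbc : b = 0 ∧ c = 0
  · simp [hbc.1, hbc.2]
  obtain ⟨w₀, z₀, y₀, hP₀, hT₀⟩ := exists_affine_point_ne_zero hP hP0 hbc
  have key : ∀ z₁ : k, (b - c * (Polynomial.C z₀ +
      Polynomial.C z₁ * (Polynomial.X - Polynomial.C y₀))).natDegree ≤ m := by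
    intro z₁
    set e₁ := b - c * (Polynomial.C z₀ + Polynomial.C z₁ * (Polynomial.X - Polynomial.C y₀))
      with he₁
    have he₁e : ∀ y, e₁.eval y = b.eval y - c.eval y * (z₀ + z₁ * (y - y₀)) := by
      intro y; simp [he₁]
    have he₁0 : e₁.eval y₀ ≠ 0 := by
      rw [he₁e]; simpa using hT₀
    have he₁ne : e₁ ≠ 0 := by
      rintro h0; rw [h0] at he₁0; simp at he₁0
    obtain ⟨w₁, hw₁⟩ := ((Polynomial.finite_setOfPred_isRoot he₁ne).image
      fun y => (a.eval y / c.eval y - w₀) / (y - y₀)).infinite_compl.nonempty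
    set e₀ := a - c * (Polynomial.C w₀ + Polynomial.C w₁ * (Polynomial.X - Polynomial.C y₀))
      with he₀
    have he₀e : ∀ y, e₀.eval y = a.eval y - c.eval y * (w₀ + w₁ * (y - y₀)) := by
      intro y; simp [he₀]
    have hcop : IsCoprime e₁ e₀ := by
      rw [Polynomial.isCoprime_iff_aeval_ne_zero_of_isAlgClosed k k]
      intro y
      by_contra! hy
      rw [Polynomial.coe_aeval_eq_eval, he₀e] at hy
      obtain ⟨h1, h0⟩ := hy
      have hyy : y - y₀ ≠ 0 := by
        intro h2
        rw [sub_eq_zero] at h2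
        exact he₁0 (h2 ▸ h1)
      have h1' := h1
      rw [he₁e] at h1'
      have hc : c.eval y ≠ 0 := by
        intro hc
        rw [hc] at h0 h1'
        exact habc y ⟨by simpa using h0, by simpa using h1', hc⟩
      refine hw₁ ⟨y, h1, ?_⟩
      field_simp
      linear_combination h0
    set u : Fin 4 → k := ![w₀ - w₁ * y₀, z₀ - z₁ * y₀, 1, 0]
    set v : Fin 4 → k := ![w₁, z₁, 0, 1]
    have hpt : ∀ y : k, u + y • v = ![w₀ + w₁ * (y - y₀), z₀ + z₁ * (y - y₀), 1, y] := by
      intro y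
      ext i; fin_cases i <;> simp [u, v] <;> ring
    have hid : e₁ * lineExp Q u v + e₀ * lineExp P u v = 0 := by
      refine Polynomial.funext fun y => ?_
      rw [Polynomial.eval_add, Polynomial.eval_mul, Polynomial.eval_mul, lineExp_eval_field,
        lineExp_eval_field, hpt, he₁e, he₀e, h, Polynomial.eval_zero]
    have hne : lineExp P u v ≠ 0 := by
      intro h0
      apply hP₀
      have := lineExp_eval_field P u v y₀
      rw [h0, hpt] at this
      simpa using this.symm
    have hdvd : e₁ ∣ lineExp P u v := by
      refine hcop.dvd_of_dvd_mul_left ⟨-lineExp Q u v, ?_⟩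
      linear_combination hid
    exact (Polynomial.natDegree_le_of_dvd hdvd hne).trans (lineExp_natDegree_le hP u v)
  have k0 := key 0
  have k1 := key 1
  rw [Polynomial.C_0, zero_mul, add_zero] at k0
  rw [Polynomial.C_1, one_mul] at k1
  have hc : (c * (Polynomial.X - Polynomial.C y₀)).natDegree ≤ m := by
    have : c * (Polynomial.X - Polynomial.C y₀) = (b - c * Polynomial.C z₀) -
      (b - c * (Polynomial.C z₀ + (Polynomial.X - Polynomial.C y₀))) := by ring
    rw [this]
    exact (Polynomial.natDegree_sub_le _ _).trans (max_le k0 k1)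
  have hcX : (Polynomial.X * c).natDegree ≤ m := by
    by_cases hc0 : c = 0
    · simp [hc0]
    · rw [Polynomial.natDegree_mul hc0 (Polynomial.X_sub_C_ne_zero _),
        Polynomial.natDegree_X_sub_C] at hc
      rwa [Polynomial.natDegree_mul Polynomial.X_ne_zero hc0, Polynomial.natDegree_X, add_comm]
  refine ⟨?_, hcX⟩
  have hcm : c.natDegree ≤ m := by
    by_cases hc0 : c = 0
    · simp [hc0]
    · rw [Polynomial.natDegree_mul Polynomial.X_ne_zero hc0] at hcX
      omega
  have : b = (b - c * Polynomial.C z₀) + c * Polynomial.C z₀ := by ring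
  rw [this]
  exact (Polynomial.natDegree_add_le _ _).trans
    (max_le k0 ((Polynomial.natDegree_mul_C_le _ _).trans hcm))

/-- The section of strange points has small degree. -/
lemma natDegree_strange_section_le [IsAlgClosed k] (hf : f.IsHomogeneous (m + 1))
    (hf₁ : f₁.IsHomogeneous m) (hf₂ : f₂.IsHomogeneous m) (hfd : f = X 2 * f₁ + X 3 * f₂)
    (hmk : (m : k) = 0) (hw : pderiv 0 f ≠ 0) {c : Fin 3 → Polynomial k}
    (hc : ∀ y, (fun i => (c i).eval y) ≠ 0)
    (hco : ∀ y v, dirDeriv (residualForm f₁ f₂ y) v (fun i => (c i).eval y) = 0) :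
    (c 0).natDegree ≤ m ∧ (c 1).natDegree ≤ m ∧ (Polynomial.X * c 2).natDegree ≤ m := by
  have hsyz : ∀ w z y : k,
      ((c 1).eval y - (c 2).eval y * z) * eval ![w, z, 1, y] (pderiv 1 f) +
      ((c 0).eval y - (c 2).eval y * w) * eval ![w, z, 1, y] (pderiv 0 f) = 0 := by
    intro w z y
    set v : Fin 3 → k := ![w, z, 1] with hv
    have hself : dirDeriv (residualForm f₁ f₂ y) v v = 0 := by
      have := (residual_isHomogeneous hf₁ hf₂ y).sum_X_mul_pderiv
      have := congrArg (eval v) this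
      rw [map_sum, map_nsmul, nsmul_eq_mul, hmk, zero_mul] at this
      simpa [dirDeriv] using this
    have h1 := dirDeriv_residual hfd y (u := v)
      (v := (fun i => (c i).eval y) - (c 2).eval y • v) rfl (by simp [hv])
    have h2 : dirDeriv (residualForm f₁ f₂ y) v
        ((fun i => (c i).eval y) - (c 2).eval y • v) = 0 := by
      have : dirDeriv (residualForm f₁ f₂ y) v ((fun i => (c i).eval y) - (c 2).eval y • v) =
          dirDeriv (residualForm f₁ f₂ y) v (fun i => (c i).eval y) -
            (c 2).eval y * dirDeriv (residualForm f₁ f₂ y) v v := by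
        simp only [dirDeriv, Finset.mul_sum, ← Finset.sum_sub_distrib, Pi.sub_apply,
          Pi.smul_apply, smul_eq_mul]
        exact Finset.sum_congr rfl fun i _ => by ring
      rw [this, hco, hself, mul_zero, sub_zero]
    rw [h2] at h1
    have h3 : planePoint y v = ![w, z, 1, y] := by simp [planePoint, hv]
    rw [h3] at h1
    simp only [Pi.sub_apply, Pi.smul_apply, smul_eq_mul, hv, Matrix.cons_val] at h1
    linear_combination -h1
  have hcom : ∀ y, ¬ ((c 0).eval y = 0 ∧ (c 1).eval y = 0 ∧ (c 2).eval y = 0) := by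
    rintro y ⟨h0, h1, h2⟩
    exact hc y (funext fun i => by fin_cases i <;> assumption)
  have hswap : ∀ (g : MvPolynomial (Fin 4) k) (w z y : k),
      eval ![w, z, 1, y] (rename (Equiv.swap 0 1) g) = eval ![z, w, 1, y] g := by
    intro g w z y
    rw [eval_rename]
    congr 2
    funext i; fin_cases i <;> rfl
  have hinj : Function.Injective
      (rename (Equiv.swap (0 : Fin 4) 1) : MvPolynomial (Fin 4) k → MvPolynomial (Fin 4) k) :=
    rename_injective _ (Equiv.injective _)
  obtain ⟨h1, h2⟩ := natDegree_le_of_syzygy (m := m) (hf.pderiv (i := 0)) hw hcom hsyz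
  refine ⟨?_, h1, h2⟩
  by_cases hz : pderiv 1 f = 0
  · by_cases hc0 : c 0 = 0
    · simp [hc0]
    obtain ⟨w, z, y, hP, hT⟩ := exists_affine_point_ne_zero (a := c 0) (b := c 2)
      ((hf.pderiv (i := 0)).rename_isHomogeneous (f := Equiv.swap 0 1))
      ((map_ne_zero_iff _ hinj).2 hw) (fun h => hc0 h.1)
    rw [hswap] at hP
    have := hsyz z w y
    rw [hz, map_zero, mul_zero, zero_add] at this
    exact absurd this (mul_ne_zero hT hP)
  · refine (natDegree_le_of_syzygy (m := m) (a := c 1) (c := c 2)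
      (Q := rename (Equiv.swap 0 1) (pderiv 0 f))
      ((hf.pderiv (i := 1)).rename_isHomogeneous (f := Equiv.swap 0 1))
      ((map_ne_zero_iff _ hinj).2 hz) (fun y h => hcom y ⟨h.2.1, h.1, h.2.2⟩) ?_).1
    intro w z y
    rw [hswap, hswap]
    linear_combination hsyz z w y

end DegreeBound

section Pencil

variable {k : Type*} [Field k] {f f₁ f₂ : MvPolynomial (Fin 4) k} {m : ℕ}

lemma finrank_axis_le : Module.finrank k (axis k) ≤ 2 := by
  classical
  have h : axis k = Submodule.span k
      (({Pi.single 0 1, Pi.single 1 1} : Finset (Fin 4 → k)) : Set (Fin 4 → k)) := by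
    refine le_antisymm (fun v hv => ?_) ?_
    · rw [Finset.coe_insert, Finset.coe_singleton]
      refine Submodule.mem_span_pair.2 ⟨v 0, v 1, ?_⟩
      ext i; fin_cases i <;> simp [hv.1, hv.2]
    · rw [Submodule.span_le]
      intro v hv
      rw [Finset.coe_insert, Finset.coe_singleton] at hv
      rcases hv with rfl | rfl <;> simp [mem_axis]
  rw [h]
  exact (finrank_span_finset_le_card _).trans Finset.card_le_two

/-- The planes through the axis other than `X₂ = 0`. -/
def pencilPlane (y : k) : Submodule k (Fin 4 → k) :=
  LinearMap.ker (LinearMap.proj 3 - y • LinearMap.proj 2 : (Fin 4 → k) →ₗ[k] k)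

lemma mem_pencilPlane {y : k} {v : Fin 4 → k} : v ∈ pencilPlane y ↔ v 3 = y * v 2 := by
  simp [pencilPlane, sub_eq_zero]

lemma finrank_pencilPlane (y : k) : Module.finrank k (pencilPlane y) = 3 := by
  have h : (LinearMap.proj 3 - y • LinearMap.proj 2 : Module.Dual k (Fin 4 → k)) ≠ 0 := by
    intro h
    have := LinearMap.congr_fun h (Pi.single 3 1)
    simp at this
  have := Module.Dual.finrank_ker_add_one_of_ne_zero h
  rw [Module.finrank_fin_fun] at this
  exact Nat.succ.inj this

lemma planePoint_castSucc {y : k} {v : Fin 4 → k} (hv : v ∈ pencilPlane y) :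
    planePoint y (v ∘ Fin.castSucc) = v := by
  funext i
  fin_cases i
  · rfl
  · rfl
  · rfl
  · exact (mem_pencilPlane.1 hv).symm

lemma planePoint_mem (y : k) (v : Fin 3 → k) : planePoint y v ∈ pencilPlane y :=
  mem_pencilPlane.2 rfl

lemma exists_mem_apply_eq_one {M : Submodule k (Fin 4 → k)} {y : k}
    (hM : Module.finrank k M = 2) (hne : M ≠ axis k) (hMy : M ≤ pencilPlane y) :
    ∃ q ∈ M, q 2 = 1 := by
  by_contra! h
  refine hne (Submodule.eq_of_le_of_finrank_le (fun v hv => ?_) (hM ▸ finrank_axis_le))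
  have h2 : v 2 = 0 := by
    by_contra h2
    exact h ((v 2)⁻¹ • v) (M.smul_mem _ hv) (by simp [h2])
  exact ⟨h2, by rw [mem_pencilPlane.1 (hMy hv), h2, mul_zero]⟩

lemma eval_residual_eq_zero [Infinite k] (hfd : f = X 2 * f₁ + X 3 * f₂)
    {M : Submodule k (Fin 4 → k)} {y : k} (hM : IsLineOn f M) (hne : M ≠ axis k)
    (hMy : M ≤ pencilPlane y) {v : Fin 4 → k} (hv : v ∈ M) :
    eval (v ∘ Fin.castSucc) (residualForm f₁ f₂ y) = 0 := by
  obtain ⟨q, hq, hq2⟩ := exists_mem_apply_eq_one hM.1 hne hMy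
  have h : (Polynomial.X + Polynomial.C (v 2)) *
      lineExp (residualForm f₁ f₂ y) (v ∘ Fin.castSucc) (q ∘ Fin.castSucc) = 0 := by
    refine Polynomial.funext fun s => ?_
    have hvs := M.add_mem hv (M.smul_mem s hq)
    have h1 := hM.2 _ hvs
    rw [← planePoint_castSucc (hMy hvs), eval_planePoint hfd] at h1
    rw [Polynomial.eval_mul, lineExp_eval_field, Polynomial.eval_zero, ← h1, Polynomial.eval_add,
      Polynomial.eval_X, Polynomial.eval_C]
    congr 1
    simp [hq2, add_comm]
  have h0 := (mul_eq_zero.1 h).resolve_left (Polynomial.X_add_C_ne_zero _)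
  have := lineExp_eval_field (residualForm f₁ f₂ y) (v ∘ Fin.castSucc) (q ∘ Fin.castSucc) 0
  rw [h0, zero_smul, add_zero, Polynomial.eval_zero] at this
  exact this.symm

lemma splitsOn_pencilPlane (hfd : f = X 2 * f₁ + X 3 * f₂) {y : k} {n : ℕ} (C₀ : k)
    (ℓ : Fin n → Module.Dual k (Fin 4 → k))
    (h : ∀ v : Fin 3 → k, eval v (residualForm f₁ f₂ y) = C₀ * ∏ i, ℓ i (planePoint y v)) :
    SplitsOn f (pencilPlane y) (n + 1) := by
  refine ⟨C₀, Fin.cons (LinearMap.proj 2) ℓ, fun v hv => ?_⟩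
  rw [Fin.prod_univ_succ]
  simp only [Fin.cons_zero, Fin.cons_succ]
  have h1 := eval_planePoint hfd y (v ∘ Fin.castSucc)
  rw [h, planePoint_castSucc hv] at h1
  rw [h1]
  change v 2 * _ = C₀ * (v 2 * _)
  ring

open Classical in
lemma Polynomial.exists_homogenization_factors [IsAlgClosed k] (m : ℕ) (p : Polynomial k)
    (hp : p.natDegree ≤ m) : ∃ (c : k) (ℓ : Fin m → k × k), ∀ a b : k,
      c * ∏ i, ((ℓ i).1 * a + (ℓ i).2 * b) =
        if a = 0 then p.coeff m * b ^ m else a ^ m * p.eval (b / a) := by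
  induction m generalizing p with
  | zero =>
    refine ⟨p.coeff 0, Fin.elim0, fun a b => ?_⟩
    rw [Polynomial.eq_C_of_natDegree_le_zero hp]
    simp
  | succ m ih =>
    by_cases h0 : p.natDegree ≤ m
    · obtain ⟨c, ℓ, h⟩ := ih p h0
      refine ⟨c, Fin.cons (1, 0) ℓ, fun a b => ?_⟩
      rw [Fin.prod_univ_succ]
      simp only [Fin.cons_zero, Fin.cons_succ]
      rw [mul_left_comm, h, Polynomial.coeff_eq_zero_of_natDegree_lt (p := p) (n := m + 1) (by omega)]
      split_ifs with ha
      · simp [ha]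
      · ring
    · obtain ⟨r, hr⟩ := IsAlgClosed.exists_root p
        (fun hd => h0 ((Polynomial.natDegree_eq_of_degree_eq_some hd).trans_le (Nat.zero_le m)))
      obtain ⟨q, rfl⟩ := Polynomial.dvd_iff_isRoot.2 hr
      have hq0 : q ≠ 0 := by rintro rfl; simp at h0
      rw [Polynomial.natDegree_mul (Polynomial.X_sub_C_ne_zero r) hq0,
        Polynomial.natDegree_X_sub_C] at hp
      obtain ⟨c, ℓ, h⟩ := ih q (by omega)
      refine ⟨c, Fin.cons (-r, 1) ℓ, fun a b => ?_⟩
      rw [Fin.prod_univ_succ]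
      simp only [Fin.cons_zero, Fin.cons_succ]
      rw [mul_left_comm, h, sub_mul, Polynomial.coeff_sub, Polynomial.coeff_X_mul,
        Polynomial.coeff_C_mul, Polynomial.coeff_eq_zero_of_natDegree_lt (p := q) (n := m + 1)
        (by omega)]
      split_ifs with ha
      · rw [ha]; ring
      · simp only [Polynomial.eval_sub, Polynomial.eval_mul, Polynomial.eval_X, Polynomial.eval_C]
        field_simp
        ring

/-- Binary forms factor into linear forms. -/
lemma exists_binary_factors [IsAlgClosed k] {σ : Type*} {g : MvPolynomial σ k}
    (hg : g.IsHomogeneous m) (u v : σ → k) : ∃ (c : k) (ℓ : Fin m → k × k), ∀ a b : k,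
      eval (a • u + b • v) g = c * ∏ i, ((ℓ i).1 * a + (ℓ i).2 * b) := by
  obtain ⟨c, ℓ, h⟩ := Polynomial.exists_homogenization_factors m (lineExp g u v)
    (lineExp_natDegree_le hg u v)
  refine ⟨c, ℓ, fun a b => ?_⟩
  rw [h]
  split_ifs with ha
  · rw [ha, zero_smul, zero_add, IsHomogeneous.eval_smul hg, lineExp_coeff_top hg, mul_comm]
    rfl
  · rw [lineExp_eval_field, ← IsHomogeneous.eval_smul hg, smul_add, smul_smul,
      mul_div_cancel₀ _ ha]

/-- A cone splits into lines. -/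
lemma splitsOn_of_cone [IsAlgClosed k] (hf₁ : f₁.IsHomogeneous m) (hf₂ : f₂.IsHomogeneous m)
    (hfd : f = X 2 * f₁ + X 3 * f₂) {y : k} {c : Fin 3 → k} (hc : c ≠ 0)
    (h : ∀ v : Fin 3 → k, ∀ s : k,
      eval (v + s • c) (residualForm f₁ f₂ y) = eval v (residualForm f₁ f₂ y)) :
    SplitsOn f (pencilPlane y) (m + 1) := by
  obtain ⟨i, hi⟩ : ∃ i, c i ≠ 0 := by
    by_contra! h
    exact hc (funext h)
  obtain ⟨C₀, ℓ, hℓ⟩ := exists_binary_factors (residual_isHomogeneous hf₁ hf₂ y)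
    (Pi.single (i + 1) 1 : Fin 3 → k) (Pi.single (i + 2) 1)
  let coord : Fin 3 → Module.Dual k (Fin 4 → k) := fun j =>
    LinearMap.proj j.castSucc - (c j / c i) • LinearMap.proj i.castSucc
  refine splitsOn_pencilPlane hfd C₀
    (fun j => (ℓ j).1 • coord (i + 1) + (ℓ j).2 • coord (i + 2)) fun v => ?_
  have hcoord : ∀ j, coord j (planePoint y v) = v j - c j / c i * v i := by
    intro j
    have hp : ∀ j : Fin 3, planePoint y v j.castSucc = v j := by
      intro j; fin_cases j <;> rfl
    simp [coord, hp]
  have hv : v + (-(v i / c i)) • c = (v (i + 1) - c (i + 1) / c i * v i) •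
      (Pi.single (i + 1) 1 : Fin 3 → k) +
      (v (i + 2) - c (i + 2) / c i * v i) • (Pi.single (i + 2) 1 : Fin 3 → k) := by
    funext j
    fin_cases i <;> fin_cases j <;> simp at hi ⊢ <;> field_simp <;> ring
  rw [← h v (-(v i / c i)), hv, hℓ]
  simp only [LinearMap.add_apply, LinearMap.smul_apply, smul_eq_mul, hcoord]

end Pencil

section Discriminant

variable {k : Type*} [Field k] {f f₁ f₂ : MvPolynomial (Fin 4) k} {m : ℕ}

lemma eval_add_smul_strange [Infinite k] {G : MvPolynomial (Fin 3) k} (hG : G.IsHomogeneous m)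
    (hm : m ≠ 0) {v c : Fin 3 → k}
    (hco : ∀ j, 1 ≤ j → j < m → (lineExp G v c).coeff j = 0) :
    lineExp G v c = Polynomial.C (eval v G) + Polynomial.C (eval c G) * Polynomial.X ^ m := by
  ext j
  rw [Polynomial.coeff_add, Polynomial.coeff_C_mul_X_pow, Polynomial.coeff_C]
  rcases Nat.eq_zero_or_pos j with rfl | hj
  · rw [if_pos rfl, if_neg (Ne.symm hm), add_zero, lineExp_coeff_zero]; rfl
  · rw [if_neg hj.ne', zero_add]
    split_ifs with hjm
    · rw [hjm, lineExp_coeff_top hG]; rfl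
    · rcases Nat.lt_or_ge m j with h | h
      · exact Polynomial.coeff_eq_zero_of_natDegree_lt ((lineExp_natDegree_le hG v c).trans_lt h)
      · exact hco j hj (lt_of_le_of_ne h hjm)

lemma dirDeriv_add_smul_right (g : MvPolynomial (Fin 4) k) (v u w : Fin 4 → k) (s : k) :
    dirDeriv g v (u + s • w) = dirDeriv g v u + s * dirDeriv g v w := by
  simp only [dirDeriv, Finset.mul_sum, ← Finset.sum_add_distrib, Pi.add_apply, Pi.smul_apply,
    smul_eq_mul]
  exact Finset.sum_congr rfl fun i _ => by ring

lemma lineExp_planePoint_strange [Infinite k] (hf₁ : f₁.IsHomogeneous m)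
    (hf₂ : f₂.IsHomogeneous m) (hfd : f = X 2 * f₁ + X 3 * f₂) (hm : m ≠ 0) {y : k}
    {c v : Fin 3 → k}
    (hco : ∀ j, 1 ≤ j → j < m → (lineExp (residualForm f₁ f₂ y) v c).coeff j = 0)
    (hv : eval v (residualForm f₁ f₂ y) = 0) :
    lineExp f (planePoint y v) (planePoint y c) =
      (Polynomial.C (v 2) + Polynomial.X * Polynomial.C (c 2)) *
        (Polynomial.C (eval c (residualForm f₁ f₂ y)) * Polynomial.X ^ m) := by
  have h1 := eval_add_smul_strange (residual_isHomogeneous hf₁ hf₂ y) hm hco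
  rw [hv, Polynomial.C_0, zero_add] at h1
  refine Polynomial.funext fun s => ?_
  have h2 := eval_planePoint hfd y (v + s • c)
  rw [planePoint_add_smul, ← lineExp_eval_field, ← lineExp_eval_field, h1] at h2
  rw [h2]
  simp only [Polynomial.eval_mul, Polynomial.eval_add, Polynomial.eval_C, Polynomial.eval_X,
    Polynomial.eval_pow, Pi.add_apply, Pi.smul_apply, smul_eq_mul]

lemma sup_span_eq_pencilPlane {M : Submodule k (Fin 4 → k)} {y : k}
    (hM : Module.finrank k M = 2) (hMy : M ≤ pencilPlane y) {p : Fin 4 → k}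
    (hp : p ∈ pencilPlane y) (hpM : p ∉ M) : M ⊔ Submodule.span k {p} = pencilPlane y := by
  refine Submodule.eq_of_le_of_finrank_le (sup_le hMy ?_) ?_
  · rwa [Submodule.span_singleton_le_iff_mem]
  · rw [finrank_pencilPlane]
    have hlt : M < M ⊔ Submodule.span k {p} := by
      refine lt_of_le_of_ne le_sup_left fun h => hpM ?_
      rw [h]
      exact Submodule.mem_sup_right (Submodule.mem_span_singleton_self _)
    have := Submodule.finrank_lt_finrank_of_lt hlt
    rw [hM] at this
    omega

/-- A plane containing a further line passes through the strange point on the surface. -/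
lemma eval_strange_eq_zero [IsAlgClosed k] (hf : IsSmoothSurface f (m + 1))
    (hf₁ : f₁.IsHomogeneous m) (hf₂ : f₂.IsHomogeneous m) (hfd : f = X 2 * f₁ + X 3 * f₂)
    (hm : 2 ≤ m) {y : k} {c : Fin 3 → k}
    (hco : ∀ j, 1 ≤ j → j < m → ∀ v, (lineExp (residualForm f₁ f₂ y) v c).coeff j = 0)
    {M : Submodule k (Fin 4 → k)} (hM : IsLineOn f M) (hne : M ≠ axis k)
    (hMy : M ≤ pencilPlane y) : eval c (residualForm f₁ f₂ y) = 0 := by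
  by_contra hc
  have hcM : planePoint y c ∉ M := by
    intro h
    have h0 := eval_residual_eq_zero hfd hM hne hMy h
    have hcs : planePoint y c ∘ Fin.castSucc = c := by
      funext i
      fin_cases i <;> rfl
    rw [hcs] at h0
    exact hc h0
  have hsup := sup_span_eq_pencilPlane hM.1 hMy (planePoint_mem y c) hcM
  have key : ∀ v ∈ M, ∀ u ∈ pencilPlane y, dirDeriv f v u = 0 := by
    intro v hv u hu
    rw [← hsup] at hu
    obtain ⟨μ, hμ, w, hw, rfl⟩ := Submodule.mem_sup.1 hu
    obtain ⟨s, rfl⟩ := Submodule.mem_span_singleton.1 hw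
    rw [dirDeriv_add_smul_right, ← lineExp_coeff_one f v μ, lineExp_eq_zero_of_mem hM.2 hv hμ,
      Polynomial.coeff_zero, zero_add]
    refine mul_eq_zero_of_right _ ?_
    have hexp := lineExp_planePoint_strange hf₁ hf₂ hfd (by omega)
      (fun j hj hjm => hco j hj hjm (v ∘ Fin.castSucc)) (eval_residual_eq_zero hfd hM hne hMy hv)
    rw [planePoint_castSucc (hMy hv)] at hexp
    rw [← lineExp_coeff_one, hexp, ← mul_assoc, Polynomial.coeff_mul_X_pow', if_neg (by omega)]
  have := hf.finrank_le_one_of_tangent (by omega) (finrank_pencilPlane y) (M := M) fun v hv =>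
    ⟨hM.2 v hv, key v hv⟩
  rw [hM.1] at this
  omega

/-- The resultant locating the planes of the pencil that split into lines. -/
def IsPencilDiscriminant (f : MvPolynomial (Fin 4) k) (m : ℕ) (R : Polynomial k) : Prop :=
  R ≠ 0 ∧ R.natDegree ≤ m ^ 2 + 1 ∧ ∀ (y : k) (M : Submodule k (Fin 4 → k)), IsLineOn f M →
    M ≠ axis k → M ≤ pencilPlane y → R.eval y = 0 ∧ SplitsOn f (pencilPlane y) (m + 1)

lemma exists_isPencilDiscriminant_of_three_le [IsAlgClosed k] (hf : IsSmoothSurface f (m + 1))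
    (hm : 3 ≤ m) (hcount : {W | IsLineOn f W}.ncard = (m + 1) * (m ^ 3 + 1))
    (hL : ∀ v : Fin 4 → k, v 2 = 0 → v 3 = 0 → eval v f = 0) (hw : pderiv 0 f ≠ 0) :
    ∃ R, IsPencilDiscriminant f m R := by
  obtain ⟨f₁, f₂, hf₁, hf₂, hfd⟩ := axis_decomposition hf.2.1 hL
  have hfin : {W | IsLineOn f W}.Finite := Set.finite_of_ncard_pos (by rw [hcount]; positivity)
  have hdvd : ∀ j, 2 ≤ j → j < m → f ∣ axisForm f j := fun j h2 hj =>
    dvd_axisForm_of_lt hf hm hcount hL hw h2 hj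
  have hP : ¬ f ∣ axisForm f m := by
    obtain ⟨j, h2, hj, hndvd⟩ := exists_axisForm_not_dvd hf (by omega) hfin hL hw
    rcases Nat.lt_or_ge j m with h | h
    · exact absurd (hdvd j h2 h) hndvd
    · rwa [← le_antisymm hj h]
  have hw' := pderiv_not_dvd hf.2.1 0 hw
  have hmk := natCast_eq_zero_of_dvd_axisForm (hf.prime (by omega)) hm hw' hdvd hP
  obtain ⟨c, hc, hco, y₀, hy₀⟩ :=
    exists_strange_section hf hf₁ hf₂ hfd (by omega) hmk hw' hdvd hP
  obtain ⟨h0, h1, h2⟩ := natDegree_strange_section_le hf.2.1 hf₁ hf₂ hfd hmk hw hc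
    (fun y v => by rw [← lineExp_coeff_one]; exact hco y 1 le_rfl (by omega) v)
  have h2' : (c 2).natDegree ≤ m := by
    by_cases hc2 : c 2 = 0
    · simp [hc2]
    · rw [Polynomial.natDegree_mul Polynomial.X_ne_zero hc2] at h2
      omega
  set R : Polynomial k := aeval (planePoint Polynomial.X c) f₁ +
    Polynomial.X * aeval (planePoint Polynomial.X c) f₂ with hR
  have hRe : ∀ y, R.eval y = eval (fun i => (c i).eval y) (residualForm f₁ f₂ y) := by
    intro y
    have h : ∀ g : MvPolynomial (Fin 4) k, (aeval (planePoint Polynomial.X c) g).eval y =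
        eval (planePoint y fun i => (c i).eval y) g := by
      intro g
      have : (fun i => (Polynomial.aeval y : Polynomial k →ₐ[k] k) (planePoint Polynomial.X c i)) =
          planePoint y fun i => (c i).eval y := by
        funext i; fin_cases i <;> simp [planePoint, Polynomial.coe_aeval_eq_eval]
      change (Polynomial.aeval y : Polynomial k →ₐ[k] k) (aeval _ g) = _
      rw [← AlgHom.comp_apply, comp_aeval, this]
      rfl
    rw [eval_residual, hR, Polynomial.eval_add, Polynomial.eval_mul, Polynomial.eval_X, h, h]
  refine ⟨R, ?_, ?_, fun y M hM hne hMy => ?_⟩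
  · intro hR0
    exact hy₀ (by rw [← hRe, hR0, Polynomial.eval_zero])
  · have hd : ∀ {g : MvPolynomial (Fin 4) k}, g.IsHomogeneous m →
        (aeval (planePoint Polynomial.X c) g).natDegree ≤ m ^ 2 := by
      intro g hg
      rw [sq]
      refine MvPolynomial.aeval_natDegree_le g hg.totalDegree_le _ fun i => ?_
      fin_cases i
      exacts [h0, h1, h2', h2]
    refine (Polynomial.natDegree_add_le _ _).trans (max_le ((hd hf₁).trans (by omega)) ?_)
    refine Polynomial.natDegree_mul_le.trans ?_
    rw [Polynomial.natDegree_X]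
    have := hd hf₂
    omega
  · have hz := eval_strange_eq_zero hf hf₁ hf₂ hfd (by omega) (hco y) hM hne hMy
    refine ⟨by rw [hRe, hz], splitsOn_of_cone hf₁ hf₂ hfd (hc y) fun v s => ?_⟩
    rw [← lineExp_eval_field, eval_add_smul_strange (residual_isHomogeneous hf₁ hf₂ y) (by omega)
      (fun j hj hjm => hco y j hj hjm v), hz, Polynomial.C_0, zero_mul, add_zero,
      Polynomial.eval_C]

end Discriminant

section Conic

variable {k : Type*} [Field k] {f f₁ f₂ : MvPolynomial (Fin 4) k}

lemma exists_quadratic_coefficients {σ : Type*} [Fintype σ] {g : MvPolynomial σ k}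
    (hg : g.IsHomogeneous 2) :
    ∃ Q : σ → σ → k, ∀ v, eval v g = ∑ i, ∑ j, Q i j * (v i * v j) := by
  classical
  have hmon : ∀ s : σ →₀ ℕ, s.degree = 2 → ∃ a b : σ, s = Finsupp.single a 1 + Finsupp.single b 1 := by
    intro s hs
    have hsplit : ∀ (s : σ →₀ ℕ) (n : ℕ), s.degree = n + 1 →
        ∃ a t, s = Finsupp.single a 1 + t ∧ t.degree = n := by
      intro s n hs
      obtain ⟨a, ha⟩ : ∃ a, s a ≠ 0 := by
        by_contra! h
        have : s = 0 := Finsupp.ext h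
        simp [this] at hs
      obtain ⟨t, rfl⟩ : ∃ t, s = Finsupp.single a 1 + t :=
        ⟨s - Finsupp.single a 1, (add_tsub_cancel_of_le (by
          rw [Finsupp.single_le_iff]; exact Nat.one_le_iff_ne_zero.2 ha)).symm⟩
      rw [map_add, Finsupp.degree_single] at hs
      exact ⟨a, t, rfl, by omega⟩
    obtain ⟨a, t, rfl, ht⟩ := hsplit s 1 hs
    obtain ⟨b, u, rfl, hu⟩ := hsplit t 0 ht
    rw [(Finsupp.degree_eq_zero_iff u).1 hu, add_zero]
    exact ⟨a, b, rfl⟩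
  have hsum : ∀ S : Finset (σ →₀ ℕ), (∀ s ∈ S, s.degree = 2) → ∃ Q : σ → σ → k, ∀ v : σ → k,
      eval v (∑ s ∈ S, monomial s (coeff s g)) = ∑ i, ∑ j, Q i j * (v i * v j) := by
    intro S
    induction S using Finset.induction_on with
    | empty => exact fun _ => ⟨0, fun v => by simp⟩
    | insert s S hs ih =>
      intro h
      obtain ⟨Q, hQ⟩ := ih fun t ht => h t (Finset.mem_insert_of_mem ht)
      obtain ⟨a, b, hab⟩ := hmon s (h s (Finset.mem_insert_self _ _))
      refine ⟨fun i j => Q i j + if i = a then (if j = b then coeff s g else 0) else 0,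
        fun v => ?_⟩
      rw [Finset.sum_insert hs, map_add, hQ, add_comm]
      simp only [add_mul, Finset.sum_add_distrib]
      congr 1
      rw [Finset.sum_eq_single a (fun i _ hi => by simp [hi]) (by simp),
        Finset.sum_eq_single b (fun i _ hi => by simp [hi]) (by simp), if_pos rfl, if_pos rfl,
        eval_monomial, hab, Finsupp.prod_add_index' (by simp) (by simp [pow_add])]
      simp
  obtain ⟨Q, hQ⟩ := hsum g.support fun s hs => by
    rw [Finsupp.degree_eq_weight_one]
    exact hg (mem_support_iff.1 hs)
  exact ⟨Q, fun v => by rw [← hQ, support_sum_monomial_coeff]⟩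

lemma exists_conic_coefficients (hf₁ : f₁.IsHomogeneous 2) (hf₂ : f₂.IsHomogeneous 2) :
    ∃ a b c e h i : Polynomial k, (a.natDegree ≤ 1 ∧ b.natDegree ≤ 1 ∧ c.natDegree ≤ 1 ∧
      e.natDegree ≤ 2 ∧ h.natDegree ≤ 2 ∧ i.natDegree ≤ 3) ∧ ∀ (y : k) (v : Fin 3 → k),
      eval v (residualForm f₁ f₂ y) = a.eval y * v 1 ^ 2 + b.eval y * (v 1 * v 0) +
        c.eval y * v 0 ^ 2 + (e.eval y * v 1 + h.eval y * v 0) * v 2 + i.eval y * v 2 ^ 2 := by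
  obtain ⟨p, hp⟩ := exists_quadratic_coefficients hf₁
  obtain ⟨r, hr⟩ := exists_quadratic_coefficients hf₂
  let lin : k → k → Polynomial k := fun s t => Polynomial.C s + Polynomial.C t * Polynomial.X
  let mix : Fin 4 → Polynomial k := fun l =>
    Polynomial.C (p l 2 + p 2 l) + Polynomial.C (p l 3 + p 3 l + r l 2 + r 2 l) * Polynomial.X +
      Polynomial.C (r l 3 + r 3 l) * Polynomial.X ^ 2
  have hlin : ∀ s t, (lin s t).natDegree ≤ 1 := fun s t => by
    simp only [lin]; compute_degree
  have hmix : ∀ l, (mix l).natDegree ≤ 2 := fun l => by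
    simp only [mix]; compute_degree
  refine ⟨lin (p 1 1) (r 1 1), lin (p 0 1 + p 1 0) (r 0 1 + r 1 0), lin (p 0 0) (r 0 0),
    mix 1, mix 0, Polynomial.C (p 2 2) + Polynomial.C (p 2 3 + p 3 2 + r 2 2) * Polynomial.X +
      Polynomial.C (p 3 3 + r 2 3 + r 3 2) * Polynomial.X ^ 2 +
      Polynomial.C (r 3 3) * Polynomial.X ^ 3,
    ⟨hlin _ _, hlin _ _, hlin _ _, hmix _, hmix _, by compute_degree⟩, fun y v => ?_⟩
  rw [eval_residual, hp, hr]
  simp only [Fin.sum_univ_four, lin, mix, planePoint, Matrix.cons_val, Polynomial.eval_add,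
    Polynomial.eval_mul, Polynomial.eval_C, Polynomial.eval_X, Polynomial.eval_pow]
  ring

/-- The second coefficient of a conic along the direction annihilated by the derivative. -/
lemma eval_axisForm_two [Infinite k] (hfd : f = X 2 * f₁ + X 3 * f₂)
    {y a b c e h i : k}
    (hG : ∀ v : Fin 3 → k, eval v (residualForm f₁ f₂ y) = a * v 1 ^ 2 + b * (v 1 * v 0) +
        c * v 0 ^ 2 + (e * v 1 + h * v 0) * v 2 + i * v 2 ^ 2)
    {q : Fin 4 → k} (hq2 : q 2 = 1) (hqy : q ∈ pencilPlane y) (hq : eval q f = 0) :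
    eval q (axisForm f 2) =
      -((4 * a * c - b ^ 2) * i - a * h ^ 2 + b * e * h - c * e ^ 2) := by
  have hq3 : q 3 = y := by rw [mem_pencilPlane.1 hqy, hq2, mul_one]
  have hexp : ∀ s t : k, lineExp f q ![s, t, 0, 0] =
      Polynomial.C (eval q f) +
      Polynomial.C ((b * q 1 + 2 * c * q 0 + h) * s + (2 * a * q 1 + b * q 0 + e) * t) *
        Polynomial.X +
      Polynomial.C (a * t ^ 2 + b * (s * t) + c * s ^ 2) * Polynomial.X ^ 2 := by
    intro s t
    have hval : ∀ p ∈ pencilPlane y, eval p f = p 2 * (a * p 1 ^ 2 + b * (p 1 * p 0) +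
        c * p 0 ^ 2 + (e * p 1 + h * p 0) * p 2 + i * p 2 ^ 2) := by
      intro p hp
      rw [← planePoint_castSucc hp, eval_planePoint hfd, hG]
      rfl
    refine Polynomial.funext fun r => ?_
    rw [lineExp_eval_field, hval, hval q hqy]
    · simp only [Polynomial.eval_add, Polynomial.eval_mul, Polynomial.eval_C, Polynomial.eval_X,
        Polynomial.eval_pow, Pi.add_apply, Pi.smul_apply, smul_eq_mul, Matrix.cons_val, hq2]
      ring
    · rw [mem_pencilPlane]
      simp [hq2, hq3]
  have hd : ∀ s t : k, dirDeriv f q ![s, t, 0, 0] =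
      (b * q 1 + 2 * c * q 0 + h) * s + (2 * a * q 1 + b * q 0 + e) * t := by
    intro s t
    rw [← lineExp_coeff_one, hexp]
    simp only [Polynomial.coeff_add, Polynomial.coeff_C_mul, Polynomial.coeff_X_pow,
      Polynomial.coeff_C, Polynomial.coeff_X]
    norm_num
  have h0 := hd 1 0
  have h1 := hd 0 1
  rw [dirDeriv_eval] at h0 h1
  simp only [Matrix.cons_val] at h0 h1
  have hq' : a * q 1 ^ 2 + b * (q 1 * q 0) + c * q 0 ^ 2 + (e * q 1 + h * q 0) + i = 0 := by
    rw [← planePoint_castSucc hqy, eval_planePoint hfd, hG] at hq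
    have : (q ∘ Fin.castSucc) 2 = (1 : k) := hq2
    rw [this] at hq
    change 1 * (a * q 1 ^ 2 + b * (q 1 * q 0) + c * q 0 ^ 2 + (e * q 1 + h * q 0) * 1 + i * 1 ^ 2)
      = 0 at hq
    linear_combination hq
  have h0' : eval q (pderiv 0 f) = b * q 1 + 2 * c * q 0 + h := by linear_combination h0
  have h1' : eval q (pderiv 1 f) = 2 * a * q 1 + b * q 0 + e := by linear_combination h1
  rw [eval_axisForm, hexp, h0', h1']
  simp only [Polynomial.coeff_add, Polynomial.coeff_C_mul, Polynomial.coeff_X_pow, Polynomial.coeff_C,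
    Polynomial.coeff_X]
  norm_num
  linear_combination (4 * a * c - b ^ 2) * hq'

/-- A conic containing a line is a product of linear forms. -/
lemma splitsOn_of_conic (hfd : f = X 2 * f₁ + X 3 * f₂) {y a b c e h i : k}
    (hG : ∀ v : Fin 3 → k, eval v (residualForm f₁ f₂ y) = a * v 1 ^ 2 + b * (v 1 * v 0) +
        c * v 0 ^ 2 + (e * v 1 + h * v 0) * v 2 + i * v 2 ^ 2)
    {q u : Fin 3 → k} (hq2 : q 2 = 1) (hu : u ≠ 0) (hu2 : u 2 = 0)
    (hq : eval q (residualForm f₁ f₂ y) = 0) (hu0 : eval u (residualForm f₁ f₂ y) = 0)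
    (hqu : eval (q + u) (residualForm f₁ f₂ y) = 0) : SplitsOn f (pencilPlane y) 3 := by
  rw [hG] at hq hu0 hqu
  simp only [hq2, hu2, Pi.add_apply] at hq hu0 hqu
  let x : Fin 4 → Module.Dual k (Fin 4 → k) := fun j => LinearMap.proj j
  by_cases h0 : u 0 = 0
  · have h1 : u 1 ≠ 0 := fun h1 => hu (by funext j; fin_cases j <;> assumption)
    have hu0' : a = 0 := by
      have : a * u 1 ^ 2 = 0 := by rw [h0] at hu0; linear_combination hu0
      exact (mul_eq_zero.1 this).resolve_right (pow_ne_zero _ h1)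
    have hqu' : b * q 0 + e = 0 := by
      have : u 1 * (b * q 0 + e) = 0 := by
        rw [h0, hu0'] at hqu; rw [hu0'] at hq; linear_combination hqu - hq
      exact (mul_eq_zero.1 this).resolve_left h1
    refine splitsOn_pencilPlane hfd (n := 2) 1 ![x 0 - q 0 • x 2,
      (c * q 0 + b * q 1 + h + c * q 0) • x 2 + c • (x 0 - q 0 • x 2) + b • (x 1 - q 1 • x 2)]
      fun v => ?_
    rw [hG]
    simp [Fin.prod_univ_two, x, planePoint]
    rw [hu0'] at hq ⊢
    linear_combination v 2 ^ 2 * hq + v 2 * (v 1 - v 2 * q 1) * hqu'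
  · have hc : c = -(a * (u 1 / u 0) ^ 2 + b * (u 1 / u 0)) := by
      field_simp
      linear_combination hu0
    have hh : b * q 1 + 2 * c * q 0 + h = -(u 1 / u 0) * (2 * a * q 1 + b * q 0 + e) := by
      have h2 : u 0 * (b * q 1 + 2 * c * q 0 + h) = -u 1 * (2 * a * q 1 + b * q 0 + e) := by
        linear_combination hqu - hq - hu0
      field_simp
      linear_combination h2
    generalize u 1 / u 0 = t at hc hh
    refine splitsOn_pencilPlane hfd (n := 2) 1 ![(x 1 - q 1 • x 2) - t • (x 0 - q 0 • x 2),
      (2 * a * q 1 + b * q 0 + e) • x 2 + a • (x 1 - q 1 • x 2) +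
        (a * t + b) • (x 0 - q 0 • x 2)]
      fun v => ?_
    rw [hG]
    simp [Fin.prod_univ_two, x, planePoint]
    linear_combination v 2 ^ 2 * hq + v 2 * (v 0 - v 2 * q 0) * hh + (v 0 - v 2 * q 0) ^ 2 * hc

lemma exists_isPencilDiscriminant_of_two [IsAlgClosed k] (hf : IsSmoothSurface f 3)
    (hfin : {W | IsLineOn f W}.Finite)
    (hL : ∀ v : Fin 4 → k, v 2 = 0 → v 3 = 0 → eval v f = 0) (hw : pderiv 0 f ≠ 0) :
    ∃ R, IsPencilDiscriminant f 2 R := by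
  obtain ⟨f₁, f₂, hf₁, hf₂, hfd⟩ := axis_decomposition hf.2.1 hL
  obtain ⟨a, b, c, e, h, i, ⟨ha, hb, hc, he, hh, hi⟩, hG⟩ := exists_conic_coefficients hf₁ hf₂
  have hax : ∀ y, ∀ q : Fin 4 → k, q 2 = 1 → q ∈ pencilPlane y → eval q f = 0 →
      eval q (axisForm f 2) =
        -((4 * a * c - b ^ 2) * i - a * h ^ 2 + b * e * h - c * e ^ 2).eval y := by
    intro y q hq2 hqy hq
    rw [eval_axisForm_two hfd (hG y) hq2 hqy hq]
    simp
  refine ⟨(4 * a * c - b ^ 2) * i - a * h ^ 2 + b * e * h - c * e ^ 2, ?_, ?_,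
    fun y M hM hne hMy => ?_⟩
  · intro h0
    obtain ⟨j, h2, hj, hndvd⟩ := exists_axisForm_not_dvd hf le_rfl hfin hL hw
    obtain rfl : j = 2 := le_antisymm hj h2
    obtain ⟨q, hq, hq2, -, hne⟩ := hf.exists_general_point le_rfl hfin
      (axisForm_isHomogeneous hf.2.1 (by omega)) hndvd
    refine hne ?_
    rw [hax (q 3) q hq2 (mem_pencilPlane.2 (by rw [hq2, mul_one])) hq, h0, Polynomial.eval_zero,
      neg_zero]
  · have h4 : (4 : Polynomial k).natDegree ≤ 0 := (Polynomial.natDegree_ofNat 4).le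
    have h1 := Polynomial.natDegree_sub_le_of_le
      (Polynomial.natDegree_mul_le_of_le (Polynomial.natDegree_mul_le_of_le h4 ha) hc)
      (Polynomial.natDegree_pow_le_of_le 2 hb)
    have h2 := Polynomial.natDegree_sub_le_of_le (Polynomial.natDegree_mul_le_of_le h1 hi)
      (Polynomial.natDegree_mul_le_of_le ha (Polynomial.natDegree_pow_le_of_le 2 hh))
    have h3 := Polynomial.natDegree_add_le_of_le h2
      (Polynomial.natDegree_mul_le_of_le (Polynomial.natDegree_mul_le_of_le hb he) hh)
    have h5 := Polynomial.natDegree_sub_le_of_le h3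
      (Polynomial.natDegree_mul_le_of_le hc (Polynomial.natDegree_pow_le_of_le 2 he))
    exact h5.trans (by norm_num)
  · obtain ⟨q, hq, hq2⟩ := exists_mem_apply_eq_one hM.1 hne hMy
    obtain ⟨u, hu, hu0, hu2⟩ := exists_zero_of_isHomogeneous (isHomogeneous_X k (2 : Fin 4))
      one_ne_zero hM.1.ge
    rw [eval_X] at hu2
    have hu3 : u 3 = 0 := by rw [mem_pencilPlane.1 (hMy hu), hu2, mul_zero]
    constructor
    · have := axisForm_eval_eq_zero hM hu hu0 hu2 hu3 hq (j := 1)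
      rw [hax y q hq2 (hMy hq) (hM.2 q hq)] at this
      exact neg_eq_zero.1 this
    · have hqu := eval_residual_eq_zero hfd hM hne hMy (M.add_mem hq hu)
      have hadd : (q + u) ∘ Fin.castSucc = q ∘ Fin.castSucc + u ∘ Fin.castSucc := rfl
      rw [hadd] at hqu
      refine splitsOn_of_conic hfd (hG y) (q := q ∘ Fin.castSucc) (u := u ∘ Fin.castSucc) hq2 ?_
        hu2 (eval_residual_eq_zero hfd hM hne hMy hq) (eval_residual_eq_zero hfd hM hne hMy hu) hqu
      intro h0
      refine hu0 (funext fun j => ?_)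
      fin_cases j
      · exact congr_fun h0 0
      · exact congr_fun h0 1
      · exact hu2
      · exact hu3

end Conic

section MeetingPlanes

variable {k : Type*} [Field k] {f : MvPolynomial (Fin 4) k} {m d : ℕ}

/-- The planes containing `L` and another line on the surface. -/
def meetingPlanes (f : MvPolynomial (Fin 4) k) (L : Submodule k (Fin 4 → k)) :
    Set (Submodule k (Fin 4 → k)) :=
  {H | Module.finrank k H = 3 ∧ L ≤ H ∧ ∃ M, IsLineOn f M ∧ M ≠ L ∧ M ≤ H}

lemma lt_finrank_sup {L M : Submodule k (Fin 4 → k)} (h : Module.finrank k L ≤ Module.finrank k M)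
    (hne : M ≠ L) : Module.finrank k L < Module.finrank k (L ⊔ M : Submodule k _) := by
  refine Submodule.finrank_lt_finrank_of_lt (lt_of_le_of_ne le_sup_left fun hs => hne ?_)
  exact Submodule.eq_of_le_of_finrank_le (by rw [hs]; exact le_sup_right) h

lemma finrank_sup_eq_three {L M : Submodule k (Fin 4 → k)} (hL : Module.finrank k L = 2)
    (hM : Module.finrank k M = 2) (hne : M ≠ L) {c : Fin 4 → k} (hcL : c ∈ L) (hcM : c ∈ M)
    (hc : c ≠ 0) : Module.finrank k (L ⊔ M : Submodule k _) = 3 := by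
  have h1 := lt_finrank_sup (hL.trans hM.symm).le hne
  have h2 := Submodule.finrank_sup_add_finrank_inf_eq L M
  have h3 : 0 < Module.finrank k (L ⊓ M : Submodule k _) := by
    rw [Module.finrank_pos_iff_exists_ne_zero]
    exact ⟨⟨c, hcL, hcM⟩, fun h => hc (congrArg Subtype.val h)⟩
  omega

lemma mem_meetingPlanes_of_mem {L M : Submodule k (Fin 4 → k)} (hL : Module.finrank k L = 2)
    (hM : IsLineOn f M) (hne : M ≠ L) {c : Fin 4 → k} (hcL : c ∈ L) (hcM : c ∈ M) (hc : c ≠ 0) :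
    L ⊔ M ∈ meetingPlanes f L :=
  ⟨finrank_sup_eq_three hL hM.1 hne hcL hcM hc, le_sup_left, M, hM, hne, le_sup_right⟩

/-- The planes through a line that meet the surface in further lines split completely. -/
def HasFewPlanes (f : MvPolynomial (Fin 4) k) (m : ℕ) (L : Submodule k (Fin 4 → k)) : Prop :=
  (meetingPlanes f L).Nonempty ∧ (meetingPlanes f L).Finite ∧
    (meetingPlanes f L).ncard ≤ m ^ 2 + 1 ∧ ∀ H ∈ meetingPlanes f L, SplitsOn f H (m + 1)

lemma exists_isPencilDiscriminant [IsAlgClosed k] (hf : IsSmoothSurface f (m + 1)) (hm : 2 ≤ m)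
    (hcount : {W | IsLineOn f W}.ncard = (m + 1) * (m ^ 3 + 1))
    (hL : ∀ v : Fin 4 → k, v 2 = 0 → v 3 = 0 → eval v f = 0) (hw : pderiv 0 f ≠ 0) :
    ∃ R, IsPencilDiscriminant f m R := by
  rcases hm.eq_or_lt with rfl | hm
  · exact exists_isPencilDiscriminant_of_two hf
      (Set.finite_of_ncard_pos (by rw [hcount]; positivity)) hL hw
  · exact exists_isPencilDiscriminant_of_three_le hf hm hcount hL hw

lemma hasFewPlanes_axis [IsAlgClosed k] (hf : IsSmoothSurface f (m + 1)) (hm : 2 ≤ m)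
    (hcount : {W | IsLineOn f W}.ncard = (m + 1) * (m ^ 3 + 1)) (hL : IsLineOn f (axis k))
    (hw : pderiv 0 f ≠ 0)
    (hinf : ∀ M, IsLineOn f M → M ≠ axis k → ∃ v ∈ M, v 2 ≠ 0) : HasFewPlanes f m (axis k) := by
  classical
  have hL' : ∀ v : Fin 4 → k, v 2 = 0 → v 3 = 0 → eval v f = 0 := fun v h2 h3 => hL.2 v ⟨h2, h3⟩
  obtain ⟨R, hR0, hRd, hR⟩ := exists_isPencilDiscriminant hf hm hcount hL' hw
  have hpl : ∀ H ∈ meetingPlanes f (axis k), ∃ y ∈ R.roots.toFinset,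
      pencilPlane y = H ∧ SplitsOn f (pencilPlane y) (m + 1) := by
    rintro H ⟨hH, hLH, M, hM, hne, hMH⟩
    obtain ⟨v, hv, hv2⟩ := hinf M hM hne
    have hy : pencilPlane (v 3 / v 2) = H := by
      refine Submodule.eq_of_le_of_finrank_le (fun u hu => ?_) (by rw [hH, finrank_pencilPlane])
      have : u - (u 2 / v 2) • v ∈ axis k := by
        rw [mem_pencilPlane] at hu
        refine ⟨?_, ?_⟩
        · simp [hv2]
        · simp only [Pi.sub_apply, Pi.smul_apply, smul_eq_mul, hu]
          ring
      have h2 := H.add_mem (hLH this) (H.smul_mem (u 2 / v 2) (hMH hv))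
      rwa [sub_add_cancel] at h2
    obtain ⟨h1, h2⟩ := hR _ M hM hne (hy ▸ hMH)
    exact ⟨_, by simpa [hR0] using h1, hy, h2⟩
  have hsub : meetingPlanes f (axis k) ⊆ pencilPlane '' (R.roots.toFinset : Set k) := by
    intro H hH
    obtain ⟨y, hy, h, -⟩ := hpl H hH
    exact ⟨y, hy, h⟩
  have hfin : (pencilPlane '' (R.roots.toFinset : Set k)).Finite := (Finset.finite_toSet _).image _
  refine ⟨?_, hfin.subset hsub, ?_, fun H hH => ?_⟩
  · obtain ⟨M, hM, hne, c, hcM, hc0, h2, h3⟩ := exists_meeting_line hf hm hcount hL' hw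
    exact ⟨_, mem_meetingPlanes_of_mem hL.1 hM hne ⟨h2, h3⟩ hcM hc0⟩
  · refine (Set.ncard_le_ncard hsub hfin).trans ((Set.ncard_image_le (Finset.finite_toSet _)).trans ?_)
    rw [Set.ncard_coe_finset]
    exact (Multiset.toFinset_card_le _).trans ((Polynomial.card_roots' R).trans hRd)
  · obtain ⟨y, -, rfl, h⟩ := hpl H hH
    exact h

variable (T : (Fin 4 → k) ≃ₗ[k] (Fin 4 → k))

lemma SplitsOn.map {H : Submodule k (Fin 4 → k)}
    (h : SplitsOn (lsub (T : (Fin 4 → k) →ₗ[k] (Fin 4 → k)) f) H d) :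
    SplitsOn f (H.map (T : (Fin 4 → k) →ₗ[k] (Fin 4 → k))) d := by
  obtain ⟨c, ℓ, h⟩ := h
  refine ⟨c, fun i => (ℓ i).comp T.symm.toLinearMap, fun v hv => ?_⟩
  obtain ⟨u, hu, rfl⟩ := hv
  have := h u hu
  rw [eval_lsub] at this
  rw [this]
  simp

lemma meetingPlanes_map (L : Submodule k (Fin 4 → k)) :
    meetingPlanes f (L.map (T : (Fin 4 → k) →ₗ[k] (Fin 4 → k))) =
      Submodule.map (T : (Fin 4 → k) →ₗ[k] (Fin 4 → k)) ''
        meetingPlanes (lsub (T : (Fin 4 → k) →ₗ[k] (Fin 4 → k)) f) L := by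
  have hinj : Function.Injective (Submodule.map (T : (Fin 4 → k) →ₗ[k] (Fin 4 → k))) :=
    Submodule.map_injective_of_injective T.injective
  have hsurj : ∀ M : Submodule k (Fin 4 → k),
      ∃ N : Submodule k (Fin 4 → k), N.map (T : (Fin 4 → k) →ₗ[k] (Fin 4 → k)) = M := fun M =>
    ⟨M.comap (T : (Fin 4 → k) →ₗ[k] (Fin 4 → k)),
      Submodule.map_comap_eq_of_surjective T.surjective M⟩
  have hle : ∀ M N : Submodule k (Fin 4 → k),
      M.map (T : (Fin 4 → k) →ₗ[k] (Fin 4 → k)) ≤ N.map (T : (Fin 4 → k) →ₗ[k] (Fin 4 → k)) ↔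
        M ≤ N := fun M N => Submodule.map_le_map_iff_of_injective T.injective M N
  have hrank : ∀ M : Submodule k (Fin 4 → k), Module.finrank k
      (M.map (T : (Fin 4 → k) →ₗ[k] (Fin 4 → k))) = Module.finrank k M := fun M =>
    LinearEquiv.finrank_map_eq T M
  ext H
  obtain ⟨H, rfl⟩ := hsurj H
  rw [hinj.mem_set_image]
  refine and_congr (by rw [hrank]) (and_congr (hle _ _) ⟨?_, ?_⟩)
  · rintro ⟨M, hM, hne, hMH⟩
    obtain ⟨M, rfl⟩ := hsurj M
    exact ⟨M, (isLineOn_lsub T M).2 hM, fun h => hne (h ▸ rfl), (hle _ _).1 hMH⟩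
  · rintro ⟨M, hM, hne, hMH⟩
    exact ⟨_, (isLineOn_lsub T M).1 hM, fun h => hne (hinj h), (hle _ _).2 hMH⟩

lemma ncard_lines_lsub :
    {W | IsLineOn (lsub (T : (Fin 4 → k) →ₗ[k] (Fin 4 → k)) f) W}.ncard =
      {W | IsLineOn f W}.ncard := by
  have hinj : Function.Injective (Submodule.map (T : (Fin 4 → k) →ₗ[k] (Fin 4 → k))) :=
    Submodule.map_injective_of_injective T.injective
  rw [← Set.ncard_image_of_injective _ hinj]
  congr 1
  ext M
  constructor
  · rintro ⟨W, hW, rfl⟩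
    exact (isLineOn_lsub T W).1 hW
  · intro hM
    have hmap : (M.comap (T : (Fin 4 → k) →ₗ[k] (Fin 4 → k))).map
        (T : (Fin 4 → k) →ₗ[k] (Fin 4 → k)) = M :=
      Submodule.map_comap_eq_of_surjective T.surjective M
    exact ⟨_, (isLineOn_lsub T _).2 (hmap.symm ▸ hM), hmap⟩

lemma HasFewPlanes.map {L : Submodule k (Fin 4 → k)}
    (h : HasFewPlanes (lsub (T : (Fin 4 → k) →ₗ[k] (Fin 4 → k)) f) m L) :
    HasFewPlanes f m (L.map (T : (Fin 4 → k) →ₗ[k] (Fin 4 → k))) := by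
  obtain ⟨h1, h2, h3, h4⟩ := h
  rw [HasFewPlanes, meetingPlanes_map]
  refine ⟨h1.image _, h2.image _, (Set.ncard_image_le h2).trans h3, ?_⟩
  rintro _ ⟨H, hH, rfl⟩
  exact (h4 H hH).map T

lemma hasFewPlanes_of_basis [IsAlgClosed k] (hf : IsSmoothSurface f (m + 1)) (hm : 2 ≤ m)
    (hcount : {W | IsLineOn f W}.ncard = (m + 1) * (m ^ 3 + 1)) {a b c e : Fin 4 → k} (ha : a ≠ 0)
    (hb : b ∉ Submodule.span k {a}) (hc : c ∉ Submodule.span k {a, b})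
    (he : e ∉ Submodule.span k {a, b, c}) (hL : IsLineOn f (Submodule.span k {a, b}))
    (hinf : ∀ M, IsLineOn f M → M ≠ Submodule.span k {a, b} →
      ¬ M ≤ Submodule.span k {a, b} ⊔ Submodule.span k {c})
    (hD : ∃ v, dirDeriv f v a ≠ 0) : HasFewPlanes f m (Submodule.span k {a, b}) := by
  have : Infinite k := IsAlgClosed.instInfinite
  obtain ⟨T, hT⟩ := exists_linearEquiv_of_notMem ha hb hc he
  have hax : (axis k).map (T : (Fin 4 → k) →ₗ[k] (Fin 4 → k)) = Submodule.span k {a, b} := by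
    ext v
    rw [Submodule.mem_span_pair]
    constructor
    · rintro ⟨u, hu, rfl⟩
      refine ⟨u 0, u 1, ?_⟩
      rw [LinearEquiv.coe_coe, hT, hu.1, hu.2]
      simp
    · rintro ⟨x, y, rfl⟩
      exact ⟨![x, y, 0, 0], ⟨rfl, rfl⟩, by rw [LinearEquiv.coe_coe, hT]; simp⟩
  have hinj : Function.Injective (Submodule.map (T : (Fin 4 → k) →ₗ[k] (Fin 4 → k))) :=
    Submodule.map_injective_of_injective T.injective
  rw [← hax] at hL hinf ⊢
  refine HasFewPlanes.map T (hasFewPlanes_axis (hf.lsub T) hm (by rw [ncard_lines_lsub, hcount])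
    ((isLineOn_lsub T _).2 hL) (fun h0 => ?_) fun M hM hne => ?_)
  · obtain ⟨v, hv⟩ := hD
    refine hv ?_
    have h1 := dirDeriv_lsub (T : (Fin 4 → k) →ₗ[k] (Fin 4 → k)) f (T.symm v) ![1, 0, 0, 0]
    rw [LinearEquiv.coe_coe, LinearEquiv.apply_symm_apply, hT] at h1
    rw [dirDeriv_eval, h0] at h1
    simpa using h1.symm
  · by_contra! h
    refine hinf _ ((isLineOn_lsub T M).1 hM) (fun h => hne (hinj h)) ?_
    rintro _ ⟨u, hu, rfl⟩
    rw [LinearEquiv.coe_coe, hT, h u hu, zero_smul, add_zero, hax]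
    exact Submodule.add_mem_sup (Submodule.mem_span_pair.2 ⟨_, _, rfl⟩)
      (Submodule.mem_span_singleton.2 ⟨_, rfl⟩)

lemma exists_span_pair_eq {L : Submodule k (Fin 4 → k)} (hL : Module.finrank k L = 2) :
    ∃ a b, a ≠ 0 ∧ b ∉ Submodule.span k {a} ∧ L = Submodule.span k {a, b} := by
  have h0 : ⊥ < L := by
    rw [bot_lt_iff_ne_bot]
    rintro rfl
    rw [finrank_bot] at hL
    omega
  obtain ⟨a, haL, ha⟩ := SetLike.exists_of_lt h0
  have ha0 : a ≠ 0 := fun h => ha (h ▸ Submodule.zero_mem _)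
  have h1 : Submodule.span k {a} < L := by
    refine lt_of_le_of_ne ((Submodule.span_singleton_le_iff_mem _ _).2 haL) fun h => ?_
    have := finrank_span_singleton_le_one a
    rw [h] at this
    omega
  obtain ⟨b, hbL, hb⟩ := SetLike.exists_of_lt h1
  refine ⟨a, b, ha0, hb, (Submodule.eq_of_le_of_finrank_le ?_ ?_).symm⟩
  · rw [Submodule.span_le]
    rintro x (rfl | rfl)
    exacts [haL, hbL]
  · have h2 : Submodule.span k {a} < Submodule.span k {a, b} := by
      refine lt_of_le_of_ne (Submodule.span_mono (by simp)) fun h => hb ?_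
      rw [h]
      exact Submodule.subset_span (by simp)
    have := Submodule.finrank_lt_finrank_of_lt h2
    rw [finrank_span_singleton ha0] at this
    omega

lemma exists_notMem_sup_of_finite [Infinite k] {L : Submodule k (Fin 4 → k)}
    (hL : Module.finrank k L = 2) (s : Finset (Submodule k (Fin 4 → k)))
    (hs : ∀ M ∈ s, Module.finrank k M = 2) :
    ∃ c, c ∉ L ∧ ∀ M ∈ s, M ≠ L → ¬ M ≤ L ⊔ Submodule.span k {c} := by
  classical
  obtain ⟨c, hc⟩ := exists_notMem_of_finite (insert L s)
    (fun M => if Module.finrank k (L ⊔ M : Submodule k _) < 4 then L ⊔ M else L) (by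
      intro M _
      by_cases h : Module.finrank k (L ⊔ M : Submodule k _) < 4
      · rwa [if_pos h]
      · rw [if_neg h, hL]
        omega)
  have hcL : c ∉ L := by
    have := hc L (Finset.mem_insert_self _ _)
    rwa [sup_idem, if_pos (by omega)] at this
  refine ⟨c, hcL, fun M hM hne hle => ?_⟩
  have h3 := finrank_sup_span_singleton_le L c
  have hle' : L ⊔ M ≤ L ⊔ Submodule.span k {c} := sup_le le_sup_left hle
  have h4 := Submodule.finrank_mono hle'
  have h5 := lt_finrank_sup (hL.trans (hs M hM).symm).le hne
  have h6 := hc M (Finset.mem_insert_of_mem hM)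
  rw [if_pos (by omega), Submodule.eq_of_le_of_finrank_le hle' (by omega)] at h6
  exact h6 (Submodule.mem_sup_right (Submodule.mem_span_singleton_self c))

lemma IsSmoothSurface.hasFewPlanes [IsAlgClosed k] (hf : IsSmoothSurface f (m + 1)) (hm : 2 ≤ m)
    (hcount : {W | IsLineOn f W}.ncard = (m + 1) * (m ^ 3 + 1)) {L : Submodule k (Fin 4 → k)}
    (hL : IsLineOn f L) : HasFewPlanes f m L := by
  classical
  have : Infinite k := IsAlgClosed.instInfinite
  have hfin : {W | IsLineOn f W}.Finite := Set.finite_of_ncard_pos (by rw [hcount]; positivity)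
  obtain ⟨c, hc, hinf⟩ := exists_notMem_sup_of_finite hL.1 hfin.toFinset fun M hM =>
    ((Set.Finite.mem_toFinset hfin).1 hM).1
  replace hinf : ∀ M, IsLineOn f M → M ≠ L → ¬ M ≤ L ⊔ Submodule.span k {c} := fun M hM =>
    hinf M ((Set.Finite.mem_toFinset hfin).2 hM)
  obtain ⟨a, b, ha, hb, rfl⟩ := exists_span_pair_eq hL.1
  obtain ⟨e, he⟩ := exists_notMem_span' a b c
  by_cases hDa : ∃ v, dirDeriv f v a ≠ 0
  · exact hasFewPlanes_of_basis hf hm hcount ha hb hc he hL hinf hDa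
  by_cases hDb : ∃ v, dirDeriv f v b ≠ 0
  · have hba : a ∉ Submodule.span k {b} := by
      intro h
      obtain ⟨t, rfl⟩ := Submodule.mem_span_singleton.1 h
      refine hb (Submodule.mem_span_singleton.2 ⟨t⁻¹, ?_⟩)
      rw [smul_smul, inv_mul_cancel₀ (left_ne_zero_of_smul ha), one_smul]
    have hb0 : b ≠ 0 := fun h => hb (h ▸ Submodule.zero_mem _)
    rw [Set.insert_comm] at he
    rw [Set.pair_comm] at hc hL hinf ⊢
    exact hasFewPlanes_of_basis hf hm hcount hb0 hba hc he hL hinf hDb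
  push Not at hDa hDb
  exfalso
  obtain ⟨g, hg, hgv⟩ := dirDeriv_isHomogeneous hf.2.1 c
  obtain ⟨h, hh, hhv⟩ := dirDeriv_isHomogeneous hf.2.1 e
  obtain ⟨v, hv0, hv⟩ := exists_common_zero {f, g, h} Finset.card_le_three (by
    simp only [Finset.mem_insert, Finset.mem_singleton]
    rintro p (rfl | rfl | rfl)
    exacts [⟨m + 1, by omega, hf.2.1⟩, ⟨m + 1 - 1, by omega, hg⟩, ⟨m + 1 - 1, by omega, hh⟩])
  obtain ⟨i, hi⟩ := hf.exists_pderiv hv0 (hv f (by simp))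
  obtain ⟨T, hT⟩ := exists_linearEquiv_of_notMem ha hb hc he
  refine hi ?_
  have hzero : ∀ u, dirDeriv f v (T u) = 0 := by
    intro u
    rw [hT, dirDeriv_add_smul_right, dirDeriv_add_smul_right, dirDeriv_add_smul_right,
      ← hgv, ← hhv, hv g (by simp), hv h (by simp), hDb]
    have := dirDeriv_add_smul_right f v 0 a (u 0)
    rw [zero_add, hDa] at this
    rw [this]
    simp [dirDeriv]
  have := hzero (T.symm (Pi.single i 1))
  rw [T.apply_symm_apply, dirDeriv_single] at this
  exact this

end MeetingPlanes

section Count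

variable {k : Type*} [Field k] {f : MvPolynomial (Fin 4) k} {m : ℕ}

lemma card_lines_meeting_le [IsAlgClosed k] (hf : IsSmoothSurface f (m + 1)) (hm : 2 ≤ m)
    {L H₀ : Submodule k (Fin 4 → k)} (hL : IsLineOn f L) (hP : HasFewPlanes f m L)
    (hH₀ : H₀ ∈ meetingPlanes f L) (S : Finset (Submodule k (Fin 4 → k)))
    (hS : ∀ M ∈ S, IsLineOn f M ∧ ¬ M ≤ H₀ ∧ ∃ c ∈ L, c ∈ M ∧ c ≠ 0) :
    S.card ≤ m * ((meetingPlanes f L).ncard - 1) := by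
  classical
  obtain ⟨-, hfin, -, hsplit⟩ := hP
  have hcard : (hfin.toFinset.erase H₀).card = (meetingPlanes f L).ncard - 1 := by
    rw [Finset.card_erase_of_mem ((Set.Finite.mem_toFinset hfin).2 hH₀),
      Set.ncard_eq_toFinset_card _ hfin]
  have hne : ∀ M ∈ S, M ≠ L := by
    rintro M hM rfl
    exact (hS M hM).2.1 hH₀.2.1
  rw [← hcard]
  refine Finset.card_le_mul_card_image_of_maps_to (f := fun M => L ⊔ M) (fun M hM => ?_) m
    fun H hH => ?_
  · obtain ⟨h1, h2, c, hcL, hcM, hc⟩ := hS M hM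
    refine Finset.mem_erase.2 ⟨fun h => h2 (h ▸ le_sup_right), ?_⟩
    exact (Set.Finite.mem_toFinset hfin).2
      (mem_meetingPlanes_of_mem hL.1 h1 (hne M hM) hcL hcM hc)
  · have hH' := (Set.Finite.mem_toFinset hfin).1 (Finset.mem_of_mem_erase hH)
    have hn := (hf.lines_of_splitsOn (by omega) hH'.1 (hsplit H hH')).1
    have hfinH : {M | IsLineOn f M ∧ M ≤ H}.Finite := Set.finite_of_ncard_pos (by omega)
    rw [Set.ncard_eq_toFinset_card _ hfinH] at hn
    have hLH : L ∈ hfinH.toFinset := (Set.Finite.mem_toFinset hfinH).2 ⟨hL, hH'.2.1⟩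
    have hsub : S.filter (fun M => L ⊔ M = H) ⊆ hfinH.toFinset.erase L := by
      intro M hM
      obtain ⟨hMS, rfl⟩ := Finset.mem_filter.1 hM
      exact Finset.mem_erase.2 ⟨hne M hMS,
        (Set.Finite.mem_toFinset hfinH).2 ⟨(hS M hMS).1, le_sup_right⟩⟩
    have := Finset.card_le_card hsub
    rw [Finset.card_erase_of_mem hLH, hn] at this
    exact this

lemma exists_mem_inf_ne_zero {H M : Submodule k (Fin 4 → k)} (hH : Module.finrank k H = 3)
    (hM : Module.finrank k M = 2) : ∃ c ∈ H, c ∈ M ∧ c ≠ 0 := by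
  have h1 := Submodule.finrank_sup_add_finrank_inf_eq H M
  have h2 := Submodule.finrank_le (H ⊔ M)
  rw [Module.finrank_fin_fun] at h2
  have h3 : 0 < Module.finrank k (H ⊓ M : Submodule k _) := by omega
  rw [Module.finrank_pos_iff_exists_ne_zero] at h3
  obtain ⟨⟨c, hc⟩, hc0⟩ := h3
  exact ⟨c, hc.1, hc.2, fun h => hc0 (Subtype.ext h)⟩

lemma IsSmoothSurface.ncard_meetingPlanes [IsAlgClosed k] (hf : IsSmoothSurface f (m + 1))
    (hm : 2 ≤ m) (hcount : {W | IsLineOn f W}.ncard = (m + 1) * (m ^ 3 + 1))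
    {L : Submodule k (Fin 4 → k)} (hL : IsLineOn f L) :
    (meetingPlanes f L).ncard = m ^ 2 + 1 := by
  classical
  have hfin : {W | IsLineOn f W}.Finite := Set.finite_of_ncard_pos (by rw [hcount]; positivity)
  have hP : ∀ {M}, IsLineOn f M → HasFewPlanes f m M := fun hM => hf.hasFewPlanes hm hcount hM
  refine le_antisymm (hP hL).2.2.1 ?_
  by_contra! hlt
  obtain ⟨H₀, hH₀⟩ := (hP hL).1
  obtain ⟨hn, hcover⟩ := hf.lines_of_splitsOn (by omega) hH₀.1 ((hP hL).2.2.2 H₀ hH₀)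
  rw [Set.ncard_eq_toFinset_card _ hfin] at hcount
  set S := hfin.toFinset with hS
  have hSmem : ∀ {M}, M ∈ S ↔ IsLineOn f M := fun {M} => Set.Finite.mem_toFinset hfin
  set A := S.filter (fun M => M ≤ H₀) with hA
  have hAmem : ∀ {M}, M ∈ A ↔ IsLineOn f M ∧ M ≤ H₀ := fun {M} => by
    rw [hA, Finset.mem_filter, hSmem]
  have hAcard : A.card = m + 1 := by
    rw [← hn, ← Set.ncard_coe_finset]
    congr 1
    ext M
    exact hAmem
  let D : Submodule k (Fin 4 → k) → Finset (Submodule k (Fin 4 → k)) := fun M' =>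
    S.filter fun M => ¬ M ≤ H₀ ∧ ∃ c ∈ M', c ∈ M ∧ c ≠ 0
  have hD : ∀ M ∈ A, (D M).card ≤ m * ((meetingPlanes f M).ncard - 1) := by
    intro M hM
    refine card_lines_meeting_le hf hm (hAmem.1 hM).1 (hP (hAmem.1 hM).1) (H₀ := H₀)
      ⟨hH₀.1, (hAmem.1 hM).2, ?_⟩ _ fun M' hM' => ?_
    · obtain ⟨M', hM', hne⟩ := Finset.exists_mem_ne (s := A) (by omega) M
      exact ⟨M', (hAmem.1 hM').1, hne, (hAmem.1 hM').2⟩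
    · rw [Finset.mem_filter, hSmem] at hM'
      exact hM'
  have hsub : S ⊆ A ∪ A.biUnion D := by
    intro M hM
    have hMl := hSmem.1 hM
    by_cases hMH : M ≤ H₀
    · exact Finset.mem_union_left _ (hAmem.2 ⟨hMl, hMH⟩)
    obtain ⟨c, hcH, hcM, hc⟩ := exists_mem_inf_ne_zero hH₀.1 hMl.1
    obtain ⟨M', hM', hM'H, hcM'⟩ := hcover c hcH (hMl.2 c hcM)
    refine Finset.mem_union_right _ (Finset.mem_biUnion.2 ⟨M', hAmem.2 ⟨hM', hM'H⟩, ?_⟩)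
    exact Finset.mem_filter.2 ⟨hM, hMH, c, hcM', hcM, hc⟩
  have hLA : L ∈ A := hAmem.2 ⟨hL, hH₀.2.1⟩
  have hDL : (D L).card < m ^ 3 := by
    have h1 := hD L hLA
    have hpos : 0 < (meetingPlanes f L).ncard := (Set.ncard_pos (hP hL).2.1).2 ⟨H₀, hH₀⟩
    calc (D L).card ≤ m * ((meetingPlanes f L).ncard - 1) := h1
      _ < m * m ^ 2 := by
        refine Nat.mul_lt_mul_of_pos_left ?_ (by omega)
        omega
      _ = m ^ 3 := by ring
  have hsum : ∑ M ∈ A, (D M).card < ∑ _M ∈ A, m ^ 3 := by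
    refine Finset.sum_lt_sum (fun M hM => (hD M hM).trans ?_) ⟨L, hLA, hDL⟩
    calc m * ((meetingPlanes f M).ncard - 1) ≤ m * m ^ 2 :=
        Nat.mul_le_mul_left _ (by have := (hP (hAmem.1 hM).1).2.2.1; omega)
      _ = m ^ 3 := by ring
  rw [Finset.sum_const, hAcard, smul_eq_mul] at hsum
  have h1 := (Finset.card_le_card hsub).trans ((Finset.card_union_le _ _).trans
    (Nat.add_le_add_left Finset.card_biUnion_le _))
  rw [hcount, hAcard] at h1
  linarith

end Count

theorem planes_around_a_line {k : Type*} [Field k] [IsAlgClosed k] (d : ℕ) (hd : 3 ≤ d)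
    (f : MvPolynomial (Fin 4) k) (hf : IsSmoothSurface f d)
    (hcount : {W : Submodule k (Fin 4 → k) | IsLineOn f W}.ncard =
      d ^ 2 * (d ^ 2 - 3 * d + 3)) :
    ∀ L : Submodule k (Fin 4 → k), IsLineOn f L →
      ({H : Submodule k (Fin 4 → k) | Module.finrank k H = 3 ∧ L ≤ H ∧
          ∃ M : Submodule k (Fin 4 → k), IsLineOn f M ∧ M ≠ L ∧ M ≤ H}.ncard =
        d ^ 2 - 2 * d + 2) ∧
      ∀ H : Submodule k (Fin 4 → k), Module.finrank k H = 3 → L ≤ H →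
        (∃ M : Submodule k (Fin 4 → k), IsLineOn f M ∧ M ≠ L ∧ M ≤ H) →
        {M : Submodule k (Fin 4 → k) | IsLineOn f M ∧ M ≤ H}.ncard = d := by
  obtain ⟨n, rfl⟩ : ∃ n, d = n + 2 + 1 := ⟨d - 3, by omega⟩
  intro L hL
  have hcount' : {W | IsLineOn f W}.ncard = (n + 2 + 1) * ((n + 2) ^ 3 + 1) := by
    have : (n + 2 + 1) ^ 2 - 3 * (n + 2 + 1) = n ^ 2 + 3 * n := by
      rw [Nat.sub_eq_iff_eq_add (by nlinarith)]
      ring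
    rw [hcount, this]
    ring
  refine ⟨?_, fun H hH hLH hM => ?_⟩
  · have : (n + 2 + 1) ^ 2 - 2 * (n + 2 + 1) + 2 = (n + 2) ^ 2 + 1 := by
      have : (n + 2 + 1) ^ 2 - 2 * (n + 2 + 1) = n ^ 2 + 4 * n + 3 := by
        rw [Nat.sub_eq_iff_eq_add (by nlinarith)]
        ring
      rw [this]
      ring
    rw [this]
    exact hf.ncard_meetingPlanes (by omega) hcount' hL
  · exact (hf.lines_of_splitsOn (by omega) hH
      ((hf.hasFewPlanes (by omega) hcount' hL).2.2.2 H ⟨hH, hLH, hM⟩)).1
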